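/- Let u be a monotone traveling wave solution of the unbalanced Allen-Cahn equation in the plane connecting −1 to 1, with speed c. Then c ≥ c₀, and exactly one of the following holds: (a) u is planar, i.e. there exist ε ∈ {1, −1} and b ∈ ℝ with u(x,y) = g(y cos α + ε x sin α + b) for all (x,y), where α = arccos(c₀/c) ∈ [0, π/2); or (b) u is a V-shaped wave: there exists x₀ ∈ ℝ with u(x₀ + x, y) = u(x₀ − x, y) for all (x,y) and ∂u/∂x(x,y) < 0 for x > x₀, and any other non-planar solution with the same speed c coincides with u after a translation in x and y. -/

import Mathlib

open Real Filter MeasureTheory Metric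

noncomputable def pdx (u : ℝ → ℝ → ℝ) (x y : ℝ) : ℝ := deriv (fun t => u t y) x

noncomputable def pdy (u : ℝ → ℝ → ℝ) (x y : ℝ) : ℝ := deriv (fun t => u x t) y

noncomputable def pdxx (u : ℝ → ℝ → ℝ) (x y : ℝ) : ℝ := deriv (fun t => pdx u t y) x

noncomputable def pdyy (u : ℝ → ℝ → ℝ) (x y : ℝ) : ℝ := deriv (fun t => pdy u x t) y

/-- `F` is an unbalanced double-well potential. -/
def UnbalancedDoubleWell (F : ℝ → ℝ) : Prop :=
  ContDiff ℝ 3 F ∧ deriv F (-1) = 0 ∧ deriv F 1 = 0 ∧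
  0 < deriv (deriv F) (-1) ∧ 0 < deriv (deriv F) 1 ∧
  (∀ s ∈ Set.Ioo (-1 : ℝ) 0, 0 < deriv F s) ∧
  (∀ s ∈ Set.Ioo (0 : ℝ) 1, deriv F s < 0) ∧
  F (-1) = 0 ∧ 0 < F 1

/-- `u` is a `C³` solution of `Δu + c uᵧ = F'(u)` on `ℝ²` with `|u| ≤ 1`
which is monotone in `y`. -/
def IsSolution (F : ℝ → ℝ) (c : ℝ) (u : ℝ → ℝ → ℝ) : Prop :=
  ContDiff ℝ 3 (fun p : ℝ × ℝ => u p.1 p.2) ∧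
  (∀ x y : ℝ, pdxx u x y + pdyy u x y + c * pdy u x y = deriv F (u x y)) ∧
  (∀ x y : ℝ, |u x y| ≤ 1) ∧
  (∀ x y : ℝ, 0 < pdy u x y)

/-- A monotone traveling wave solution connecting `-1` to `1`. -/
def IsTravelingWave (F : ℝ → ℝ) (c : ℝ) (u : ℝ → ℝ → ℝ) : Prop :=
  IsSolution F c u ∧
  (∀ x : ℝ, Tendsto (fun y => u x y) atTop (nhds 1)) ∧
  (∀ x : ℝ, Tendsto (fun y => u x y) atBot (nhds (-1)))

/-- `u` is a planar wave: `u(x,y) = g(y cos α ± x sin α + b)`. -/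
def IsPlanar (g : ℝ → ℝ) (α : ℝ) (u : ℝ → ℝ → ℝ) : Prop :=
  ∃ ε : ℝ, (ε = 1 ∨ ε = -1) ∧ ∃ b : ℝ, ∀ x y : ℝ,
    u x y = g (y * Real.cos α + ε * x * Real.sin α + b)

/-- Pointwise two times differentiable in each variable, and jointly continuous. -/
structure IsC2 (w : ℝ → ℝ → ℝ) : Prop where
  dx : ∀ x y, HasDerivAt (fun t => w t y) (pdx w x y) x
  dy : ∀ x y, HasDerivAt (fun t => w x t) (pdy w x y) y
  dxx : ∀ x y, HasDerivAt (fun t => pdx w t y) (pdxx w x y) x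
  dyy : ∀ x y, HasDerivAt (fun t => pdy w x t) (pdyy w x y) y
  cont : Continuous (fun p : ℝ × ℝ => w p.1 p.2)

/-- The operator `Δ + c ∂/∂y`. -/
noncomputable def Lop (c : ℝ) (w : ℝ → ℝ → ℝ) (x y : ℝ) : ℝ :=
  pdxx w x y + pdyy w x y + c * pdy w x y

theorem pdx_of_hasDerivAt {w wx : ℝ → ℝ → ℝ}
    (hx : ∀ x y, HasDerivAt (fun t => w t y) (wx x y) x) : pdx w = wx := by
  funext x y; exact (hx x y).deriv

theorem pdy_of_hasDerivAt {w wy : ℝ → ℝ → ℝ}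
    (hy : ∀ x y, HasDerivAt (fun t => w x t) (wy x y) y) : pdy w = wy := by
  funext x y; exact (hy x y).deriv

theorem isC2_of_jet {w wx wy wxx wyy : ℝ → ℝ → ℝ}
    (hx : ∀ x y, HasDerivAt (fun t => w t y) (wx x y) x)
    (hy : ∀ x y, HasDerivAt (fun t => w x t) (wy x y) y)
    (hxx : ∀ x y, HasDerivAt (fun t => wx t y) (wxx x y) x)
    (hyy : ∀ x y, HasDerivAt (fun t => wy x t) (wyy x y) y)
    (hc : Continuous (fun p : ℝ × ℝ => w p.1 p.2)) :
    IsC2 w ∧ pdx w = wx ∧ pdy w = wy ∧ pdxx w = wxx ∧ pdyy w = wyy := by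
  have e1 := pdx_of_hasDerivAt hx
  have e2 := pdy_of_hasDerivAt hy
  have e3 : pdxx w = wxx := by
    funext x y
    have := (hxx x y).deriv
    simpa [pdxx, e1] using this
  have e4 : pdyy w = wyy := by
    funext x y
    have := (hyy x y).deriv
    simpa [pdyy, e2] using this
  refine ⟨⟨?_, ?_, ?_, ?_, hc⟩, e1, e2, e3, e4⟩
  · rw [e1]; exact hx
  · rw [e2]; exact hy
  · rw [e1, e3]; exact hxx
  · rw [e2, e4]; exact hyy

namespace IsC2

variable {w v : ℝ → ℝ → ℝ}

theorem add_jet (hw : IsC2 w) (hv : IsC2 v) (a b : ℝ) :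
    IsC2 (fun x y => a * w x y + b * v x y) ∧
    pdx (fun x y => a * w x y + b * v x y) = (fun x y => a * pdx w x y + b * pdx v x y) ∧
    pdy (fun x y => a * w x y + b * v x y) = (fun x y => a * pdy w x y + b * pdy v x y) ∧
    pdxx (fun x y => a * w x y + b * v x y) = (fun x y => a * pdxx w x y + b * pdxx v x y) ∧
    pdyy (fun x y => a * w x y + b * v x y) = (fun x y => a * pdyy w x y + b * pdyy v x y) :=
  isC2_of_jet (fun x y => ((hw.dx x y).const_mul a).add ((hv.dx x y).const_mul b))
    (fun x y => ((hw.dy x y).const_mul a).add ((hv.dy x y).const_mul b))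
    (fun x y => ((hw.dxx x y).const_mul a).add ((hv.dxx x y).const_mul b))
    (fun x y => ((hw.dyy x y).const_mul a).add ((hv.dyy x y).const_mul b))
    ((continuous_const.mul hw.cont).add (continuous_const.mul hv.cont))

theorem lin (hw : IsC2 w) (hv : IsC2 v) (a b : ℝ) :
    IsC2 (fun x y => a * w x y + b * v x y) := (hw.add_jet hv a b).1

theorem lop_lin (hw : IsC2 w) (hv : IsC2 v) (a b c x y : ℝ) :
    Lop c (fun x y => a * w x y + b * v x y) x y = a * Lop c w x y + b * Lop c v x y := by
  obtain ⟨-, -, h2, h3, h4⟩ := hw.add_jet hv a b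
  simp only [Lop, h2, h3, h4]; ring

theorem sub (hw : IsC2 w) (hv : IsC2 v) : IsC2 (fun x y => w x y - v x y) := by
  have := hw.lin hv 1 (-1)
  simpa [sub_eq_add_neg] using this

theorem lop_sub (hw : IsC2 w) (hv : IsC2 v) (c x y : ℝ) :
    Lop c (fun x y => w x y - v x y) x y = Lop c w x y - Lop c v x y := by
  have := hw.lop_lin hv 1 (-1) c x y
  simpa [sub_eq_add_neg] using this

theorem neg (hw : IsC2 w) : IsC2 (fun x y => - w x y) := by
  have := hw.lin hw (-1) 0
  simpa using this

theorem lop_neg (hw : IsC2 w) (c x y : ℝ) :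
    Lop c (fun x y => - w x y) x y = - Lop c w x y := by
  have := hw.lop_lin hw (-1) 0 c x y
  simpa using this

end IsC2

theorem isC2_const (a : ℝ) : IsC2 (fun _ _ => a) ∧ pdx (fun _ _ => a) = (fun _ _ => 0) ∧
    pdy (fun _ _ => a) = (fun _ _ => 0) ∧ pdxx (fun _ _ => a) = (fun _ _ => 0) ∧
    pdyy (fun _ _ => a) = (fun _ _ => 0) :=
  isC2_of_jet (fun _ _ => hasDerivAt_const _ _) (fun _ _ => hasDerivAt_const _ _)
    (fun _ _ => hasDerivAt_const _ _) (fun _ _ => hasDerivAt_const _ _) continuous_const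

theorem lop_const (c a x y : ℝ) : Lop c (fun _ _ => a) x y = 0 := by
  obtain ⟨-, -, h2, h3, h4⟩ := isC2_const a
  simp [Lop, h2, h3, h4]

theorem IsC2.shift_jet {w : ℝ → ℝ → ℝ} (hw : IsC2 w) (a b : ℝ) :
    IsC2 (fun x y => w (x + a) (y + b)) ∧
    pdx (fun x y => w (x + a) (y + b)) = (fun x y => pdx w (x + a) (y + b)) ∧
    pdy (fun x y => w (x + a) (y + b)) = (fun x y => pdy w (x + a) (y + b)) ∧
    pdxx (fun x y => w (x + a) (y + b)) = (fun x y => pdxx w (x + a) (y + b)) ∧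
    pdyy (fun x y => w (x + a) (y + b)) = (fun x y => pdyy w (x + a) (y + b)) :=
  isC2_of_jet
    (fun x y => (hw.dx (x + a) (y + b)).comp_add_const x a)
    (fun x y => (hw.dy (x + a) (y + b)).comp_add_const y b)
    (fun x y => (hw.dxx (x + a) (y + b)).comp_add_const x a)
    (fun x y => (hw.dyy (x + a) (y + b)).comp_add_const y b)
    (hw.cont.comp (f := fun p : ℝ × ℝ => (p.1 + a, p.2 + b)) (by fun_prop))

theorem IsC2.shift {w : ℝ → ℝ → ℝ} (hw : IsC2 w) (a b : ℝ) :
    IsC2 (fun x y => w (x + a) (y + b)) := (hw.shift_jet a b).1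

theorem IsC2.lop_shift {w : ℝ → ℝ → ℝ} (hw : IsC2 w) (a b c x y : ℝ) :
    Lop c (fun x y => w (x + a) (y + b)) x y = Lop c w (x + a) (y + b) := by
  obtain ⟨-, -, h2, h3, h4⟩ := hw.shift_jet a b
  simp only [Lop, h2, h3, h4]

theorem IsC2.reflect_jet {w : ℝ → ℝ → ℝ} (hw : IsC2 w) (a : ℝ) :
    IsC2 (fun x y => w (a - x) y) ∧
    pdx (fun x y => w (a - x) y) = (fun x y => - pdx w (a - x) y) ∧
    pdy (fun x y => w (a - x) y) = (fun x y => pdy w (a - x) y) ∧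
    pdxx (fun x y => w (a - x) y) = (fun x y => pdxx w (a - x) y) ∧
    pdyy (fun x y => w (a - x) y) = (fun x y => pdyy w (a - x) y) :=
  isC2_of_jet
    (fun x y => (hw.dx (a - x) y).comp_const_sub a x)
    (fun x y => hw.dy (a - x) y)
    (fun x y => by
      have := ((hw.dxx (a - x) y).comp_const_sub a x).neg
      rw [neg_neg] at this
      exact this)
    (fun x y => hw.dyy (a - x) y)
    (hw.cont.comp (f := fun p : ℝ × ℝ => (a - p.1, p.2)) (by fun_prop))

/-- Interchanging the two variables. -/
theorem IsC2.swap_jet {w : ℝ → ℝ → ℝ} (hw : IsC2 w) :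
    IsC2 (fun x y => w y x) ∧
    pdx (fun x y => w y x) = (fun x y => pdy w y x) ∧
    pdy (fun x y => w y x) = (fun x y => pdx w y x) ∧
    pdxx (fun x y => w y x) = (fun x y => pdyy w y x) ∧
    pdyy (fun x y => w y x) = (fun x y => pdxx w y x) :=
  isC2_of_jet (fun x y => hw.dy y x) (fun x y => hw.dx y x) (fun x y => hw.dyy y x)
    (fun x y => hw.dxx y x) (hw.cont.comp continuous_swap)

/-- Necessary conditions of first and second order at a local minimum. -/
theorem IsLocalMin.deriv_tests {φ φ1 : ℝ → ℝ} {φ2 x : ℝ}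
    (h1 : ∀ t, HasDerivAt φ (φ1 t) t) (h2 : HasDerivAt φ1 φ2 x) (hm : IsLocalMin φ x) :
    φ1 x = 0 ∧ 0 ≤ φ2 := by
  have e : φ1 x = 0 := hm.hasDerivAt_eq_zero (h1 x)
  refine ⟨e, ?_⟩
  by_contra hneg
  push Not at hneg
  have hd : deriv φ = φ1 := funext fun t => (h1 t).deriv
  have hmax : IsLocalMax φ x := by
    apply isLocalMax_of_deriv_deriv_neg
    · rw [hd, h2.deriv]; exact hneg
    · rw [hd, e]
    · exact (h1 x).continuousAt
  have hc : φ =ᶠ[nhds x] fun _ => φ x := by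
    filter_upwards [hm, hmax] with t h h' using le_antisymm h' h
  have hz : φ1 =ᶠ[nhds x] fun _ => 0 := by
    filter_upwards [hc.eventually_nhds] with t ht
    have := (h1 t).congr_of_eventuallyEq (f₁ := fun _ => φ x)
      (by filter_upwards [ht] with s hs using hs.symm)
    exact this.unique (hasDerivAt_const t _)
  have := h2.congr_of_eventuallyEq (f₁ := fun _ => (0 : ℝ))
    (by filter_upwards [hz] with s hs using hs.symm)
  have := this.unique (hasDerivAt_const x _)
  linarith

theorem IsClosed.exists_min_of_bounded {E : Type*} [PseudoMetricSpace E] [ProperSpace E]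
    {D : Set E} (hD : IsClosed D) {φ : E → ℝ} (hφ : Continuous φ) {p₀ : E} (hp : p₀ ∈ D)
    (o : E) (R : ℝ) (hR : ∀ p ∈ D, φ p ≤ φ p₀ → dist p o ≤ R) :
    ∃ p ∈ D, ∀ q ∈ D, φ p ≤ φ q := by
  have hK : IsCompact (closedBall o R ∩ D) := (isCompact_closedBall o R).inter_right hD
  obtain ⟨p, hp1, hp2⟩ := hK.exists_isMinOn ⟨p₀, hR p₀ hp le_rfl, hp⟩ hφ.continuousOn
  refine ⟨p, hp1.2, fun q hq => ?_⟩
  by_cases h : φ q ≤ φ p₀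
  · exact hp2 ⟨hR q hq h, hq⟩
  · exact (hp2 (show p₀ ∈ _ from ⟨hR p₀ hp le_rfl, hp⟩)).trans (not_le.1 h).le

/-- A smooth approximation of the absolute value. -/
noncomputable def bra (x : ℝ) : ℝ := √(1 + x ^ 2)

theorem bra_pos (x : ℝ) : 0 < bra x := Real.sqrt_pos.2 (by positivity)

theorem bra_sq (x : ℝ) : bra x ^ 2 = 1 + x ^ 2 := Real.sq_sqrt (by positivity)

theorem abs_le_bra (x : ℝ) : |x| ≤ bra x :=
  Real.abs_le_sqrt (by linarith)

theorem one_le_bra (x : ℝ) : 1 ≤ bra x :=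
  Real.one_le_sqrt.2 (by nlinarith [sq_nonneg x])

theorem continuous_bra : Continuous bra := by unfold bra; fun_prop

theorem hasDerivAt_bra (x : ℝ) : HasDerivAt bra (x / bra x) x := by
  have h : HasDerivAt (fun x : ℝ => 1 + x ^ 2) (2 * x) x := by
    simpa using (hasDerivAt_pow 2 x).const_add 1
  have h' : HasDerivAt bra (2 * x / (2 * bra x)) x := h.sqrt (by positivity)
  convert h' using 1
  have := (bra_pos x).ne'
  field_simp

theorem hasDerivAt_bra' (x : ℝ) : HasDerivAt (fun t => t / bra t) (1 / bra x ^ 3) x := by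
  have h' : HasDerivAt (fun t => t / bra t) ((1 * bra x - x * (x / bra x)) / bra x ^ 2) x :=
    (hasDerivAt_id x).div (hasDerivAt_bra x) (bra_pos x).ne'
  convert h' using 1
  have h := (bra_pos x).ne'
  have h2 := bra_sq x
  field_simp
  linarith

theorem abs_bra_deriv_le (x : ℝ) : |x / bra x| ≤ 1 := by
  rw [abs_div, abs_of_pos (bra_pos x), div_le_one (bra_pos x)]
  exact abs_le_bra x

theorem bra_deriv2_le (x : ℝ) : 1 / bra x ^ 3 ≤ 1 := by
  rw [div_le_one (by have := bra_pos x; positivity)]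
  exact one_le_pow₀ (one_le_bra x)

/-- Maximum principle on a closed, possibly unbounded, set. -/
theorem IsC2.nonneg_of_lop_le {D : Set (ℝ × ℝ)} (hD : IsClosed D) {Z : ℝ → ℝ → ℝ} (hZ : IsC2 Z)
    {A β c : ℝ} (hA : ∀ p ∈ D, -A ≤ Z p.1 p.2) (hβ : 0 < β)
    (h : ∀ p ∈ D, Z p.1 p.2 < 0 → D ∈ nhds p ∧ Lop c Z p.1 p.2 ≤ β * Z p.1 p.2) :
    ∀ p ∈ D, 0 ≤ Z p.1 p.2 := by
  intro p₀ hp₀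
  by_contra hneg
  push Not at hneg
  set δ := - Z p₀.1 p₀.2 / 2 with hδ
  have hδ0 : 0 < δ := by linarith
  set r₀ := bra p₀.1 + bra p₀.2 with hr₀
  have hr0 : 0 < r₀ := add_pos (bra_pos _) (bra_pos _)
  obtain ⟨η, hη, hη1, hη2⟩ : ∃ η > 0, η * r₀ ≤ δ ∧ η * (2 + |c|) < β * δ := by
    have hc2 : 0 < 2 + |c| := by positivity
    refine ⟨min (δ / r₀) (β * δ / (2 * (2 + |c|))), by positivity, ?_, ?_⟩
    · calc _ ≤ δ / r₀ * r₀ := by gcongr; exact min_le_left _ _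
        _ = δ := by field_simp
    · calc _ ≤ β * δ / (2 * (2 + |c|)) * (2 + |c|) := by gcongr; exact min_le_right _ _
        _ = β * δ / 2 := by field_simp
        _ < β * δ := by have := mul_pos hβ hδ0; linarith
  set φ : ℝ × ℝ → ℝ := fun p => Z p.1 p.2 + η * (bra p.1 + bra p.2) with hφ
  have hφc : Continuous φ := by
    have := hZ.cont
    have := continuous_bra
    simp only [hφ]; fun_prop
  have hφ0 : φ p₀ ≤ -δ := by simp only [hφ, ← hr₀]; linarith
  obtain ⟨p, hpD, hmin⟩ := hD.exists_min_of_bounded hφc hp₀ (0, 0) (A / η) (by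
    intro p hp hle
    have h1 := hA p hp
    have h2 : φ p ≤ 0 := by linarith
    simp only [hφ] at h2
    have h3 : bra p.1 + bra p.2 ≤ A / η := by
      rw [le_div_iff₀ hη]; linarith
    have := abs_le_bra p.1
    have := abs_le_bra p.2
    have := bra_pos p.1
    have := bra_pos p.2
    rw [Prod.dist_eq]
    simp only [Real.dist_eq, sub_zero]
    exact max_le (by linarith) (by linarith))
  have hφp : φ p ≤ -δ := (hmin p₀ hp₀).trans hφ0
  have hbp : 0 < η * (bra p.1 + bra p.2) := mul_pos hη (add_pos (bra_pos _) (bra_pos _))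
  have hZp : Z p.1 p.2 ≤ -δ := by simp only [hφ] at hφp; linarith
  obtain ⟨hnhds, hL⟩ := h p hpD (by linarith)
  have hloc : IsLocalMin φ p := by
    filter_upwards [hnhds] with q hq using hmin q hq
  have hx : IsLocalMin (fun t => Z t p.2 + η * (bra t + bra p.2)) p.1 := by
    have hcont : ContinuousAt (fun t : ℝ => (t, p.2)) p.1 := by fun_prop
    exact hcont.eventually hloc
  have hy : IsLocalMin (fun t => Z p.1 t + η * (bra p.1 + bra t)) p.2 := by
    have hcont : ContinuousAt (fun t : ℝ => (p.1, t)) p.2 := by fun_prop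
    exact hcont.eventually hloc
  obtain ⟨-, tx⟩ := hx.deriv_tests
    (fun t => (hZ.dx t p.2).add (((hasDerivAt_bra t).add_const _).const_mul η))
    ((hZ.dxx p.1 p.2).add ((hasDerivAt_bra' p.1).const_mul η))
  obtain ⟨ty1, ty⟩ := hy.deriv_tests
    (fun t => (hZ.dy p.1 t).add (((hasDerivAt_bra t).const_add _).const_mul η))
    ((hZ.dyy p.1 p.2).add ((hasDerivAt_bra' p.2).const_mul η))
  have b1 := bra_deriv2_le p.1
  have b2 := bra_deriv2_le p.2
  have b3 := abs_bra_deriv_le p.2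
  have b4 : c * pdy Z p.1 p.2 ≥ - (η * |c|) := by
    have : pdy Z p.1 p.2 = - (η * (p.2 / bra p.2)) := by linarith
    rw [this]
    have : |c * (p.2 / bra p.2)| ≤ |c| * 1 := by rw [abs_mul]; gcongr
    have := (abs_le.1 this).2
    nlinarith
  have : Lop c Z p.1 p.2 ≥ - (η * (2 + |c|)) := by
    unfold Lop
    nlinarith
  nlinarith

set_option maxHeartbeats 800000 in
/-- Quantitative strong maximum principle: positivity in a small disc propagates. -/
theorem exists_growth_const {c L ρ D₁ D η : ℝ} (hρ : 0 < ρ) (hD₁ : 0 ≤ D₁) (hD : D₁ < D)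
    (hη : 0 < η) (hL : 0 ≤ L) :
    ∃ η' > 0, ∀ (w : ℝ → ℝ → ℝ) (a b : ℝ), IsC2 w →
      (∀ x y, (x - a) ^ 2 + (y - b) ^ 2 ≤ D ^ 2 → 0 ≤ w x y ∧ Lop c w x y ≤ L * w x y) →
      (∀ x y, (x - a) ^ 2 + (y - b) ^ 2 ≤ ρ ^ 2 → η ≤ w x y) →
      ∀ x y, (x - a) ^ 2 + (y - b) ^ 2 ≤ D₁ ^ 2 → η' ≤ w x y := by
  have hD0 : 0 < D := by linarith
  set A : ℝ := (L + 4 + 2 * |c| * D) / (4 * ρ ^ 2) + 1 with hA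
  have hA1 : 1 ≤ A := by
    have : 0 ≤ (L + 4 + 2 * |c| * D) / (4 * ρ ^ 2) := by positivity
    linarith
  have hA2 : L + A * (4 + 2 * |c| * D) ≤ 4 * A ^ 2 * ρ ^ 2 := by
    have h1 : L + 4 + 2 * |c| * D ≤ 4 * A * ρ ^ 2 := by
      have : (L + 4 + 2 * |c| * D) / (4 * ρ ^ 2) * (4 * ρ ^ 2) = L + 4 + 2 * |c| * D := by
        field_simp
      have h3 : 0 < ρ ^ 2 := by positivity
      rw [hA]; nlinarith
    have h2 : L ≤ A * L := by nlinarith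
    nlinarith
  refine ⟨η * (exp (-A * D₁ ^ 2) - exp (-A * D ^ 2)), ?_, ?_⟩
  · have : exp (-A * D ^ 2) < exp (-A * D₁ ^ 2) := by
      apply exp_lt_exp.2
      have : D₁ ^ 2 < D ^ 2 := by nlinarith
      nlinarith
    exact mul_pos hη (by linarith)
  intro w a b hw hpos hball
  set E : ℝ → ℝ → ℝ := fun x y => exp (-A * ((x - a) ^ 2 + (y - b) ^ 2)) with hE
  have key : ∀ x y, (x - a) ^ 2 + (y - b) ^ 2 ≤ D ^ 2 →
      0 ≤ w x y - η * (E x y - exp (-A * D ^ 2)) := by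
    by_contra hcon
    push Not at hcon
    obtain ⟨x₀, y₀, hin, hneg⟩ := hcon
    have hcl : IsClosed {p : ℝ × ℝ | (p.1 - a) ^ 2 + (p.2 - b) ^ 2 ≤ D ^ 2} :=
      isClosed_le (by fun_prop) continuous_const
    have hφc : Continuous (fun p : ℝ × ℝ => w p.1 p.2 - η * (E p.1 p.2 - exp (-A * D ^ 2))) := by
      have := hw.cont
      simp only [hE]; fun_prop
    obtain ⟨⟨p, q⟩, hpD, hmin⟩ := hcl.exists_min_of_bounded hφc (p₀ := (x₀, y₀)) hin (a, b) D (by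
      rintro ⟨x, y⟩ hxy -
      simp only [Set.mem_ofPred_eq] at hxy
      rw [Prod.dist_eq]
      simp only [Real.dist_eq]
      apply max_le
      · exact abs_le_of_sq_le_sq (by nlinarith [sq_nonneg (y - b)]) hD0.le
      · exact abs_le_of_sq_le_sq (by nlinarith [sq_nonneg (x - a)]) hD0.le)
    simp only [Set.mem_ofPred_eq] at hpD
    have hmneg : w p q - η * (E p q - exp (-A * D ^ 2)) < 0 :=
      (hmin (x₀, y₀) hin).trans_lt hneg
    obtain ⟨hw0, hwL⟩ := hpos p q hpD
    have hlt : (p - a) ^ 2 + (q - b) ^ 2 < D ^ 2 := by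
      refine lt_of_le_of_ne hpD fun heq => ?_
      simp only [hE, heq] at hmneg
      linarith
    have hgt : ρ ^ 2 < (p - a) ^ 2 + (q - b) ^ 2 := by
      by_contra hle
      push Not at hle
      have h1 := hball p q hle
      have h2 : E p q ≤ 1 := by
        simp only [hE]; rw [exp_le_one_iff]
        have : 0 ≤ (p - a) ^ 2 + (q - b) ^ 2 := by positivity
        nlinarith
      have h3 := exp_pos (-A * D ^ 2)
      nlinarith
    have hnhds : {p : ℝ × ℝ | (p.1 - a) ^ 2 + (p.2 - b) ^ 2 ≤ D ^ 2} ∈ nhds (p, q) := by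
      have : IsOpen {p : ℝ × ℝ | (p.1 - a) ^ 2 + (p.2 - b) ^ 2 < D ^ 2} :=
        isOpen_lt (by fun_prop) continuous_const
      refine mem_of_superset (this.mem_nhds hlt) fun z hz => ?_
      rw [Set.mem_ofPred_eq] at *
      exact hz.le
    have hloc : IsLocalMin (fun p : ℝ × ℝ => w p.1 p.2 - η * (E p.1 p.2 - exp (-A * D ^ 2)))
        (p, q) := by
      filter_upwards [hnhds] with z hz using hmin z hz
    have hx : IsLocalMin (fun t => w t q - η * (E t q - exp (-A * D ^ 2))) p := by
      have hcont : ContinuousAt (fun t : ℝ => (t, q)) p := by fun_prop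
      exact hcont.eventually hloc
    have hy : IsLocalMin (fun t => w p t - η * (E p t - exp (-A * D ^ 2))) q := by
      have hcont : ContinuousAt (fun t : ℝ => (p, t)) q := by fun_prop
      exact hcont.eventually hloc
    have dl : ∀ (t s : ℝ), HasDerivAt (fun t : ℝ => t - s) 1 t := fun t s =>
      (hasDerivAt_id t).sub_const s
    have dE : ∀ (k s t : ℝ), HasDerivAt (fun t => exp (-A * ((t - s) ^ 2 + k)))
        (-2 * A * (t - s) * exp (-A * ((t - s) ^ 2 + k))) t := by
      intro k s t
      refine ((((dl t s).pow 2).add_const k).const_mul (-A)).exp.congr_deriv ?_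
      simp only [Pi.pow_apply]
      push_cast
      ring
    have dE2 : ∀ (k s t : ℝ), HasDerivAt (fun t => -2 * A * (t - s) * exp (-A * ((t - s) ^ 2 + k)))
        ((4 * A ^ 2 * (t - s) ^ 2 - 2 * A) * exp (-A * ((t - s) ^ 2 + k))) t := by
      intro k s t
      refine (((dl t s).const_mul (-2 * A)).mul (dE k s t)).congr_deriv ?_
      ring
    have hEy : ∀ t, E p t = exp (-A * ((t - b) ^ 2 + (p - a) ^ 2)) := by
      intro t; simp only [hE]; rw [add_comm]
    simp only [hEy] at hy
    obtain ⟨-, tx⟩ := hx.deriv_tests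
      (fun t => (hw.dx t q).sub (((dE ((q - b) ^ 2) a t).sub_const _).const_mul η))
      ((hw.dxx p q).sub ((dE2 ((q - b) ^ 2) a p).const_mul η))
    obtain ⟨ty1, ty⟩ := hy.deriv_tests
      (fun t => (hw.dy p t).sub (((dE ((p - a) ^ 2) b t).sub_const _).const_mul η))
      ((hw.dyy p q).sub ((dE2 ((p - a) ^ 2) b q).const_mul η))
    rw [← hEy q] at ty ty1
    change 0 ≤ pdxx w p q - η * ((4 * A ^ 2 * (p - a) ^ 2 - 2 * A) * E p q) at tx
    have hEpos : 0 < E p q := exp_pos _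
    have hqb : |q - b| ≤ D := abs_le_of_sq_le_sq (by nlinarith [sq_nonneg (p - a)]) hD0.le
    have hcq : c * (q - b) ≤ |c| * D := by
      calc c * (q - b) ≤ |c * (q - b)| := le_abs_self _
        _ = |c| * |q - b| := abs_mul _ _
        _ ≤ |c| * D := by gcongr
    have hLop : Lop c w p q ≥ η * E p q * (4 * A ^ 2 * ((p - a) ^ 2 + (q - b) ^ 2) - 4 * A
        - 2 * A * (c * (q - b))) := by
      have : pdy w p q = η * (-2 * A * (q - b) * E p q) := by linarith
      unfold Lop
      rw [this]
      nlinarith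
    have h5 : L ≤ 4 * A ^ 2 * ((p - a) ^ 2 + (q - b) ^ 2) - 4 * A - 2 * A * (c * (q - b)) := by
      have h6 : 4 * A ^ 2 * ρ ^ 2 ≤ 4 * A ^ 2 * ((p - a) ^ 2 + (q - b) ^ 2) := by gcongr
      have h7 : 2 * A * (c * (q - b)) ≤ 2 * A * (|c| * D) := by gcongr
      linarith
    have h8 : η * E p q * L ≤ Lop c w p q := by
      refine le_trans ?_ hLop
      gcongr
    have h9 : w p q < η * E p q := by
      have := mul_pos hη (exp_pos (-A * D ^ 2))
      linarith
    rcases hL.eq_or_lt with h0 | h0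
    · have h10 : 0 < 4 * A ^ 2 * ((p - a) ^ 2 + (q - b) ^ 2) - 4 * A - 2 * A * (c * (q - b)) := by
        have h6 : 4 * A ^ 2 * ρ ^ 2 < 4 * A ^ 2 * ((p - a) ^ 2 + (q - b) ^ 2) := by gcongr
        have h7 : 2 * A * (c * (q - b)) ≤ 2 * A * (|c| * D) := by gcongr
        linarith
      have := mul_pos (mul_pos hη hEpos) h10
      rw [← h0] at hwL
      linarith
    · have : L * w p q < L * (η * E p q) := by gcongr
      linarith
  intro x y hxy
  have h1 := key x y (hxy.trans (by nlinarith))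
  have h2 : exp (-A * D₁ ^ 2) ≤ E x y := by
    simp only [hE]; apply exp_le_exp.2
    nlinarith
  have h3 : η * (exp (-A * D₁ ^ 2) - exp (-A * D ^ 2)) ≤ η * (E x y - exp (-A * D ^ 2)) := by
    gcongr
  linarith

/-- Strong maximum principle on a connected open set. -/
theorem IsC2.eq_zero_of_preconnected {Ω : Set (ℝ × ℝ)} (hΩ : IsOpen Ω) (hconn : IsPreconnected Ω)
    {w : ℝ → ℝ → ℝ} (hw : IsC2 w) {c L : ℝ} (hL : 0 ≤ L)
    (h : ∀ p ∈ Ω, 0 ≤ w p.1 p.2 ∧ Lop c w p.1 p.2 ≤ L * w p.1 p.2)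
    {p₀ : ℝ × ℝ} (hp₀ : p₀ ∈ Ω) (hz : w p₀.1 p₀.2 = 0) : ∀ p ∈ Ω, w p.1 p.2 = 0 := by
  set W : Set (ℝ × ℝ) := {p | w p.1 p.2 ≠ 0} with hW
  have hWo : IsOpen W := isOpen_ne.preimage hw.cont
  set V : Set (ℝ × ℝ) := {p | p ∈ Ω ∧ w p.1 p.2 = 0} with hV
  have hVo : IsOpen V := by
    rw [Metric.isOpen_iff]
    rintro ⟨a, b⟩ ⟨hab, hab0⟩
    obtain ⟨r, hr, hball⟩ := Metric.isOpen_iff.1 hΩ (a, b) hab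
    have hsub : ∀ x y, (x - a) ^ 2 + (y - b) ^ 2 < r ^ 2 → (x, y) ∈ Ω := by
      intro x y hxy
      apply hball
      rw [mem_ball, Prod.dist_eq]
      simp only [Real.dist_eq]
      apply max_lt
      · exact abs_lt_of_sq_lt_sq (by nlinarith [sq_nonneg (y - b)]) hr.le
      · exact abs_lt_of_sq_lt_sq (by nlinarith [sq_nonneg (x - a)]) hr.le
    refine ⟨r / 8, by positivity, ?_⟩
    rintro ⟨s, t⟩ hst
    rw [mem_ball, Prod.dist_eq] at hst
    simp only [Real.dist_eq, max_lt_iff] at hst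
    have hs2 : (s - a) ^ 2 ≤ (r / 8) ^ 2 := sq_le_sq' (by have := (abs_lt.1 hst.1).1; linarith)
      (by have := (abs_lt.1 hst.1).2; linarith)
    have ht2 : (t - b) ^ 2 ≤ (r / 8) ^ 2 := sq_le_sq' (by have := (abs_lt.1 hst.2).1; linarith)
      (by have := (abs_lt.1 hst.2).2; linarith)
    have hstΩ : (s, t) ∈ Ω := hsub s t (by nlinarith)
    refine ⟨hstΩ, ?_⟩
    by_contra hne
    have hpos : 0 < w s t := lt_of_le_of_ne (h _ hstΩ).1 (Ne.symm hne)
    have hev : ∀ᶠ p : ℝ × ℝ in nhds (s, t), w s t / 2 < w p.1 p.2 :=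
      hw.cont.continuousAt.eventually (lt_mem_nhds (by simp only; linarith))
    obtain ⟨ρ, hρ, hρb⟩ := Metric.eventually_nhds_iff.1 hev
    obtain ⟨η', hη', hg⟩ := exists_growth_const (c := c) (L := L) (ρ := ρ / 2) (D₁ := r / 4)
      (D := r / 2) (η := w s t / 2) (by positivity) (by positivity) (by linarith) (by linarith) hL
    have := hg w s t hw (fun x y hxy => h (x, y) (hsub x y (by
        nlinarith [sq_nonneg ((x - s) - 3 * (s - a)), sq_nonneg ((y - t) - 3 * (t - b))])))
      (fun x y hxy => (hρb (y := (x, y)) (by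
        rw [Prod.dist_eq]
        simp only [Real.dist_eq]
        apply max_lt
        · exact abs_lt_of_sq_lt_sq (by nlinarith [sq_nonneg (y - t)]) hρ.le
        · exact abs_lt_of_sq_lt_sq (by nlinarith [sq_nonneg (x - s)]) hρ.le)).le)
      a b (by nlinarith)
    linarith
  by_contra hcon
  push Not at hcon
  obtain ⟨p₁, hp₁, hne⟩ := hcon
  obtain ⟨p, -, hp1, hp2⟩ := hconn V W hVo hWo
    (fun p hp => by
      by_cases h0 : w p.1 p.2 = 0
      · exact Or.inl ⟨hp, h0⟩
      · exact Or.inr h0)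
    ⟨p₀, hp₀, hp₀, hz⟩ ⟨p₁, hp₁, hne⟩
  exact hp2 hp1.2

/-- Strong maximum principle on the plane. -/
theorem IsC2.eq_zero_of_nonneg {w : ℝ → ℝ → ℝ} (hw : IsC2 w) {c L : ℝ} (hL : 0 ≤ L)
    (h : ∀ x y, 0 ≤ w x y ∧ Lop c w x y ≤ L * w x y)
    {x₀ y₀ : ℝ} (hz : w x₀ y₀ = 0) (x y : ℝ) : w x y = 0 :=
  hw.eq_zero_of_preconnected isOpen_univ isPreconnected_univ hL (fun p _ => h p.1 p.2)
    (Set.mem_univ (x₀, y₀)) hz (x, y) (Set.mem_univ _)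

/-- Global gradient bound in the first variable, by doubling of variables. -/
theorem IsC2.pdx_le {w : ℝ → ℝ → ℝ} (hw : IsC2 w) {A B a b : ℝ} (hA : ∀ x y, |w x y| ≤ A)
    (hB : ∀ x y, |pdxx w x y + pdyy w x y + a * pdx w x y + b * pdy w x y| ≤ B) (x y : ℝ) :
    pdx w x y ≤ 2 * A + B + 1 := by
  have hA0 : 0 ≤ A := (abs_nonneg _).trans (hA 0 0)
  have hB0 : 0 ≤ B := (abs_nonneg _).trans (hB 0 0)
  set κ := 2 * A + B + 1 with hκ
  have key : ∀ x y, ∀ t ∈ Set.Icc (0 : ℝ) 1, w (x + t) y - w (x - t) y ≤ κ * (t * (2 - t)) := by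
    intro x₀ y₀ t₀ ht₀
    by_contra hcon
    push Not at hcon
    set δ := w (x₀ + t₀) y₀ - w (x₀ - t₀) y₀ - κ * (t₀ * (2 - t₀)) with hδ
    have hδ0 : 0 < δ := by linarith
    set r₀ := bra x₀ + bra y₀ with hr₀
    have hr0 : 0 < r₀ := add_pos (bra_pos _) (bra_pos _)
    obtain ⟨η, hη, hη1, hη2⟩ : ∃ η > 0, η * r₀ ≤ δ / 2 ∧ η * (1 + |a| + |b|) < 1 := by
      have hc2 : 0 < 1 + |a| + |b| := by positivity
      refine ⟨min (δ / 2 / r₀) (1 / (2 * (1 + |a| + |b|))), by positivity, ?_, ?_⟩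
      · calc _ ≤ δ / 2 / r₀ * r₀ := by gcongr; exact min_le_left _ _
          _ = δ / 2 := by field_simp
      · calc _ ≤ 1 / (2 * (1 + |a| + |b|)) * (1 + |a| + |b|) := by
              gcongr; exact min_le_right _ _
          _ = 1 / 2 := by field_simp
          _ < 1 := by norm_num
    set φ : ℝ × ℝ × ℝ → ℝ := fun p =>
      η * (bra p.1 + bra p.2.1) + κ * (p.2.2 * (2 - p.2.2))
        - (w (p.1 + p.2.2) p.2.1 - w (p.1 - p.2.2) p.2.1) with hφ
    have hφc : Continuous φ := by
      have := hw.cont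
      have h1 : Continuous fun p : ℝ × ℝ × ℝ => w (p.1 + p.2.2) p.2.1 :=
        hw.cont.comp (f := fun p : ℝ × ℝ × ℝ => (p.1 + p.2.2, p.2.1)) (by fun_prop)
      have h2 : Continuous fun p : ℝ × ℝ × ℝ => w (p.1 - p.2.2) p.2.1 :=
        hw.cont.comp (f := fun p : ℝ × ℝ × ℝ => (p.1 - p.2.2, p.2.1)) (by fun_prop)
      have := continuous_bra
      simp only [hφ]; fun_prop
    have hcl : IsClosed {p : ℝ × ℝ × ℝ | p.2.2 ∈ Set.Icc (0 : ℝ) 1} :=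
      isClosed_Icc.preimage (by fun_prop)
    have hφ0 : φ (x₀, y₀, t₀) < 0 := by simp only [hφ, ← hr₀]; linarith
    obtain ⟨⟨p, q, t⟩, ht, hmin⟩ := hcl.exists_min_of_bounded hφc (p₀ := (x₀, y₀, t₀)) ht₀
      (0, 0, 0) (max (2 * A / η) 1) (by
        rintro ⟨p, q, t⟩ ht hle
        simp only [Set.mem_ofPred_eq, Set.mem_Icc] at ht
        have h2 : φ (p, q, t) ≤ 0 := by linarith
        simp only [hφ] at h2
        have h3 : bra p + bra q ≤ 2 * A / η := by
          rw [le_div_iff₀ hη]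
          have := (abs_le.1 (hA (p + t) q)).2
          have := (abs_le.1 (hA (p - t) q)).1
          have : 0 ≤ κ * (t * (2 - t)) := by
            have : 0 ≤ t * (2 - t) := mul_nonneg ht.1 (by linarith)
            positivity
          linarith
        have := abs_le_bra p
        have := abs_le_bra q
        have := bra_pos p
        have := bra_pos q
        rw [Prod.dist_eq, Prod.dist_eq]
        simp only [Real.dist_eq, sub_zero]
        refine max_le (le_max_of_le_left (by linarith)) (max_le (le_max_of_le_left (by linarith))
          (le_max_of_le_right ?_))
        rw [abs_of_nonneg ht.1]; exact ht.2)
    simp only [Set.mem_ofPred_eq, Set.mem_Icc] at ht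
    have hφp : φ (p, q, t) < 0 := (hmin (x₀, y₀, t₀) ht₀).trans_lt hφ0
    have hbp : 0 < η * (bra p + bra q) := mul_pos hη (add_pos (bra_pos _) (bra_pos _))
    have ht0 : 0 < t := by
      refine lt_of_le_of_ne ht.1 fun h => ?_
      rw [← h] at hφp
      simp [hφ] at hφp
      linarith
    have ht1 : t < 1 := by
      refine lt_of_le_of_ne ht.2 fun h => ?_
      rw [h] at hφp
      simp only [hφ] at hφp
      have := (abs_le.1 (hA (p + 1) q)).2
      have := (abs_le.1 (hA (p - 1) q)).1
      linarith
    have hx : IsLocalMin (fun s => φ (s, q, t)) p :=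
      Eventually.of_forall fun s => hmin (s, q, t) ht
    have hy : IsLocalMin (fun s => φ (p, s, t)) q :=
      Eventually.of_forall fun s => hmin (p, s, t) ht
    have htt : IsLocalMin (fun s => φ (p, q, s)) t := by
      filter_upwards [Icc_mem_nhds ht0 ht1] with s hs using hmin (p, q, s) hs
    have e1 := hx.hasDerivAt_eq_zero
      ((((hasDerivAt_bra p).add_const (bra q)).const_mul η).add_const (κ * (t * (2 - t))) |>.sub
        (((hw.dx (p + t) q).comp_add_const p t).sub ((hw.dx (p - t) q).comp_sub_const p t)))
    obtain ⟨e2, e3⟩ := hy.deriv_tests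
      (fun s => (((hasDerivAt_bra s).const_add (bra p)).const_mul η).add_const (κ * (t * (2 - t)))
        |>.sub ((hw.dy (p + t) s).sub (hw.dy (p - t) s)))
      (((hasDerivAt_bra' q).const_mul η).sub ((hw.dyy (p + t) q).sub (hw.dyy (p - t) q)))
    have dpoly : ∀ s : ℝ, HasDerivAt (fun s => κ * (s * (2 - s))) (κ * (2 - 2 * s)) s := by
      intro s
      refine (((hasDerivAt_id s).mul ((hasDerivAt_id s).const_sub 2)).const_mul κ).congr_deriv ?_
      simp only [id]; ring
    have dpoly2 : HasDerivAt (fun s : ℝ => κ * (2 - 2 * s)) (-2 * κ) t := by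
      refine ((((hasDerivAt_id t).const_mul 2).const_sub 2).const_mul κ).congr_deriv ?_
      ring
    obtain ⟨e4, e5⟩ := htt.deriv_tests
      (fun s => ((dpoly s).const_add (η * (bra p + bra q))).sub
        (((hw.dx (p + s) q).comp_const_add p s).sub ((hw.dx (p - s) q).comp_const_sub p s)))
      (dpoly2.sub (((hw.dxx (p + t) q).comp_const_add p t).sub
        ((hw.dxx (p - t) q).comp_const_sub p t).neg))
    have b1 := bra_deriv2_le q
    have b2 := abs_bra_deriv_le p
    have b3 := abs_bra_deriv_le q
    have B1 := (abs_le.1 (hB (p + t) q)).1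
    have B2 := (abs_le.1 (hB (p - t) q)).2
    have ea : a * (pdx w (p + t) q - pdx w (p - t) q) ≤ η * |a| := by
      have : pdx w (p + t) q - pdx w (p - t) q = η * (p / bra p) := by linarith
      rw [this]
      have : |a * (p / bra p)| ≤ |a| * 1 := by rw [abs_mul]; gcongr
      have := (abs_le.1 this).2
      nlinarith
    have eb : b * (pdy w (p + t) q - pdy w (p - t) q) ≤ η * |b| := by
      have : pdy w (p + t) q - pdy w (p - t) q = η * (q / bra q) := by linarith
      rw [this]
      have : |b * (q / bra q)| ≤ |b| * 1 := by rw [abs_mul]; gcongr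
      have := (abs_le.1 this).2
      nlinarith
    have : η * (1 / bra q ^ 3) ≤ η * 1 := by gcongr
    linarith
  have hlim : HasDerivAt (fun t => w (x + t) y - w (x - t) y) (2 * pdx w x y) 0 := by
    have h1 : HasDerivAt (fun t => w (x + t) y) (pdx w x y) 0 :=
      HasDerivAt.comp_const_add x 0 (by simpa using hw.dx x y)
    have h2 : HasDerivAt (fun t => w (x - t) y) (-pdx w x y) 0 :=
      HasDerivAt.comp_const_sub x 0 (by simpa using hw.dx x y)
    refine (h1.sub h2).congr_deriv ?_
    ring
  have hs := hlim.tendsto_slope_zero_right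
  have hle : 2 * pdx w x y ≤ 2 * κ := by
    refine le_of_tendsto hs ?_
    filter_upwards [Ioo_mem_nhdsGT (show (0 : ℝ) < 1 by norm_num)] with t ht
    have h1 := key x y t ⟨ht.1.le, ht.2.le⟩
    simp only [zero_add, add_zero, sub_zero, sub_self, smul_eq_mul]
    rw [inv_mul_le_iff₀ ht.1]
    have hκ0 : 0 < κ := by positivity
    have : 0 ≤ κ * t ^ 2 := by positivity
    nlinarith
  linarith

theorem IsC2.abs_pdx_le {w : ℝ → ℝ → ℝ} (hw : IsC2 w) {A B a b : ℝ} (hA : ∀ x y, |w x y| ≤ A)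
    (hB : ∀ x y, |pdxx w x y + pdyy w x y + a * pdx w x y + b * pdy w x y| ≤ B) (x y : ℝ) :
    |pdx w x y| ≤ 2 * A + B + 1 := by
  obtain ⟨h0, h1, h2, h3, h4⟩ := hw.reflect_jet 0
  refine abs_le.2 ⟨?_, hw.pdx_le hA hB x y⟩
  have := h0.pdx_le (A := A) (B := B) (a := -a) (b := b) (fun x y => hA _ _) (fun x y => by
    rw [h1, h2, h3, h4]
    have := hB (0 - x) y
    simpa using this) (-x) y
  rw [h1] at this
  simp at this
  linarith

theorem IsC2.abs_pdy_le {w : ℝ → ℝ → ℝ} (hw : IsC2 w) {A B a b : ℝ} (hA : ∀ x y, |w x y| ≤ A)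
    (hB : ∀ x y, |pdxx w x y + pdyy w x y + a * pdx w x y + b * pdy w x y| ≤ B) (x y : ℝ) :
    |pdy w x y| ≤ 2 * A + B + 1 := by
  obtain ⟨h0, h1, h2, h3, h4⟩ := hw.swap_jet
  have := h0.abs_pdx_le (A := A) (B := B) (a := b) (b := a) (fun x y => hA _ _) (fun x y => by
    rw [h1, h2, h3, h4]
    have := hB y x
    convert this using 2
    ring) y x
  rwa [h1] at this

/-- Bounded and Lipschitz, both with constant `K`. -/
def BddLip (K : ℝ) (w : ℝ → ℝ → ℝ) : Prop :=
  (∀ x y, |w x y| ≤ K) ∧ ∀ x y x' y', |w x y - w x' y'| ≤ K * (|x - x'| + |y - y'|)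

theorem BddLip.mono {K K' : ℝ} (h : K ≤ K') {w : ℝ → ℝ → ℝ} (hw : BddLip K w) : BddLip K' w :=
  ⟨fun x y => (hw.1 x y).trans h, fun x y x' y' => (hw.2 x y x' y').trans (by gcongr)⟩

theorem BddLip.nonneg {K : ℝ} {w : ℝ → ℝ → ℝ} (hw : BddLip K w) : 0 ≤ K :=
  (abs_nonneg _).trans (hw.1 0 0)

theorem BddLip.lin {K K' : ℝ} {w v : ℝ → ℝ → ℝ} (hw : BddLip K w) (hv : BddLip K' v) (a b : ℝ) :
    BddLip (|a| * K + |b| * K') (fun x y => a * w x y + b * v x y) := by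
  constructor
  · intro x y
    calc |a * w x y + b * v x y| ≤ |a * w x y| + |b * v x y| := abs_add_le _ _
      _ = |a| * |w x y| + |b| * |v x y| := by rw [abs_mul, abs_mul]
      _ ≤ _ := by gcongr; exacts [hw.1 _ _, hv.1 _ _]
  · intro x y x' y'
    calc |a * w x y + b * v x y - (a * w x' y' + b * v x' y')|
        = |a * (w x y - w x' y') + b * (v x y - v x' y')| := by congr 1; ring
      _ ≤ |a * (w x y - w x' y')| + |b * (v x y - v x' y')| := abs_add_le _ _
      _ = |a| * |w x y - w x' y'| + |b| * |v x y - v x' y'| := by rw [abs_mul, abs_mul]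
      _ ≤ |a| * (K * (|x - x'| + |y - y'|)) + |b| * (K' * (|x - x'| + |y - y'|)) := by
          gcongr; exacts [hw.2 _ _ _ _, hv.2 _ _ _ _]
      _ = _ := by ring

theorem BddLip.continuous {K : ℝ} {w : ℝ → ℝ → ℝ} (hw : BddLip K w) :
    Continuous (fun p : ℝ × ℝ => w p.1 p.2) := by
  have hK := hw.nonneg
  apply LipschitzWith.continuous (K := (2 * K).toNNReal)
  refine LipschitzWith.of_dist_le_mul fun p q => ?_
  rw [Real.coe_toNNReal _ (by positivity), Real.dist_eq]
  refine (hw.2 _ _ _ _).trans ?_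
  have h1 : |p.1 - q.1| ≤ dist p q := by rw [Prod.dist_eq, ← Real.dist_eq]; exact le_max_left _ _
  have h2 : |p.2 - q.2| ≤ dist p q := by rw [Prod.dist_eq, ← Real.dist_eq]; exact le_max_right _ _
  nlinarith

theorem abs_sub_le_of_hasDerivAt {φ φ' : ℝ → ℝ} {K : ℝ} (h : ∀ t, HasDerivAt φ (φ' t) t)
    (hb : ∀ t, |φ' t| ≤ K) (s t : ℝ) : |φ s - φ t| ≤ K * |s - t| := by
  have := Convex.norm_image_sub_le_of_norm_hasDerivWithin_le (f := φ) (f' := φ') (C := K)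
    (s := Set.univ) (x := t) (y := s) (fun x _ => (h x).hasDerivWithinAt) (fun x _ => hb x)
    convex_univ (Set.mem_univ _) (Set.mem_univ _)
  simpa [Real.norm_eq_abs] using this

theorem bddLip_of_partial {w wx wy : ℝ → ℝ → ℝ} {K : ℝ}
    (hx : ∀ x y, HasDerivAt (fun t => w t y) (wx x y) x)
    (hy : ∀ x y, HasDerivAt (fun t => w x t) (wy x y) y)
    (h : ∀ x y, |w x y| ≤ K) (h1 : ∀ x y, |wx x y| ≤ K) (h2 : ∀ x y, |wy x y| ≤ K) :
    BddLip K w := by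
  refine ⟨h, fun x y x' y' => ?_⟩
  have e1 := abs_sub_le_of_hasDerivAt (fun t => hx t y) (fun t => h1 t y) x x'
  have e2 := abs_sub_le_of_hasDerivAt (fun t => hy x' t) (fun t => h2 x' t) y y'
  calc |w x y - w x' y'| = |(w x y - w x' y) + (w x' y - w x' y')| := by congr 1; ring
    _ ≤ |w x y - w x' y| + |w x' y - w x' y'| := abs_add_le _ _
    _ ≤ K * |x - x'| + K * |y - y'| := by gcongr
    _ = _ := by ring

theorem IsC2.grad_bound {w : ℝ → ℝ → ℝ} (hw : IsC2 w) {A B c : ℝ} (hA : ∀ x y, |w x y| ≤ A)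
    (hB : ∀ x y, |Lop c w x y| ≤ B) (x y : ℝ) :
    |pdx w x y| ≤ 2 * A + B + 1 ∧ |pdy w x y| ≤ 2 * A + B + 1 := by
  have : ∀ x y, |pdxx w x y + pdyy w x y + 0 * pdx w x y + c * pdy w x y| ≤ B := by
    intro x y
    have := hB x y
    simpa [Lop] using this
  exact ⟨hw.abs_pdx_le hA this x y, hw.abs_pdy_le hA this x y⟩

theorem IsC2.bddLip {w : ℝ → ℝ → ℝ} (hw : IsC2 w) {A B c : ℝ} (hA : ∀ x y, |w x y| ≤ A)
    (hB : ∀ x y, |Lop c w x y| ≤ B) : BddLip (2 * A + B + 1) w := by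
  have hA0 : 0 ≤ A := (abs_nonneg _).trans (hA 0 0)
  have hB0 : 0 ≤ B := (abs_nonneg _).trans (hB 0 0)
  exact bddLip_of_partial hw.dx hw.dy (fun x y => (hA x y).trans (by linarith))
    (fun x y => (hw.grad_bound hA hB x y).1) (fun x y => (hw.grad_bound hA hB x y).2)

theorem IsC2.grad_bddLip {w : ℝ → ℝ → ℝ} (hw : IsC2 w) {A B c : ℝ} (hA : BddLip A w)
    (hB : BddLip B (Lop c w)) :
    BddLip (2 * A + B + 1) (pdx w) ∧ BddLip (2 * A + B + 1) (pdy w) := by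
  have key : ∀ x y x' y', |pdx w x y - pdx w x' y'| ≤ (2 * A + B + 1) * (|x - x'| + |y - y'|) ∧
      |pdy w x y - pdy w x' y'| ≤ (2 * A + B + 1) * (|x - x'| + |y - y'|) := by
    intro x y x' y'
    set h := |x - x'| + |y - y'| with hh
    rcases (show 0 ≤ h by positivity).eq_or_lt with h0 | h0
    · have e1 : x - x' = 0 := abs_eq_zero.1 (by
        have := abs_nonneg (x - x'); have := abs_nonneg (y - y'); linarith)
      have e2 : y - y' = 0 := abs_eq_zero.1 (by
        have := abs_nonneg (x - x'); have := abs_nonneg (y - y'); linarith)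
      have e3 : x = x' := by linarith
      have e4 : y = y' := by linarith
      subst e3 e4
      rw [← h0]; simp
    obtain ⟨hs, s1, s2, -, -⟩ := hw.shift_jet (x - x') (y - y')
    obtain ⟨hv, v1, v2, -, -⟩ := hs.add_jet hw h⁻¹ (-h⁻¹)
    have hdist : ∀ p q : ℝ, |p + (x - x') - p| + |q + (y - y') - q| = h := by
      intro p q; rw [hh]; congr 2 <;> ring
    have b1 := hv.grad_bound (A := A) (B := B) (c := c) (fun p q => by
        have := hA.2 (p + (x - x')) (q + (y - y')) p q
        rw [hdist] at this
        rw [show h⁻¹ * w (p + (x - x')) (q + (y - y')) + -h⁻¹ * w p q =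
          h⁻¹ * (w (p + (x - x')) (q + (y - y')) - w p q) by ring, abs_mul,
          abs_of_pos (inv_pos.2 h0), inv_mul_le_iff₀ h0]
        linarith) (fun p q => by
        rw [hs.lop_lin hw, hw.lop_shift]
        have := hB.2 (p + (x - x')) (q + (y - y')) p q
        rw [hdist] at this
        rw [show h⁻¹ * Lop c w (p + (x - x')) (q + (y - y')) + -h⁻¹ * Lop c w p q =
          h⁻¹ * (Lop c w (p + (x - x')) (q + (y - y')) - Lop c w p q) by ring, abs_mul,
          abs_of_pos (inv_pos.2 h0), inv_mul_le_iff₀ h0]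
        linarith) x' y'
    rw [v1, v2, s1, s2] at b1
    simp only [add_sub_cancel] at b1
    have e : ∀ p q : ℝ, |h⁻¹ * p + -h⁻¹ * q| ≤ 2 * A + B + 1 → |p - q| ≤ (2 * A + B + 1) * h := by
      intro p q hpq
      rw [show h⁻¹ * p + -h⁻¹ * q = h⁻¹ * (p - q) by ring, abs_mul,
        abs_of_pos (inv_pos.2 h0), inv_mul_le_iff₀ h0] at hpq
      linarith
    exact ⟨e _ _ b1.1, e _ _ b1.2⟩
  exact ⟨⟨fun x y => (hw.grad_bound hA.1 hB.1 x y).1, fun x y x' y' => (key x y x' y').1⟩,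
    ⟨fun x y => (hw.grad_bound hA.1 hB.1 x y).2, fun x y x' y' => (key x y x' y').2⟩⟩

theorem hasDerivAt_pdx_fderiv {w : ℝ → ℝ → ℝ} (h : Differentiable ℝ (fun p : ℝ × ℝ => w p.1 p.2))
    (x y : ℝ) : HasDerivAt (fun t => w t y)
      (fderiv ℝ (fun p : ℝ × ℝ => w p.1 p.2) (x, y) (1, 0)) x := by
  have h1 : HasDerivAt (fun t : ℝ => (t, y)) (1, 0) x :=
    (hasDerivAt_id x).prodMk (hasDerivAt_const x y)
  exact (h (x, y)).hasFDerivAt.comp_hasDerivAt x h1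

theorem hasDerivAt_pdy_fderiv {w : ℝ → ℝ → ℝ} (h : Differentiable ℝ (fun p : ℝ × ℝ => w p.1 p.2))
    (x y : ℝ) : HasDerivAt (fun t => w x t)
      (fderiv ℝ (fun p : ℝ × ℝ => w p.1 p.2) (x, y) (0, 1)) y := by
  have h1 : HasDerivAt (fun t : ℝ => (x, t)) (0, 1) y :=
    (hasDerivAt_const y x).prodMk (hasDerivAt_id y)
  exact (h (x, y)).hasFDerivAt.comp_hasDerivAt y h1

theorem ContDiff.pdx_pdy {w : ℝ → ℝ → ℝ} {n : ℕ}
    (h : ContDiff ℝ (n + 1) (fun p : ℝ × ℝ => w p.1 p.2)) :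
    ContDiff ℝ n (fun p : ℝ × ℝ => pdx w p.1 p.2) ∧
    ContDiff ℝ n (fun p : ℝ × ℝ => pdy w p.1 p.2) := by
  have hd : Differentiable ℝ (fun p : ℝ × ℝ => w p.1 p.2) := h.differentiable (by simp)
  rw [pdx_of_hasDerivAt (hasDerivAt_pdx_fderiv hd), pdy_of_hasDerivAt (hasDerivAt_pdy_fderiv hd)]
  have := h.fderiv_right (m := n) le_rfl
  exact ⟨this.clm_apply contDiff_const, this.clm_apply contDiff_const⟩

theorem Differentiable.hasDerivAt_pd {w : ℝ → ℝ → ℝ}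
    (hd : Differentiable ℝ (fun p : ℝ × ℝ => w p.1 p.2)) :
    (∀ x y, HasDerivAt (fun t => w t y) (pdx w x y) x) ∧
    (∀ x y, HasDerivAt (fun t => w x t) (pdy w x y) y) := by
  rw [pdx_of_hasDerivAt (hasDerivAt_pdx_fderiv hd), pdy_of_hasDerivAt (hasDerivAt_pdy_fderiv hd)]
  exact ⟨hasDerivAt_pdx_fderiv hd, hasDerivAt_pdy_fderiv hd⟩

theorem ContDiff.isC2 {w : ℝ → ℝ → ℝ} (h : ContDiff ℝ 2 (fun p : ℝ × ℝ => w p.1 p.2)) :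
    IsC2 w := by
  obtain ⟨h1, h2⟩ := ContDiff.pdx_pdy (n := 1) h
  obtain ⟨a1, a2⟩ := (h.differentiable (by simp)).hasDerivAt_pd
  exact ⟨a1, a2, (h1.differentiable (by simp)).hasDerivAt_pd.1,
    (h2.differentiable (by simp)).hasDerivAt_pd.2, h.continuous⟩

theorem ContDiff.pdx_pdy_comm {w : ℝ → ℝ → ℝ} (h : ContDiff ℝ 2 (fun p : ℝ × ℝ => w p.1 p.2)) :
    pdx (pdy w) = pdy (pdx w) := by
  obtain ⟨h1, h2⟩ := ContDiff.pdx_pdy (n := 1) h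
  have hd : Differentiable ℝ (fun p : ℝ × ℝ => w p.1 p.2) := h.differentiable (by simp)
  have hf : Differentiable ℝ (fderiv ℝ (fun p : ℝ × ℝ => w p.1 p.2)) :=
    (h.fderiv_right (m := 1) le_rfl).differentiable (by simp)
  rw [pdx_of_hasDerivAt (hasDerivAt_pdx_fderiv (h2.differentiable (by simp))),
    pdy_of_hasDerivAt (hasDerivAt_pdy_fderiv (h1.differentiable (by simp))),
    pdx_of_hasDerivAt (hasDerivAt_pdx_fderiv hd), pdy_of_hasDerivAt (hasDerivAt_pdy_fderiv hd)]
  funext x y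
  have e : ∀ a : ℝ × ℝ, fderiv ℝ (fun p : ℝ × ℝ => fderiv ℝ (fun p : ℝ × ℝ => w p.1 p.2)
      (p.1, p.2) a) (x, y) = (fderiv ℝ (fderiv ℝ (fun p : ℝ × ℝ => w p.1 p.2)) (x, y)).flip a := by
    intro a
    have := ((hf (x, y)).hasFDerivAt.clm_apply (hasFDerivAt_const a (x, y))).fderiv
    simp only [Prod.mk.eta]
    rw [this]
    ext <;> simp
  rw [e, e]
  simp only [ContinuousLinearMap.flip_apply]
  exact (h.contDiffAt.isSymmSndFDerivAt (by simp)) (1, 0) (0, 1)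

/-- Lipschitz and size bounds for the nonlinearity and its derivative on `[-1, 1]`. -/
structure NonlinBound (f : ℝ → ℝ) (L : ℝ) : Prop where
  one_le : 1 ≤ L
  diff : ∀ s, HasDerivAt f (deriv f s) s
  bd : ∀ s, |s| ≤ 1 → |f s| ≤ L
  bd' : ∀ s, |s| ≤ 1 → |deriv f s| ≤ L
  lip : ∀ s t, |s| ≤ 1 → |t| ≤ 1 → |f s - f t| ≤ L * |s - t|
  lip' : ∀ s t, |s| ≤ 1 → |t| ≤ 1 → |deriv f s - deriv f t| ≤ L * |s - t|

theorem NonlinBound.pos {f : ℝ → ℝ} {L : ℝ} (h : NonlinBound f L) : 0 < L := by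
  linarith [h.one_le]

theorem exists_nonlinBound {f : ℝ → ℝ} (hf : ContDiff ℝ 2 f) : ∃ L, NonlinBound f L := by
  have hf1 : ContDiff ℝ 1 (deriv f) := by
    have := (contDiff_succ_iff_deriv (n := 1)).1 hf
    exact this.2.2
  have hf2 : Continuous (deriv (deriv f)) := by
    have := (contDiff_succ_iff_deriv (n := 0)).1 hf1
    exact this.2.2.continuous
  have hb : ∀ φ : ℝ → ℝ, Continuous φ → ∃ L, ∀ s, |s| ≤ 1 → |φ s| ≤ L := by
    intro φ hφ
    obtain ⟨L, hL⟩ := (isCompact_Icc (a := (-1 : ℝ)) (b := 1)).exists_bound_of_continuousOn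
      hφ.continuousOn
    exact ⟨L, fun s hs => hL s (abs_le.1 hs)⟩
  obtain ⟨L0, h0⟩ := hb f hf.continuous
  obtain ⟨L1, h1⟩ := hb _ hf1.continuous
  obtain ⟨L2, h2⟩ := hb _ hf2
  have m0 := le_max_left (1 : ℝ) (max L0 (max L1 L2))
  have m1 : L0 ≤ max (1 : ℝ) (max L0 (max L1 L2)) := by simp
  have m2 : L1 ≤ max (1 : ℝ) (max L0 (max L1 L2)) := by simp
  have m3 : L2 ≤ max (1 : ℝ) (max L0 (max L1 L2)) := by simp
  have hlip : ∀ φ : ℝ → ℝ, Differentiable ℝ φ → ∀ C, (∀ s, |s| ≤ 1 → |deriv φ s| ≤ C) →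
      ∀ s t, |s| ≤ 1 → |t| ≤ 1 → |φ s - φ t| ≤ C * |s - t| := by
    intro φ hφ C hC s t hs ht
    exact Convex.norm_image_sub_le_of_norm_deriv_le (f := φ) (s := Set.Icc (-1) 1)
      (fun x _ => hφ x) (fun x hx => hC x (abs_le.2 hx)) (convex_Icc _ _) (abs_le.1 ht)
      (abs_le.1 hs)
  refine ⟨max 1 (max L0 (max L1 L2)), m0, ?_, ?_, ?_, ?_, ?_⟩
  · exact fun s => (hf.differentiable (by simp) s).hasDerivAt
  · exact fun s hs => (h0 s hs).trans m1
  · exact fun s hs => (h1 s hs).trans m2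
  · exact hlip f (hf.differentiable (by simp)) _ (fun s hs => (h1 s hs).trans m2)
  · exact hlip _ (hf1.differentiable (by simp)) _ (fun s hs => (h2 s hs).trans m3)

/-- Uniform regularity up to second order. -/
structure Reg (K : ℝ) (w : ℝ → ℝ → ℝ) : Prop where
  c2 : IsC2 w
  b : BddLip K w
  bx : BddLip K (pdx w)
  by' : BddLip K (pdy w)
  bxx : BddLip K (pdxx w)
  byy : BddLip K (pdyy w)

/-- A `C²` function solving the linearised equation at `u`. -/
structure IsLinSol (f : ℝ → ℝ) (c K : ℝ) (u w : ℝ → ℝ → ℝ) : Prop where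
  c2 : IsC2 w
  b : BddLip K w
  bx : BddLip K (pdx w)
  by' : BddLip K (pdy w)
  eq : ∀ x y, Lop c w x y = deriv f (u x y) * w x y

theorem IsLinSol.lin {f : ℝ → ℝ} {c K K' : ℝ} {u w v : ℝ → ℝ → ℝ} (hw : IsLinSol f c K u w)
    (hv : IsLinSol f c K' u v) (a b : ℝ) :
    IsLinSol f c (|a| * K + |b| * K') u (fun x y => a * w x y + b * v x y) where
  c2 := hw.c2.lin hv.c2 a b
  b := hw.b.lin hv.b a b
  bx := by rw [(hw.c2.add_jet hv.c2 a b).2.1]; exact hw.bx.lin hv.bx a b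
  by' := by rw [(hw.c2.add_jet hv.c2 a b).2.2.1]; exact hw.by'.lin hv.by' a b
  eq := fun x y => by rw [hw.c2.lop_lin hv.c2, hw.eq, hv.eq]; ring

/-- Uniform regularity of entire bounded solutions. -/
theorem exists_reg {f : ℝ → ℝ} {L c : ℝ} (hf : NonlinBound f L) {u : ℝ → ℝ → ℝ}
    (hu : ContDiff ℝ 3 (fun p : ℝ × ℝ => u p.1 p.2)) (heq : ∀ x y, Lop c u x y = f (u x y))
    (hb : ∀ x y, |u x y| ≤ 1) :
    ∃ K, 1 ≤ K ∧ Reg K u ∧ IsLinSol f c K u (pdx u) ∧ IsLinSol f c K u (pdy u) ∧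
      pdx (pdy u) = pdy (pdx u) := by
  have hL := hf.pos
  have hu2 : ContDiff ℝ 2 (fun p : ℝ × ℝ => u p.1 p.2) := hu.of_le (by norm_cast)
  obtain ⟨ux2, uy2⟩ := ContDiff.pdx_pdy (n := 2) hu
  obtain ⟨uxx1, uxy1⟩ := ContDiff.pdx_pdy (n := 1) ux2
  obtain ⟨uyx1, uyy1⟩ := ContDiff.pdx_pdy (n := 1) uy2
  have hc := hu2.isC2
  have hcx := ContDiff.isC2 ux2
  have hcy := ContDiff.isC2 uy2
  have hcomm := hu2.pdx_pdy_comm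
  have eqx : ∀ x y, Lop c (pdx u) x y = deriv f (u x y) * pdx u x y := by
    intro x y
    have e1 : pdyy (pdx u) = pdx (pdyy u) := by
      change pdy (pdy (pdx u)) = pdx (pdy (pdy u))
      rw [← hcomm, ContDiff.pdx_pdy_comm uy2]
    have d1 := ((uxx1.differentiable (by simp)).hasDerivAt_pd).1 x y
    have d2 := ((uyy1.differentiable (by simp)).hasDerivAt_pd).1 x y
    have d3 := ((uy2.differentiable (by simp)).hasDerivAt_pd).1 x y
    have d4 : HasDerivAt (fun t => f (u t y)) (deriv f (u x y) * pdx u x y) x :=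
      (hf.diff (u x y)).comp x (hc.dx x y)
    have d5 := ((d1.add d2).add (d3.const_mul c))
    have : (fun t => f (u t y)) = fun t => pdx (pdx u) t y + pdy (pdy u) t y + c * pdy u t y := by
      funext t; exact (heq t y).symm
    rw [this] at d4
    have := d5.unique d4
    unfold Lop
    rw [e1, ← hcomm]
    exact this
  have eqy : ∀ x y, Lop c (pdy u) x y = deriv f (u x y) * pdy u x y := by
    intro x y
    have e1 : pdxx (pdy u) = pdy (pdxx u) := by
      change pdx (pdx (pdy u)) = pdy (pdx (pdx u))
      rw [hcomm, ContDiff.pdx_pdy_comm ux2]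
    have d1 := ((uxx1.differentiable (by simp)).hasDerivAt_pd).2 x y
    have d2 := ((uyy1.differentiable (by simp)).hasDerivAt_pd).2 x y
    have d3 := ((uy2.differentiable (by simp)).hasDerivAt_pd).2 x y
    have d4 : HasDerivAt (fun t => f (u x t)) (deriv f (u x y) * pdy u x y) y :=
      (hf.diff (u x y)).comp y (hc.dy x y)
    have d5 := ((d1.add d2).add (d3.const_mul c))
    have : (fun t => f (u x t)) = fun t => pdx (pdx u) x t + pdy (pdy u) x t + c * pdy u x t := by
      funext t; exact (heq x t).symm
    rw [this] at d4
    have := d5.unique d4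
    unfold Lop
    rw [e1]
    exact this
  set K1 : ℝ := 2 * 1 + L + 1 with hK1
  have g1 := hc.grad_bound (A := 1) (B := L) (c := c) hb
    (fun x y => by rw [heq]; exact hf.bd _ (hb x y))
  have L1 : BddLip K1 u := hc.bddLip (A := 1) (B := L) (c := c) hb
    (fun x y => by rw [heq]; exact hf.bd _ (hb x y))
  have hK10 : 0 ≤ K1 := L1.nonneg
  have hprod : ∀ w : ℝ → ℝ → ℝ, (∀ x y, |w x y| ≤ K1) → ∀ x y,
      |deriv f (u x y) * w x y| ≤ L * K1 := by
    intro w hw x y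
    rw [abs_mul]
    exact mul_le_mul (hf.bd' _ (hb x y)) (hw x y) (abs_nonneg _) hL.le
  set K2 : ℝ := 2 * K1 + L * K1 + 1 with hK2
  have L2x : BddLip K2 (pdx u) := hcx.bddLip (c := c) (fun x y => (g1 x y).1)
    (fun x y => by rw [eqx]; exact hprod _ (fun x y => (g1 x y).1) x y)
  have L2y : BddLip K2 (pdy u) := hcy.bddLip (c := c) (fun x y => (g1 x y).2)
    (fun x y => by rw [eqy]; exact hprod _ (fun x y => (g1 x y).2) x y)
  have hK12 : K1 ≤ K2 := by nlinarith
  have hlin : ∀ w : ℝ → ℝ → ℝ, BddLip K2 w →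
      BddLip (L * K2 + L * K1 * K2) (fun x y => deriv f (u x y) * w x y) := by
    intro w hw
    have hK20 := hw.nonneg
    refine ⟨fun x y => ?_, fun x y x' y' => ?_⟩
    · rw [abs_mul]
      refine (mul_le_mul (hf.bd' _ (hb x y)) (hw.1 x y) (abs_nonneg _) hL.le).trans ?_
      have : 0 ≤ L * K1 * K2 := by positivity
      linarith
    · calc |deriv f (u x y) * w x y - deriv f (u x' y') * w x' y'|
          = |deriv f (u x y) * (w x y - w x' y') + (deriv f (u x y) - deriv f (u x' y')) * w x' y'|
            := by congr 1; ring
        _ ≤ |deriv f (u x y) * (w x y - w x' y')|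
            + |(deriv f (u x y) - deriv f (u x' y')) * w x' y'| := abs_add_le _ _
        _ = |deriv f (u x y)| * |w x y - w x' y'|
            + |deriv f (u x y) - deriv f (u x' y')| * |w x' y'| := by rw [abs_mul, abs_mul]
        _ ≤ L * (K2 * (|x - x'| + |y - y'|)) + L * (K1 * (|x - x'| + |y - y'|)) * K2 := by
          gcongr
          · exact hf.bd' _ (hb x y)
          · exact hw.2 _ _ _ _
          · refine (hf.lip' _ _ (hb x y) (hb x' y')).trans ?_
            gcongr
            exact L1.2 _ _ _ _
          · exact hw.1 _ _
        _ = _ := by ring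
  have L3x := hcx.grad_bddLip (c := c) L2x (B := L * K2 + L * K1 * K2) (by
    have := hlin _ L2x
    rwa [show Lop c (pdx u) = fun x y => deriv f (u x y) * pdx u x y from
      funext fun x => funext fun y => eqx x y])
  have L3y := hcy.grad_bddLip (c := c) L2y (B := L * K2 + L * K1 * K2) (by
    have := hlin _ L2y
    rwa [show Lop c (pdy u) = fun x y => deriv f (u x y) * pdy u x y from
      funext fun x => funext fun y => eqy x y])
  set K3 : ℝ := 2 * K2 + (L * K2 + L * K1 * K2) + 1 with hK3
  have hK20 := L2x.nonneg
  have hK23 : K2 ≤ K3 := by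
    have : 0 ≤ L * K2 + L * K1 * K2 := by positivity
    linarith
  refine ⟨K3, by linarith, ⟨hc, L1.mono (hK12.trans hK23), L2x.mono hK23, L2y.mono hK23, L3x.1,
    L3y.2⟩, ⟨hcx, L2x.mono hK23, L3x.1, L3x.2, eqx⟩, ⟨hcy, L2y.mono hK23, L3y.1, L3y.2, eqy⟩, hcomm⟩

/-- Limit of the translates of `w` along an ultrafilter of translation vectors. -/
noncomputable def tl (𝒰 : Ultrafilter (ℝ × ℝ)) (w : ℝ → ℝ → ℝ) (x y : ℝ) : ℝ :=
  limUnder (𝒰 : Filter (ℝ × ℝ)) (fun p => w (p.1 + x) (p.2 + y))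

section TranslationLimit

variable {𝒰 : Ultrafilter (ℝ × ℝ)} {w w₁ : ℝ → ℝ → ℝ} {K : ℝ}

theorem BddLip.tendsto_tl (hw : BddLip K w) (x y : ℝ) :
    Tendsto (fun p : ℝ × ℝ => w (p.1 + x) (p.2 + y)) 𝒰 (nhds (tl 𝒰 w x y)) := by
  apply tendsto_nhds_limUnder
  have : ∀ p : ℝ × ℝ, w (p.1 + x) (p.2 + y) ∈ Set.Icc (-K) K := fun p => abs_le.1 (hw.1 _ _)
  obtain ⟨a, -, ha⟩ := (isCompact_Icc (a := -K) (b := K)).ultrafilter_le_nhds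
    (𝒰.map (fun p => w (p.1 + x) (p.2 + y)))
    (by
      rw [le_principal_iff, Ultrafilter.mem_coe, Ultrafilter.mem_map]
      exact univ_mem' this)
  exact ⟨a, ha⟩

theorem tl_eq_of_tendsto {a x y : ℝ}
    (h : Tendsto (fun p : ℝ × ℝ => w (p.1 + x) (p.2 + y)) 𝒰 (nhds a)) : tl 𝒰 w x y = a :=
  h.limUnder_eq

theorem BddLip.tl (hw : BddLip K w) : BddLip K (tl 𝒰 w) := by
  constructor
  · intro x y
    exact le_of_tendsto (hw.tendsto_tl x y).abs (Eventually.of_forall fun p => hw.1 _ _)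
  · intro x y x' y'
    refine le_of_tendsto ((hw.tendsto_tl x y).sub (hw.tendsto_tl x' y')).abs
      (Eventually.of_forall fun p => ?_)
    have := hw.2 (p.1 + x) (p.2 + y) (p.1 + x') (p.2 + y')
    simpa using this

theorem abs_taylor_le {φ φ' : ℝ → ℝ} {K : ℝ} (hK : 0 ≤ K) (h : ∀ t, HasDerivAt φ (φ' t) t)
    (hl : ∀ s t, |φ' s - φ' t| ≤ K * |s - t|) (x s : ℝ) :
    |φ s - φ x - φ' x * (s - x)| ≤ K * (s - x) ^ 2 := by
  have := Convex.norm_image_sub_le_of_norm_hasDerivWithin_le (f := fun t => φ t - φ' x * t)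
    (f' := fun t => φ' t - φ' x) (C := K * |s - x|)
    (s := Set.uIcc x s) (x := x) (y := s)
    (fun t _ => (((h t).sub ((hasDerivAt_id t).const_mul (φ' x))).congr_deriv
      (by simp)).hasDerivWithinAt) (fun t ht => ?_)
    (convex_uIcc _ _) Set.left_mem_uIcc Set.right_mem_uIcc
  · simp only [Real.norm_eq_abs] at this
    calc |φ s - φ x - φ' x * (s - x)| = |φ s - φ' x * s - (φ x - φ' x * x)| := by congr 1; ring
      _ ≤ _ := this
      _ = K * |s - x| ^ 2 := by ring
      _ = _ := by rw [sq_abs]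
  · refine (hl t x).trans ?_
    gcongr 1
    exact Set.abs_sub_left_of_mem_uIcc ht

theorem hasDerivAt_of_quadratic {φ : ℝ → ℝ} {a x K : ℝ}
    (h : ∀ s, |φ s - φ x - a * (s - x)| ≤ K * (s - x) ^ 2) : HasDerivAt φ a x := by
  rw [hasDerivAt_iff_isLittleO]
  have h1 : (fun s => φ s - φ x - (s - x) • a) =O[nhds x] fun s => (s - x) ^ 2 := by
    refine Asymptotics.IsBigO.of_bound K (Eventually.of_forall fun s => ?_)
    rw [Real.norm_eq_abs, Real.norm_eq_abs, abs_of_nonneg (sq_nonneg (s - x)), smul_eq_mul,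
      mul_comm (s - x)]
    exact h s
  refine h1.trans_isLittleO ?_
  have : Tendsto (fun s => s - x) (nhds x) (nhds 0) := by
    have : ContinuousAt (fun s => s - x) x := by fun_prop
    simpa [ContinuousAt] using this
  exact (Asymptotics.isLittleO_pow_id (𝕜 := ℝ) (n := 2) (by norm_num)).comp_tendsto this

theorem BddLip.hasDerivAt_tl_x (hw : BddLip K w) (hw₁ : BddLip K w₁)
    (h : ∀ x y, HasDerivAt (fun t => w t y) (w₁ x y) x) (x y : ℝ) :
    HasDerivAt (fun t => _root_.tl 𝒰 w t y) (_root_.tl 𝒰 w₁ x y) x := by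
  apply hasDerivAt_of_quadratic (K := K)
  intro s
  refine le_of_tendsto (((hw.tendsto_tl s y).sub (hw.tendsto_tl x y)).sub
    ((hw₁.tendsto_tl x y).mul_const (s - x))).abs (Eventually.of_forall fun p => ?_)
  have := abs_taylor_le hw.nonneg (fun t => h t (p.2 + y))
    (fun s t => by simpa using hw₁.2 s (p.2 + y) t (p.2 + y)) (p.1 + x) (p.1 + s)
  simpa using this

theorem BddLip.hasDerivAt_tl_y (hw : BddLip K w) (hw₁ : BddLip K w₁)
    (h : ∀ x y, HasDerivAt (fun t => w x t) (w₁ x y) y) (x y : ℝ) :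
    HasDerivAt (fun t => _root_.tl 𝒰 w x t) (_root_.tl 𝒰 w₁ x y) y := by
  apply hasDerivAt_of_quadratic (K := K)
  intro s
  refine le_of_tendsto (((hw.tendsto_tl x s).sub (hw.tendsto_tl x y)).sub
    ((hw₁.tendsto_tl x y).mul_const (s - y))).abs (Eventually.of_forall fun p => ?_)
  have := abs_taylor_le hw.nonneg (fun t => h (p.1 + x) t)
    (fun s t => by simpa using hw₁.2 (p.1 + x) s (p.1 + x) t) (p.2 + y) (p.2 + s)
  simpa using this

theorem Reg.tl_jet (hw : Reg K w) : IsC2 (tl 𝒰 w) ∧ pdx (tl 𝒰 w) = tl 𝒰 (pdx w) ∧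
    pdy (tl 𝒰 w) = tl 𝒰 (pdy w) ∧ pdxx (tl 𝒰 w) = tl 𝒰 (pdxx w) ∧
    pdyy (tl 𝒰 w) = tl 𝒰 (pdyy w) :=
  isC2_of_jet (hw.b.hasDerivAt_tl_x hw.bx hw.c2.dx) (hw.b.hasDerivAt_tl_y hw.by' hw.c2.dy)
    (hw.bx.hasDerivAt_tl_x hw.bxx hw.c2.dxx) (hw.by'.hasDerivAt_tl_y hw.byy hw.c2.dyy)
    hw.b.tl.continuous

theorem Reg.tl (hw : Reg K w) : Reg K (tl 𝒰 w) := by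
  obtain ⟨h0, h1, h2, h3, h4⟩ := hw.tl_jet (𝒰 := 𝒰)
  exact ⟨h0, hw.b.tl, h1 ▸ hw.bx.tl, h2 ▸ hw.by'.tl, h3 ▸ hw.bxx.tl, h4 ▸ hw.byy.tl⟩

theorem Reg.tendsto_lop (hw : Reg K w) (c x y : ℝ) :
    Tendsto (fun p : ℝ × ℝ => Lop c w (p.1 + x) (p.2 + y)) 𝒰 (nhds (Lop c (_root_.tl 𝒰 w) x y)) := by
  obtain ⟨-, -, h2, h3, h4⟩ := hw.tl_jet (𝒰 := 𝒰)
  unfold Lop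
  rw [h2, h3, h4]
  exact ((hw.bxx.tendsto_tl x y).add (hw.byy.tendsto_tl x y)).add
    ((hw.by'.tendsto_tl x y).const_mul c)

theorem Reg.mono {K' : ℝ} (h : K ≤ K') (hw : Reg K w) : Reg K' w :=
  ⟨hw.c2, hw.b.mono h, hw.bx.mono h, hw.by'.mono h, hw.bxx.mono h, hw.byy.mono h⟩

theorem BddLip.shift (hw : BddLip K w) (a b : ℝ) : BddLip K (fun x y => w (x + a) (y + b)) :=
  ⟨fun _ _ => hw.1 _ _, fun x y x' y' => by simpa using hw.2 (x + a) (y + b) (x' + a) (y' + b)⟩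

theorem Reg.shift (hw : Reg K w) (a b : ℝ) : Reg K (fun x y => w (x + a) (y + b)) := by
  obtain ⟨h0, h1, h2, h3, h4⟩ := hw.c2.shift_jet a b
  exact ⟨h0, hw.b.shift a b, h1 ▸ hw.bx.shift a b, h2 ▸ hw.by'.shift a b, h3 ▸ hw.bxx.shift a b,
    h4 ▸ hw.byy.shift a b⟩

theorem BddLip.tl_shift (hw : BddLip K w) (a b x y : ℝ) :
    _root_.tl 𝒰 (fun x y => w (x + a) (y + b)) x y = _root_.tl 𝒰 w (x + a) (y + b) := by
  apply tl_eq_of_tendsto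
  simpa [add_assoc] using hw.tendsto_tl (𝒰 := 𝒰) (x + a) (y + b)

theorem exists_tl_tl (𝒰 𝒱 : Ultrafilter (ℝ × ℝ)) : ∃ 𝒲 : Ultrafilter (ℝ × ℝ),
    ∀ (K : ℝ) (w : ℝ → ℝ → ℝ), BddLip K w → tl 𝒱 (tl 𝒰 w) = tl 𝒲 w := by
  refine ⟨Ultrafilter.bind 𝒱 (fun q => 𝒰.map (fun p => p + q)), fun K w hw => ?_⟩
  funext x y
  symm
  apply tl_eq_of_tendsto
  rw [Metric.tendsto_nhds]
  intro ε hε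
  change ∀ᶠ q in (𝒱 : Filter (ℝ × ℝ)), ∀ᶠ p in (𝒰 : Filter (ℝ × ℝ)),
    dist (w ((p + q).1 + x) ((p + q).2 + y)) (tl 𝒱 (tl 𝒰 w) x y) < ε
  filter_upwards [Metric.tendsto_nhds.1 ((hw.tl (𝒰 := 𝒰)).tendsto_tl (𝒰 := 𝒱) x y) (ε / 2)
    (by positivity)] with q hq
  filter_upwards [Metric.tendsto_nhds.1 (hw.tendsto_tl (𝒰 := 𝒰) (q.1 + x) (q.2 + y)) (ε / 2)
    (by positivity)] with p hp
  have := dist_triangle (w (p.1 + (q.1 + x)) (p.2 + (q.2 + y))) (tl 𝒰 w (q.1 + x) (q.2 + y))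
    (tl 𝒱 (tl 𝒰 w) x y)
  simp only [Prod.fst_add, Prod.snd_add, add_assoc]
  linarith

end TranslationLimit

/-- A uniformly regular entire solution, monotone in `y`. -/
structure Wave (f : ℝ → ℝ) (c K : ℝ) (u : ℝ → ℝ → ℝ) : Prop where
  reg : Reg K u
  le_one : ∀ x y, |u x y| ≤ 1
  eq : ∀ x y, Lop c u x y = f (u x y)
  mono : ∀ x, Monotone (u x)

/-- Strict monotonicity in `y` with limits `∓1`. -/
structure Front (u : ℝ → ℝ → ℝ) : Prop where
  mono : ∀ x, StrictMono (u x)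
  top : ∀ x, Tendsto (u x) atTop (nhds 1)
  bot : ∀ x, Tendsto (u x) atBot (nhds (-1))

section Waves

variable {f : ℝ → ℝ} {c K L : ℝ} {u : ℝ → ℝ → ℝ}

theorem Wave.tl (hf : Continuous f) (hu : Wave f c K u) (𝒰 : Ultrafilter (ℝ × ℝ)) :
    Wave f c K (tl 𝒰 u) where
  reg := hu.reg.tl
  le_one := fun x y =>
    le_of_tendsto (hu.reg.b.tendsto_tl x y).abs (Eventually.of_forall fun p => hu.le_one _ _)
  eq := fun x y => by
    refine tendsto_nhds_unique (hu.reg.tendsto_lop (𝒰 := 𝒰) c x y) ?_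
    simp only [hu.eq]
    exact (hf.tendsto _).comp (hu.reg.b.tendsto_tl x y)
  mono := fun x y y' h => le_of_tendsto_of_tendsto (hu.reg.b.tendsto_tl x y)
    (hu.reg.b.tendsto_tl x y') (Eventually.of_forall fun p => hu.mono _ (by linarith))

theorem Wave.shift (hu : Wave f c K u) (a b : ℝ) : Wave f c K (fun x y => u (x + a) (y + b)) where
  reg := hu.reg.shift a b
  le_one := fun x y => hu.le_one _ _
  eq := fun x y => by rw [hu.reg.c2.lop_shift]; exact hu.eq _ _
  mono := fun x y y' h => hu.mono _ (by linarith)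

/-- Touching super- and subsolutions coincide. -/
theorem eq_of_touch (hf : NonlinBound f L) {v : ℝ → ℝ → ℝ} (hv : IsC2 v) (hu : IsC2 u)
    (hv1 : ∀ x y, |v x y| ≤ 1) (hu1 : ∀ x y, |u x y| ≤ 1)
    (hvs : ∀ x y, Lop c v x y ≤ f (v x y)) (hus : ∀ x y, f (u x y) ≤ Lop c u x y)
    (hle : ∀ x y, u x y ≤ v x y) {x₀ y₀ : ℝ} (h0 : u x₀ y₀ = v x₀ y₀) (x y : ℝ) :
    u x y = v x y := by
  have := (hv.sub hu).eq_zero_of_nonneg (c := c) (L := L) hf.pos.le (fun x y => by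
    refine ⟨sub_nonneg.2 (hle x y), ?_⟩
    rw [hv.lop_sub hu]
    have h1 := hf.lip _ _ (hv1 x y) (hu1 x y)
    rw [abs_of_nonneg (sub_nonneg.2 (hle x y))] at h1
    have h2 := (abs_le.1 h1).2
    have := hvs x y
    have := hus x y
    linarith) (x₀ := x₀) (y₀ := y₀) (by simp [h0]) x y
  linarith

theorem Wave.strictMono_or_const (hf : NonlinBound f L) (hu : Wave f c K u) :
    (∀ x, StrictMono (u x)) ∨ ∀ x y y', u x y = u x y' := by
  by_cases h : ∀ x, StrictMono (u x)
  · exact Or.inl h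
  right
  obtain ⟨x₀, y₀, η, hη, h0⟩ : ∃ x₀ y₀ η, 0 < η ∧ u x₀ y₀ = u x₀ (y₀ + η) := by
    by_contra hcon
    push Not at hcon
    apply h
    intro x y y' hyy
    refine lt_of_le_of_ne (hu.mono x hyy.le) ?_
    have := hcon x y (y' - y) (by linarith)
    simpa using this
  have hs := hu.shift 0 η
  have key : ∀ x y, u x y = u x (y + η) := by
    intro x y
    have := eq_of_touch (c := c) hf hs.reg.c2 hu.reg.c2 hs.le_one hu.le_one
      (fun x y => (hs.eq x y).le) (fun x y => (hu.eq x y).ge)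
      (fun x y => by simpa using hu.mono x (by linarith : y ≤ y + η))
      (x₀ := x₀) (y₀ := y₀) (by simpa using h0) x y
    simpa using this
  have keyn : ∀ (n : ℕ) x y, u x y = u x (y + n * η) := by
    intro n x
    induction n with
    | zero => intro y; simp
    | succ n ih => intro y; rw [ih y, key x (y + n * η)]; congr 1; push_cast; ring
  have hle : ∀ x y y', u x y' ≤ u x y := by
    intro x y y'
    obtain ⟨n, hn⟩ := exists_nat_ge ((y' - y) / η)
    rw [div_le_iff₀ hη] at hn
    rw [keyn n x y]
    exact hu.mono x (by linarith)
  exact fun x y y' => le_antisymm (hle _ _ _) (hle _ _ _)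

/-- A wave all of whose `y`-independent translation limits are trivial. -/
structure GoodWave (f : ℝ → ℝ) (c K : ℝ) (u : ℝ → ℝ → ℝ) : Prop extends Wave f c K u where
  trivial : ∀ 𝒰 : Ultrafilter (ℝ × ℝ), (∀ x y y', _root_.tl 𝒰 u x y = _root_.tl 𝒰 u x y') →
    (∀ x y, _root_.tl 𝒰 u x y = 1) ∨ (∀ x y, _root_.tl 𝒰 u x y = -1)

theorem GoodWave.tl (hf : Continuous f) (hu : GoodWave f c K u) (𝒰 : Ultrafilter (ℝ × ℝ)) :
    GoodWave f c K (_root_.tl 𝒰 u) where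
  toWave := hu.toWave.tl hf 𝒰
  trivial := fun 𝒱 => by
    obtain ⟨𝒲, h𝒲⟩ := exists_tl_tl 𝒰 𝒱
    rw [h𝒲 K u hu.reg.b]
    exact hu.trivial 𝒲

theorem GoodWave.trichotomy (hf : NonlinBound f L) (hu : GoodWave f c K u) :
    (∀ x y, u x y = 1) ∨ (∀ x y, u x y = -1) ∨ Front u := by
  have lim : ∀ l : Filter ℝ, (l = atTop ∨ l = atBot) →
      (∀ x, Tendsto (u x) l (nhds 1)) ∨ (∀ x, Tendsto (u x) l (nhds (-1))) := by
    intro l hl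
    have hconv : ∀ x, ∃ a, Tendsto (u x) l (nhds a) := by
      intro x
      rcases hl with rfl | rfl
      · exact ⟨_, tendsto_atTop_ciSup (hu.mono x) ⟨1, by
          rintro _ ⟨y, rfl⟩; exact (abs_le.1 (hu.le_one x y)).2⟩⟩
      · exact ⟨_, tendsto_atBot_ciInf (hu.mono x) ⟨-1, by
          rintro _ ⟨y, rfl⟩; exact (abs_le.1 (hu.le_one x y)).1⟩⟩
    have hne : l.NeBot := by rcases hl with rfl | rfl <;> infer_instance
    choose a ha using hconv
    have hadd : ∀ y : ℝ, Tendsto (fun s => s + y) l l := by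
      intro y
      rcases hl with rfl | rfl
      · exact tendsto_atTop_add_const_right _ _ tendsto_id
      · exact tendsto_atBot_add_const_right _ _ tendsto_id
    have htl : ∀ x y, _root_.tl ((Ultrafilter.of l).map (fun y => ((0 : ℝ), y))) u x y = a x := by
      intro x y
      apply tl_eq_of_tendsto
      change Tendsto ((fun p : ℝ × ℝ => u (p.1 + x) (p.2 + y)) ∘ fun y => ((0 : ℝ), y))
        (Ultrafilter.of l : Filter ℝ) (nhds (a x))
      have := ((ha x).comp (hadd y)).mono_left (Ultrafilter.of_le l)
      simpa [Function.comp_def] using this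
    rcases hu.trivial _ (fun x y y' => by rw [htl, htl]) with h | h
    · left; intro x; have := h x 0; rw [htl] at this; rw [← this]; exact ha x
    · right; intro x; have := h x 0; rw [htl] at this; rw [← this]; exact ha x
  rcases lim atTop (Or.inl rfl) with ht | ht
  · rcases lim atBot (Or.inr rfl) with hb | hb
    · left
      intro x y
      exact le_antisymm ((hu.mono x).ge_of_tendsto (ht x) y) ((hu.mono x).le_of_tendsto (hb x) y)
    · right; right
      rcases hu.toWave.strictMono_or_const hf with h | h
      · exact ⟨h, ht, hb⟩
      · exfalso
        have h1 : Tendsto (u 0) atTop (nhds (u 0 0)) := by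
          rw [show u 0 = fun _ => u 0 0 from funext fun y => h 0 y 0]
          exact tendsto_const_nhds
        have h2 : Tendsto (u 0) atBot (nhds (u 0 0)) := by
          rw [show u 0 = fun _ => u 0 0 from funext fun y => h 0 y 0]
          exact tendsto_const_nhds
        have := tendsto_nhds_unique h1 (ht 0)
        have := tendsto_nhds_unique h2 (hb 0)
        linarith
  · right; left
    intro x y
    exact le_antisymm ((hu.mono x).ge_of_tendsto (ht x) y) (abs_le.1 (hu.le_one x y)).1

end Waves

/-- An entire traveling wave together with its uniform bounds and linearised equations. -/
structure RegWave (f : ℝ → ℝ) (c K : ℝ) (u : ℝ → ℝ → ℝ) : Prop extends Wave f c K u where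
  one_le : 1 ≤ K
  linx : IsLinSol f c K u (pdx u)
  liny : IsLinSol f c K u (pdy u)
  comm : pdx (pdy u) = pdy (pdx u)
  pos : ∀ x y, 0 < pdy u x y
  top : ∀ x, Tendsto (u x) atTop (nhds 1)
  bot : ∀ x, Tendsto (u x) atBot (nhds (-1))

theorem IsTravelingWave.exists_regWave {F : ℝ → ℝ} {c L : ℝ} {u : ℝ → ℝ → ℝ}
    (hf : NonlinBound (deriv F) L) (hu : IsTravelingWave F c u) :
    ∃ K, RegWave (deriv F) c K u := by
  obtain ⟨⟨h1, h2, h3, h4⟩, ht, hb⟩ := hu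
  obtain ⟨K, hK, hr, hx, hy, hc⟩ := exists_reg hf h1 h2 h3
  refine ⟨K, ⟨hr, h3, h2, fun x => ?_⟩, hK, hx, hy, hc, h4, ht, hb⟩
  exact (strictMono_of_hasDerivAt_pos (fun y => hr.c2.dy x y) (fun y => h4 x y)).monotone

theorem BddLip.uniform_tl {K : ℝ} {w : ℝ → ℝ → ℝ} (hw : BddLip K w) (𝒰 : Ultrafilter (ℝ × ℝ))
    {s : Set (ℝ × ℝ)} (hs : IsCompact s) {ε : ℝ} (hε : 0 < ε) :
    ∀ᶠ p in (𝒰 : Filter (ℝ × ℝ)), ∀ z ∈ s,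
      |w (p.1 + z.1) (p.2 + z.2) - _root_.tl 𝒰 w z.1 z.2| < ε := by
  have hK := hw.nonneg
  refine hs.induction_on (p := fun s => ∀ᶠ p in (𝒰 : Filter (ℝ × ℝ)), ∀ z ∈ s,
      |w (p.1 + z.1) (p.2 + z.2) - _root_.tl 𝒰 w z.1 z.2| < ε) ?_ ?_ ?_ ?_
  · simp
  · intro s t hst ht
    filter_upwards [ht] with p hp z hz using hp z (hst hz)
  · intro s t hs ht
    filter_upwards [hs, ht] with p h1 h2 z hz
    rcases hz with hz | hz
    exacts [h1 z hz, h2 z hz]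
  · intro z _
    refine ⟨ball z (ε / (8 * (K + 1))), mem_nhdsWithin_of_mem_nhds (ball_mem_nhds _ (by positivity)),
      ?_⟩
    filter_upwards [Metric.tendsto_nhds.1 (hw.tendsto_tl (𝒰 := 𝒰) z.1 z.2) (ε / 4) (by positivity)]
      with p hp z' hz'
    rw [mem_ball, Prod.dist_eq, max_lt_iff, Real.dist_eq, Real.dist_eq] at hz'
    rw [Real.dist_eq] at hp
    have h1 := hw.2 (p.1 + z'.1) (p.2 + z'.2) (p.1 + z.1) (p.2 + z.2)
    have h2 := (hw.tl (𝒰 := 𝒰)).2 z'.1 z'.2 z.1 z.2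
    simp only [add_sub_add_left_eq_sub] at h1
    have h3 : K * (|z'.1 - z.1| + |z'.2 - z.2|) ≤ ε / 4 := by
      calc K * (|z'.1 - z.1| + |z'.2 - z.2|)
          ≤ (K + 1) * (ε / (8 * (K + 1)) + ε / (8 * (K + 1))) := by
            gcongr
            · linarith
            · exact hz'.1.le
            · exact hz'.2.le
        _ = ε / 4 := by field_simp; ring
    rw [abs_lt] at hp ⊢
    rw [abs_le] at h1 h2
    constructor <;> linarith

/-- A nonnegative function with Lipschitz derivative controls the square of its derivative. -/
theorem sq_deriv_le {φ φ' : ℝ → ℝ} {K : ℝ} (hK : 0 < K) (h : ∀ t, HasDerivAt φ (φ' t) t)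
    (hl : ∀ s t, |φ' s - φ' t| ≤ K * |s - t|) (h0 : ∀ t, 0 ≤ φ t) (x : ℝ) :
    φ' x ^ 2 ≤ 4 * K * φ x := by
  have h1 := (abs_le.1 (abs_taylor_le hK.le h hl x (x - φ' x / (2 * K)))).2
  have h2 := h0 (x - φ' x / (2 * K))
  have e1 : φ' x * (x - φ' x / (2 * K) - x) = - (φ' x ^ 2 / (2 * K)) := by ring
  have e2 : K * (x - φ' x / (2 * K) - x) ^ 2 = φ' x ^ 2 / (4 * K) := by field_simp; ring
  have e3 : φ' x ^ 2 / (2 * K) = 2 * (φ' x ^ 2 / (4 * K)) := by field_simp; ring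
  rw [e1, e2, e3] at h1
  have h3 : φ' x ^ 2 / (4 * K) ≤ φ x := by linarith
  rw [div_le_iff₀ (by positivity)] at h3
  linarith

theorem tendsto_deriv_zero {φ φ' : ℝ → ℝ} {K a : ℝ} (hK : 0 ≤ K) (h : ∀ t, HasDerivAt φ (φ' t) t)
    (hl : ∀ s t, |φ' s - φ' t| ≤ K * |s - t|) (ht : Tendsto φ atTop (nhds a)) :
    Tendsto φ' atTop (nhds 0) := by
  rw [Metric.tendsto_nhds]
  intro ε hε
  set s := ε / (2 * (K + 1)) with hs
  have hs0 : 0 < s := by positivity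
  have hsum : Tendsto (fun b => φ (b + s) - φ b) atTop (nhds 0) := by
    have := (ht.comp (tendsto_atTop_add_const_right atTop s tendsto_id)).sub ht
    simpa using this
  filter_upwards [Metric.tendsto_nhds.1 hsum (ε * s / 2) (by positivity)] with b hb
  have h1 := abs_taylor_le hK h hl b (b + s)
  rw [Real.dist_eq, sub_zero] at hb ⊢
  rw [add_sub_cancel_left] at h1
  have h2 : |φ' b * s| < ε * s := by
    have h3 : K * s ^ 2 ≤ ε * s / 2 := by
      have : (K + 1) * s = ε / 2 := by rw [hs]; field_simp
      nlinarith
    rw [abs_lt] at hb ⊢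
    rw [abs_le] at h1
    constructor <;> linarith
  rw [abs_mul, abs_of_pos hs0] at h2
  exact lt_of_mul_lt_mul_right h2 hs0.le

namespace UnbalancedDoubleWell

variable {F : ℝ → ℝ}

theorem hasDerivAt (hF : UnbalancedDoubleWell F) (s : ℝ) : HasDerivAt F (deriv F s) s :=
  (hF.1.differentiable (by simp) s).hasDerivAt

theorem contDiff_deriv (hF : UnbalancedDoubleWell F) : ContDiff ℝ 2 (deriv F) :=
  ((contDiff_succ_iff_deriv (n := 2)).1 hF.1).2.2

theorem continuous_deriv (hF : UnbalancedDoubleWell F) : Continuous (deriv F) :=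
  hF.contDiff_deriv.continuous

theorem antitoneOn (hF : UnbalancedDoubleWell F) : StrictAntiOn F (Set.Icc 0 1) := by
  apply strictAntiOn_of_deriv_neg (convex_Icc _ _) hF.1.continuous.continuousOn
  rw [interior_Icc]
  exact hF.2.2.2.2.2.2.1

theorem eq_one (hF : UnbalancedDoubleWell F) {s : ℝ} (hs : |s| ≤ 1) (h0 : deriv F s = 0)
    (h1 : F s = F 1) : s = 1 := by
  have hanti := hF.antitoneOn
  obtain ⟨-, -, -, -, -, hp, hn, hm, h1p⟩ := hF
  obtain ⟨a, b⟩ := abs_le.1 hs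
  rcases lt_trichotomy s 0 with h | h | h
  · rcases a.eq_or_lt with h' | h'
    · rw [← h', hm] at h1; linarith
    · have := hp s ⟨h', h⟩; linarith
  · have := hanti (show (0 : ℝ) ∈ Set.Icc (0 : ℝ) 1 by simp) (show (1 : ℝ) ∈ Set.Icc (0 : ℝ) 1 by simp)
      (by norm_num)
    rw [h] at h1; linarith
  · rcases b.eq_or_lt with h' | h'
    · exact h'
    · have := hn s ⟨h, h'⟩; linarith

theorem le_of_deriv_nonpos (hF : UnbalancedDoubleWell F) {s : ℝ} (hs : |s| ≤ 1)
    (h0 : deriv F s ≤ 0) : s = -1 ∨ F 1 ≤ F s := by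
  have hanti := hF.antitoneOn
  obtain ⟨-, -, -, -, -, hp, hn, hm, h1p⟩ := hF
  obtain ⟨a, b⟩ := abs_le.1 hs
  rcases lt_or_ge s 0 with h | h
  · rcases a.eq_or_lt with h' | h'
    · exact Or.inl h'.symm
    · have := hp s ⟨h', h⟩; linarith
  · right
    exact hanti.antitoneOn ⟨h, b⟩ (by simp) b

end UnbalancedDoubleWell

/-- A one-dimensional orbit at the energy level of `1` and with finite action tends to `1`. -/
theorem tendsto_one_of_action {F V V' : ℝ → ℝ} (hF : UnbalancedDoubleWell F) {K C : ℝ}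
    (hV' : ∀ t, HasDerivAt V' (deriv F (V t)) t)
    (hb : ∀ t, |V t| ≤ 1) (hb' : ∀ t, |V' t| ≤ K) (hl : ∀ s t, |V' s - V' t| ≤ K * |s - t|)
    (hl' : ∀ s t, |deriv F (V s) - deriv F (V t)| ≤ K * |s - t|)
    (hE : ∀ t, F (V t) - V' t ^ 2 / 2 = F 1) (hC : ∀ b, 0 ≤ b → ∫ x in (0 : ℝ)..b, V' x ^ 2 ≤ C) :
    Tendsto V atTop (nhds 1) := by
  have hK : 0 ≤ K := (abs_nonneg _).trans (hb' 0)
  have hV'c : Continuous V' := continuous_iff_continuousAt.2 fun t => (hV' t).continuousAt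
  have hV'c2 : Continuous (fun x => V' x ^ 2) := hV'c.pow 2
  have hI : ∀ t, HasDerivAt (fun b => ∫ x in (0 : ℝ)..b, V' x ^ 2) (V' t ^ 2) t := fun t =>
    intervalIntegral.integral_hasDerivAt_right (hV'c2.intervalIntegrable _ _)
      (hV'c2.stronglyMeasurableAtFilter _ _) hV'c2.continuousAt
  have hImono : Monotone (fun b => ∫ x in (0 : ℝ)..b, V' x ^ 2) :=
    monotone_of_hasDerivAt_nonneg hI (fun t => sq_nonneg _)
  have hIt := tendsto_atTop_ciSup hImono ⟨C, by
    rintro _ ⟨b, rfl⟩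
    rcases le_total 0 b with h | h
    · exact hC b h
    · exact (hImono h).trans (hC 0 le_rfl)⟩
  have hsq : Tendsto (fun t => V' t ^ 2) atTop (nhds 0) := by
    refine tendsto_deriv_zero (K := 2 * K * K) (by positivity) hI (fun s t => ?_) hIt
    rw [show V' s ^ 2 - V' t ^ 2 = (V' s + V' t) * (V' s - V' t) by ring, abs_mul]
    calc |V' s + V' t| * |V' s - V' t| ≤ (K + K) * (K * |s - t|) := by
          gcongr
          · exact (abs_add_le _ _).trans (add_le_add (hb' s) (hb' t))
          · exact hl s t
      _ = _ := by ring
  have hV'0 : Tendsto V' atTop (nhds 0) := by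
    have := hsq.sqrt
    simp only [Real.sqrt_zero, Real.sqrt_sq_eq_abs] at this
    exact tendsto_zero_iff_abs_tendsto_zero _ |>.2 this
  have hf0 : Tendsto (fun t => deriv F (V t)) atTop (nhds 0) :=
    tendsto_deriv_zero hK hV' hl' hV'0
  rw [tendsto_iff_ultrafilter]
  intro 𝒱 h𝒱
  obtain ⟨s, -, hs⟩ := (isCompact_Icc (a := (-1 : ℝ)) (b := 1)).ultrafilter_le_nhds (𝒱.map V) (by
    rw [le_principal_iff, Ultrafilter.mem_coe, Ultrafilter.mem_map]
    exact univ_mem' fun t => abs_le.1 (hb t))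
  have hs' : Tendsto V 𝒱 (nhds s) := hs
  have hs1 : |s| ≤ 1 := le_of_tendsto hs'.abs (Eventually.of_forall hb)
  have e1 : deriv F s = 0 := tendsto_nhds_unique ((hF.continuous_deriv.tendsto s).comp hs')
    (hf0.mono_left h𝒱)
  have e2 : F s = F 1 := by
    have h1 : Tendsto (fun t => F (V t)) 𝒱 (nhds (F s)) := (hF.1.continuous.tendsto s).comp hs'
    have h2 : Tendsto (fun t => F 1 + V' t ^ 2 / 2) 𝒱 (nhds (F 1 + 0 / 2)) :=
      ((hsq.mono_left h𝒱).div_const 2).const_add (F 1)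
    have h3 : (fun t => F (V t)) = fun t => F 1 + V' t ^ 2 / 2 := by
      funext t; linarith [hE t]
    rw [h3] at h1
    have := tendsto_nhds_unique h1 h2
    linarith
  rw [hF.eq_one hs1 e1 e2] at hs'
  exact hs'

theorem Wave.sq_pdx_le {f : ℝ → ℝ} {c K : ℝ} {u : ℝ → ℝ → ℝ} (hu : Wave f c K u) (hK : 0 < K)
    (x y : ℝ) : pdx u x y ^ 2 ≤ 4 * K * (1 - u x y) := by
  have := sq_deriv_le (φ := fun t => 1 - u t y) (φ' := fun t => - pdx u t y) hK
    (fun t => (hu.reg.c2.dx t y).const_sub 1)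
    (fun s t => by
      rw [← abs_neg]
      convert hu.reg.bx.2 s y t y using 2
      · ring
      · simp)
    (fun t => by linarith [(abs_le.1 (hu.le_one t y)).2]) x
  simpa using this

theorem Wave.sq_pdy_le {f : ℝ → ℝ} {c K : ℝ} {u : ℝ → ℝ → ℝ} (hu : Wave f c K u) (hK : 0 < K)
    (x y : ℝ) : pdy u x y ^ 2 ≤ 4 * K * (1 - u x y) := by
  have := sq_deriv_le (φ := fun t => 1 - u x t) (φ' := fun t => - pdy u x t) hK
    (fun t => (hu.reg.c2.dy x t).const_sub 1)
    (fun s t => by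
      rw [← abs_neg]
      convert hu.reg.by'.2 x s x t using 2
      · ring
      · simp)
    (fun t => by linarith [(abs_le.1 (hu.le_one x t)).2]) y
  simpa using this

/-- Energy estimate on a vertical half strip. -/
theorem RegWave.energy_le {F : ℝ → ℝ} (hF : UnbalancedDoubleWell F) {c K : ℝ} (hc : 0 ≤ c)
    {u : ℝ → ℝ → ℝ} (hu : RegWave (deriv F) c K u) {a b : ℝ} (hab : a ≤ b) (y₁ : ℝ) :
    ∫ x in a..b, (pdx u x y₁ ^ 2 / 2 + F (u x y₁) - F 1 - pdy u x y₁ ^ 2 / 2) ≤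
      2 * √(4 * K * (1 - u a y₁)) + 2 * √(4 * K * (1 - u b y₁)) := by
  have hK : 0 < K := by linarith [hu.one_le]
  have cu := hu.reg.b.continuous
  have cx := hu.reg.bx.continuous
  have cy := hu.reg.by'.continuous
  have cxy := hu.linx.by'.continuous
  have cyy := hu.reg.byy.continuous
  have cxx := hu.reg.bxx.continuous
  have cF := hF.1.continuous
  have cf := hF.continuous_deriv
  set e : ℝ → ℝ → ℝ := fun y x => pdy u x y ^ 2 / 2 - pdx u x y ^ 2 / 2 - F (u x y) with he
  set e' : ℝ → ℝ → ℝ := fun y x => pdy u x y * pdyy u x y - pdx u x y * pdy (pdx u) x y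
    - deriv F (u x y) * pdy u x y with he'
  have hline : ∀ (w : ℝ → ℝ → ℝ), Continuous (fun p : ℝ × ℝ => w p.1 p.2) → ∀ y,
      Continuous fun x => w x y := fun w hw y =>
    hw.comp (f := fun x : ℝ => (x, y)) (by fun_prop)
  have ec : ∀ y, Continuous (e y) := by
    intro y
    have h1 := hline u cu y
    have h2 := hline _ cx y
    have h3 := hline _ cy y
    simp only [he]; fun_prop
  have ec' : ∀ y, Continuous (e' y) := by
    intro y
    have h1 := hline u cu y
    have h2 := hline _ cx y
    have h3 := hline _ cy y
    have h4 := hline _ cxy y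
    have h5 := hline _ cyy y
    simp only [he']; fun_prop
  obtain ⟨M, hM⟩ : ∃ M, ∀ s, |s| ≤ 1 → |F s| ≤ M ∧ |deriv F s| ≤ M := by
    obtain ⟨M1, h1⟩ := (isCompact_Icc (a := (-1 : ℝ)) (b := 1)).exists_bound_of_continuousOn
      cF.continuousOn
    obtain ⟨M2, h2⟩ := (isCompact_Icc (a := (-1 : ℝ)) (b := 1)).exists_bound_of_continuousOn
      cf.continuousOn
    exact ⟨max M1 M2, fun s hs => ⟨(h1 s (abs_le.1 hs)).trans (le_max_left _ _),
      (h2 s (abs_le.1 hs)).trans (le_max_right _ _)⟩⟩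
  have hbd' : ∀ y x, ‖e' y x‖ ≤ K * K + K * K + M * K := by
    intro y x
    have t1 : |pdy u x y * pdyy u x y| ≤ K * K := by
      rw [abs_mul]; exact mul_le_mul (hu.reg.by'.1 _ _) (hu.reg.byy.1 _ _) (abs_nonneg _) hK.le
    have t2 : |pdx u x y * pdy (pdx u) x y| ≤ K * K := by
      rw [abs_mul]; exact mul_le_mul (hu.reg.bx.1 _ _) (hu.linx.by'.1 _ _) (abs_nonneg _) hK.le
    have t3 : |deriv F (u x y) * pdy u x y| ≤ M * K := by
      rw [abs_mul]
      exact mul_le_mul (hM _ (hu.le_one x y)).2 (hu.reg.by'.1 _ _) (abs_nonneg _)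
        ((abs_nonneg _).trans (hM _ (hu.le_one x y)).2)
    rw [Real.norm_eq_abs]
    rw [abs_le] at *
    simp only [he']
    constructor <;> linarith
  have hderiv : ∀ y x, HasDerivAt (fun y => e y x) (e' y x) y := by
    intro y x
    have d1 := ((hu.reg.c2.dyy x y).pow 2).div_const 2
    have d2 := ((hu.linx.c2.dy x y).pow 2).div_const 2
    have d3 := (hF.hasDerivAt (u x y)).comp y (hu.reg.c2.dy x y)
    refine ((d1.sub d2).sub d3).congr_deriv ?_
    simp only [he']; push_cast; ring
  have hE : ∀ y, HasDerivAt (fun y => ∫ x in a..b, e y x) (∫ x in a..b, e' y x) y := by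
    intro y
    exact (intervalIntegral.hasDerivAt_integral_of_dominated_loc_of_deriv_le
      (bound := fun _ => K * K + K * K + M * K) (s := Set.univ) univ_mem
      (Eventually.of_forall fun y => (ec y).aestronglyMeasurable)
      ((ec y).intervalIntegrable _ _) (ec' y).aestronglyMeasurable
      (Eventually.of_forall fun x _ y _ => hbd' y x)
      intervalIntegrable_const
      (Eventually.of_forall fun x _ y _ => hderiv y x)).2
  have h_int : ∀ y, ∫ x in a..b, e' y x ≤
      -(pdx u b y * pdy u b y - pdx u a y * pdy u a y) := by
    intro y
    have hd : ∀ x, HasDerivAt (fun x => pdx u x y * pdy u x y)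
        (pdxx u x y * pdy u x y + pdx u x y * pdy (pdx u) x y) x := by
      intro x
      have h1 := hu.reg.c2.dxx x y
      have h2 := hu.liny.c2.dx x y
      rw [hu.comm] at h2
      exact h1.mul h2
    have c1 : Continuous fun x => pdxx u x y * pdy u x y + pdx u x y * pdy (pdx u) x y := by
      have h2 := hline _ cx y
      have h3 := hline _ cy y
      have h4 := hline _ cxy y
      have h5 := hline _ cxx y
      fun_prop
    rw [← intervalIntegral.integral_eq_sub_of_hasDerivAt (fun x _ => hd x)
      (c1.intervalIntegrable _ _), ← intervalIntegral.integral_neg]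
    apply intervalIntegral.integral_mono_on hab ((ec' y).intervalIntegrable _ _)
      (c1.neg.intervalIntegrable _ _)
    intro x _
    have h1 : pdxx u x y + pdyy u x y + c * pdy u x y = deriv F (u x y) := hu.eq x y
    simp only [he']
    rw [← h1]
    have : 0 ≤ c * pdy u x y ^ 2 := by positivity
    rw [Pi.neg_apply]
    nlinarith
  set Sa := √(4 * K * (1 - u a y₁)) with hSa
  set Sb := √(4 * K * (1 - u b y₁)) with hSb
  have hsq : ∀ x y, y₁ ≤ y → |pdx u x y| ≤ √(4 * K * (1 - u x y₁)) := by
    intro x y hy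
    apply Real.abs_le_sqrt
    refine (hu.toWave.sq_pdx_le hK x y).trans ?_
    have := hu.mono x hy
    gcongr
  set G : ℝ → ℝ := fun y => (∫ x in a..b, e y x) - Sa * u a y - Sb * u b y with hG
  have hGd : ∀ y, HasDerivAt G ((∫ x in a..b, e' y x) - Sa * pdy u a y - Sb * pdy u b y) y :=
    fun y => ((hE y).sub ((hu.reg.c2.dy a y).const_mul Sa)).sub ((hu.reg.c2.dy b y).const_mul Sb)
  have hGanti : AntitoneOn G (Set.Ici y₁) := by
    apply antitoneOn_of_deriv_nonpos (convex_Ici _)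
      (fun y _ => (hGd y).continuousAt.continuousWithinAt)
      (fun y _ => (hGd y).differentiableAt.differentiableWithinAt)
    intro y hy
    rw [interior_Ici] at hy
    rw [(hGd y).deriv]
    have h1 := h_int y
    have h2 := hsq a y (le_of_lt hy)
    have h3 := hsq b y (le_of_lt hy)
    have h4 := hu.pos a y
    have h5 := hu.pos b y
    have h6 : pdx u a y * pdy u a y ≤ Sa * pdy u a y := by
      gcongr; exact (le_abs_self _).trans h2
    have h7 : - pdx u b y * pdy u b y ≤ Sb * pdy u b y := by
      gcongr; exact (neg_le_abs _).trans h3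
    linarith
  have hpt : ∀ x, Tendsto (fun y => e y x) atTop (nhds (- F 1)) := by
    intro x
    have h0 : Tendsto (fun y => 4 * K * (1 - u x y)) atTop (nhds 0) := by
      have := ((hu.top x).const_sub 1).const_mul (4 * K)
      simpa using this
    have h1 : Tendsto (fun y => pdx u x y ^ 2) atTop (nhds 0) :=
      squeeze_zero (fun y => sq_nonneg _) (fun y => hu.toWave.sq_pdx_le hK x y) h0
    have h2 : Tendsto (fun y => pdy u x y ^ 2) atTop (nhds 0) :=
      squeeze_zero (fun y => sq_nonneg _) (fun y => hu.toWave.sq_pdy_le hK x y) h0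
    have h3 : Tendsto (fun y => F (u x y)) atTop (nhds (F 1)) := (cF.tendsto 1).comp (hu.top x)
    have := ((h2.div_const 2).sub (h1.div_const 2)).sub h3
    simpa using this
  have hElim : Tendsto (fun y => ∫ x in a..b, e y x) atTop (nhds (∫ x in a..b, - F 1)) := by
    apply intervalIntegral.tendsto_integral_filter_of_dominated_convergence
      (fun _ => K ^ 2 + K ^ 2 + M)
    · exact Eventually.of_forall fun y => (ec y).aestronglyMeasurable
    · refine Eventually.of_forall fun y => Eventually.of_forall fun x _ => ?_
      have t1 := sq_le_sq' (abs_le.1 (hu.reg.by'.1 x y)).1 (abs_le.1 (hu.reg.by'.1 x y)).2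
      have t2 := sq_le_sq' (abs_le.1 (hu.reg.bx.1 x y)).1 (abs_le.1 (hu.reg.bx.1 x y)).2
      have t3 := abs_le.1 (hM _ (hu.le_one x y)).1
      have t4 := sq_nonneg (pdx u x y)
      have t5 := sq_nonneg (pdy u x y)
      rw [Real.norm_eq_abs, abs_le]
      simp only [he]
      constructor <;> linarith
    · exact intervalIntegrable_const
    · exact Eventually.of_forall fun x _ => hpt x
  have hGlim : Tendsto G atTop (nhds ((∫ x in a..b, - F 1) - Sa * 1 - Sb * 1)) :=
    (hElim.sub ((hu.top a).const_mul Sa)).sub ((hu.top b).const_mul Sb)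
  have hfin : (∫ x in a..b, - F 1) - Sa * 1 - Sb * 1 ≤ G y₁ := by
    refine le_of_tendsto hGlim ?_
    filter_upwards [eventually_ge_atTop y₁] with y hy
    exact hGanti (Set.self_mem_Ici) hy hy
  have hSa0 : 0 ≤ Sa := Real.sqrt_nonneg _
  have hSb0 : 0 ≤ Sb := Real.sqrt_nonneg _
  have hsplit : ∫ x in a..b, (pdx u x y₁ ^ 2 / 2 + F (u x y₁) - F 1 - pdy u x y₁ ^ 2 / 2) =
      (∫ x in a..b, - F 1) - ∫ x in a..b, e y₁ x := by
    rw [← intervalIntegral.integral_sub intervalIntegrable_const ((ec y₁).intervalIntegrable _ _)]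
    congr 1; funext x; simp only [he]; ring
  rw [hsplit]
  have := (abs_le.1 (hu.le_one a y₁)).1
  have := (abs_le.1 (hu.le_one b y₁)).1
  simp only [hG] at hfin
  nlinarith

theorem BddLip.mul {K K' : ℝ} {w v : ℝ → ℝ → ℝ} (hw : BddLip K w) (hv : BddLip K' v) :
    BddLip (2 * (K * K')) (fun x y => w x y * v x y) := by
  have hK := hw.nonneg
  have hK' := hv.nonneg
  have h0 : 0 ≤ K * K' := by positivity
  refine ⟨fun x y => ?_, fun x y x' y' => ?_⟩
  · rw [abs_mul]
    have := mul_le_mul (hw.1 x y) (hv.1 x y) (abs_nonneg _) hK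
    linarith
  · rw [show w x y * v x y - w x' y' * v x' y' =
      w x y * (v x y - v x' y') + (w x y - w x' y') * v x' y' by ring]
    refine (abs_add_le _ _).trans ?_
    rw [abs_mul, abs_mul]
    have h1 := mul_le_mul (hw.1 x y) (hv.2 x y x' y') (abs_nonneg _) hK
    have h2 := mul_le_mul (hw.2 x y x' y') (hv.1 x' y') (abs_nonneg _) (by positivity)
    linarith

theorem BddLip.comp_of_lip {K M : ℝ} {w : ℝ → ℝ → ℝ} {φ : ℝ → ℝ} (hw : BddLip K w)
    (hw1 : ∀ x y, |w x y| ≤ 1) (hb : ∀ s, |s| ≤ 1 → |φ s| ≤ M)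
    (hl : ∀ s t, |s| ≤ 1 → |t| ≤ 1 → |φ s - φ t| ≤ M * |s - t|) :
    BddLip (M * (K + 1)) (fun x y => φ (w x y)) := by
  have hK := hw.nonneg
  have hM : 0 ≤ M := (abs_nonneg _).trans (hb 0 (by simp))
  refine ⟨fun x y => (hb _ (hw1 x y)).trans (by nlinarith), fun x y x' y' => ?_⟩
  have h0 : 0 ≤ |x - x'| + |y - y'| := by positivity
  refine (hl _ _ (hw1 x y) (hw1 x' y')).trans ?_
  have := mul_le_mul_of_nonneg_left (hw.2 x y x' y') hM
  nlinarith [mul_nonneg hM h0]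

theorem UnbalancedDoubleWell.exists_lip {F : ℝ → ℝ} (hF : UnbalancedDoubleWell F) : ∃ M,
    (∀ s, |s| ≤ 1 → |F s| ≤ M) ∧ ∀ s t, |s| ≤ 1 → |t| ≤ 1 → |F s - F t| ≤ M * |s - t| := by
  obtain ⟨M1, h1⟩ := (isCompact_Icc (a := (-1 : ℝ)) (b := 1)).exists_bound_of_continuousOn
    hF.1.continuous.continuousOn
  obtain ⟨M2, h2⟩ := (isCompact_Icc (a := (-1 : ℝ)) (b := 1)).exists_bound_of_continuousOn
    hF.continuous_deriv.continuousOn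
  refine ⟨max M1 M2, fun s hs => (h1 s (abs_le.1 hs)).trans (le_max_left _ _), fun s t hs ht => ?_⟩
  have := (convex_Icc (-1 : ℝ) 1).norm_image_sub_le_of_norm_deriv_le
    (fun x _ => (hF.hasDerivAt x).differentiableAt) (fun x hx => (h2 x hx).trans (le_max_right M1 _))
    (abs_le.1 ht) (abs_le.1 hs)
  exact this

/-- The energy estimate passes to limits of translates. -/
theorem RegWave.energy_tl_le {F : ℝ → ℝ} (hF : UnbalancedDoubleWell F) {c K : ℝ} (hc : 0 ≤ c)
    {u : ℝ → ℝ → ℝ} (hu : RegWave (deriv F) c K u) (𝒰 : Ultrafilter (ℝ × ℝ)) {a b : ℝ}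
    (hab : a ≤ b) :
    ∫ x in a..b, (pdx (tl 𝒰 u) x 0 ^ 2 / 2 + F (tl 𝒰 u x 0) - F 1 - pdy (tl 𝒰 u) x 0 ^ 2 / 2) ≤
      2 * √(4 * K * (1 - tl 𝒰 u a 0)) + 2 * √(4 * K * (1 - tl 𝒰 u b 0)) := by
  obtain ⟨M, hM1, hM2⟩ := hF.exists_lip
  obtain ⟨K', hw⟩ : ∃ K', BddLip K' (fun x y => pdx u x y ^ 2 / 2 + F (u x y) - F 1
      - pdy u x y ^ 2 / 2) := by
    have h1 := ((hu.reg.bx.mul hu.reg.bx).lin (hu.reg.by'.mul hu.reg.by') (1 / 2) (-1 / 2))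
    have h2 : BddLip (|F 1|) (fun _ _ => F 1) :=
      ⟨fun _ _ => le_rfl, fun _ _ _ _ => by simp; positivity⟩
    have h3 := h1.lin ((hu.reg.b.comp_of_lip hu.le_one hM1 hM2).lin h2 1 (-1)) 1 1
    have h4 : (fun x y => pdx u x y ^ 2 / 2 + F (u x y) - F 1 - pdy u x y ^ 2 / 2) =
        fun x y => 1 * (1 / 2 * (pdx u x y * pdx u x y) + -1 / 2 * (pdy u x y * pdy u x y))
          + 1 * (1 * F (u x y) + -1 * F 1) := by
      funext x y; ring
    exact ⟨_, h4 ▸ h3⟩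
  set w : ℝ → ℝ → ℝ := fun x y => pdx u x y ^ 2 / 2 + F (u x y) - F 1 - pdy u x y ^ 2 / 2 with hwdef
  obtain ⟨-, jx, jy, -, -⟩ := hu.reg.tl_jet (𝒰 := 𝒰)
  have htl : ∀ x y, tl 𝒰 w x y = pdx (tl 𝒰 u) x y ^ 2 / 2 + F (tl 𝒰 u x y) - F 1
      - pdy (tl 𝒰 u) x y ^ 2 / 2 := by
    intro x y
    apply tl_eq_of_tendsto
    rw [jx, jy]
    exact (((((hu.reg.bx.tendsto_tl x y).pow 2).div_const 2).add
      ((hF.1.continuous.tendsto _).comp (hu.reg.b.tendsto_tl x y))).sub_const _).sub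
      (((hu.reg.by'.tendsto_tl x y).pow 2).div_const 2)
  simp only [← htl]
  have hlim : Tendsto (fun p : ℝ × ℝ => 2 * √(4 * K * (1 - u (p.1 + a) (p.2 + 0)))
      + 2 * √(4 * K * (1 - u (p.1 + b) (p.2 + 0)))) 𝒰
      (nhds (2 * √(4 * K * (1 - tl 𝒰 u a 0)) + 2 * √(4 * K * (1 - tl 𝒰 u b 0)))) :=
    ((((hu.reg.b.tendsto_tl a 0).const_sub 1).const_mul _).sqrt.const_mul 2).add
      ((((hu.reg.b.tendsto_tl b 0).const_sub 1).const_mul _).sqrt.const_mul 2)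
  have hcw : Continuous fun x => tl 𝒰 w x 0 :=
    (hw.tl (𝒰 := 𝒰)).continuous.comp (f := fun x : ℝ => (x, (0 : ℝ))) (by fun_prop)
  refine le_of_forall_pos_le_add fun ε hε => ?_
  have hlim' := hlim.add_const ε
  refine ge_of_tendsto hlim' ?_
  have hcomp : IsCompact (Set.Icc a b ×ˢ ({0} : Set ℝ)) := isCompact_Icc.prod isCompact_singleton
  have hε' : 0 < ε / (b - a + 1) := by
    have : 0 < b - a + 1 := by linarith
    positivity
  filter_upwards [hw.uniform_tl 𝒰 hcomp hε'] with p hp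
  have hcp : Continuous fun x => w (p.1 + x) p.2 :=
    hw.continuous.comp (f := fun x : ℝ => (p.1 + x, p.2)) (by fun_prop)
  have h1 : ∫ x in a..b, tl 𝒰 w x 0 ≤ ∫ x in a..b, (w (p.1 + x) p.2 + ε / (b - a + 1)) := by
    apply intervalIntegral.integral_mono_on hab (hcw.intervalIntegrable _ _)
      ((hcp.add continuous_const).intervalIntegrable _ _)
    intro x hx
    have := (abs_lt.1 (hp (x, 0) ⟨hx, rfl⟩)).1
    simp only [add_zero] at this
    rw [Pi.add_apply]
    linarith
  rw [intervalIntegral.integral_add (hcp.intervalIntegrable _ _) intervalIntegrable_const,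
    intervalIntegral.integral_const,
    intervalIntegral.integral_comp_add_left (fun x => w x p.2) p.1] at h1
  have h2 := hu.energy_le hF hc (add_le_add_right hab p.1) p.2
  have h3 : (b - a) • (ε / (b - a + 1)) ≤ ε := by
    rw [smul_eq_mul, mul_div_assoc', div_le_iff₀ (by linarith)]
    nlinarith
  simp only [add_zero]
  linarith

/-- Limits of translates that do not depend on `y` are trivial. -/
theorem RegWave.goodWave {F : ℝ → ℝ} (hF : UnbalancedDoubleWell F) {c K : ℝ} (hc : 0 ≤ c)
    {u : ℝ → ℝ → ℝ} (hu : RegWave (deriv F) c K u) :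
    GoodWave (deriv F) c K u := by
  refine ⟨hu.toWave, fun 𝒰 hy => ?_⟩
  have hK : 0 < K := by linarith [hu.one_le]
  have hV := hu.toWave.tl hF.continuous_deriv 𝒰
  have hen := fun a b hab => hu.energy_tl_le hF hc 𝒰 (a := a) (b := b) hab
  set V := tl 𝒰 u with hVdef
  have hpy : ∀ x y, pdy V x y = 0 := by
    intro x y
    have h1 : (fun t => V x t) = fun _ => V x 0 := funext fun t => hy x t 0
    have h2 := hV.reg.c2.dy x y
    rw [h1] at h2
    exact h2.unique (hasDerivAt_const _ _)
  have hpyy : ∀ x y, pdyy V x y = 0 := by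
    intro x y
    have h1 : (fun t => pdy V x t) = fun _ => (0 : ℝ) := funext fun t => hpy x t
    have h2 := hV.reg.c2.dyy x y
    rw [h1] at h2
    exact h2.unique (hasDerivAt_const _ _)
  have hode : ∀ x y, pdxx V x y = deriv F (V x y) := by
    intro x y
    have h1 : pdxx V x y + pdyy V x y + c * pdy V x y = deriv F (V x y) := hV.eq x y
    rw [hpy, hpyy] at h1
    linarith
  have hv : ∀ x, HasDerivAt (fun t => V t 0) (pdx V x 0) x := fun x => hV.reg.c2.dx x 0
  have hv' : ∀ x, HasDerivAt (fun t => pdx V t 0) (deriv F (V x 0)) x := fun x => by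
    rw [← hode]; exact hV.reg.c2.dxx x 0
  have hEd : ∀ x, HasDerivAt (fun t => F (V t 0) - pdx V t 0 ^ 2 / 2) 0 x := by
    intro x
    refine (((hF.hasDerivAt (V x 0)).comp x (hv x)).sub (((hv' x).pow 2).div_const 2)).congr_deriv ?_
    push_cast; ring
  obtain ⟨E, hE⟩ : ∃ E, ∀ x, F (V x 0) - pdx V x 0 ^ 2 / 2 = E := by
    refine ⟨F (V 0 0) - pdx V 0 0 ^ 2 / 2, fun x => ?_⟩
    exact is_const_of_deriv_eq_zero (fun x => (hEd x).differentiableAt) (fun x => (hEd x).deriv) x 0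
  have hcx : Continuous fun x => pdx V x 0 :=
    continuous_iff_continuousAt.2 fun x => (hv' x).continuousAt
  have hcx2 : Continuous fun x => pdx V x 0 ^ 2 := hcx.pow 2
  have hen' : ∀ a b, a ≤ b → (∫ x in a..b, pdx V x 0 ^ 2) + (b - a) * (E - F 1) ≤
      2 * √(4 * K * (1 - V a 0)) + 2 * √(4 * K * (1 - V b 0)) := by
    intro a b hab
    refine le_trans (le_of_eq ?_) (hen a b hab)
    rw [show (b - a) * (E - F 1) = ∫ _x in a..b, (E - F 1) by
      rw [intervalIntegral.integral_const, smul_eq_mul],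
      ← intervalIntegral.integral_add (hcx2.intervalIntegrable _ _) intervalIntegrable_const]
    congr 1; funext x
    rw [hpy, ← hE x]; ring
  have hsup : (∀ x, V x 0 = -1) ∨ F 1 ≤ E := by
    have hbdd : BddAbove (Set.range fun x => V x 0) :=
      ⟨1, by rintro _ ⟨x, rfl⟩; exact (abs_le.1 (hV.le_one x 0)).2⟩
    set S := sSup (Set.range fun x => V x 0) with hS
    have hle : ∀ x, V x 0 ≤ S := fun x => le_csSup hbdd ⟨x, rfl⟩
    obtain ⟨s, hs⟩ : ∃ s : ℕ → ℝ, ∀ n : ℕ, S - 1 / ((n : ℝ) + 1) < V (s n) 0 := by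
      refine Classical.axiomOfChoice (r := fun (n : ℕ) x => S - 1 / ((n : ℝ) + 1) < V x 0) fun n => ?_
      obtain ⟨_, ⟨x, rfl⟩, hx⟩ := exists_lt_of_lt_csSup (Set.range_nonempty fun x => V x 0)
        (show S - 1 / ((n : ℝ) + 1) < S by have : 0 < 1 / ((n : ℝ) + 1) := by positivity
                                           linarith)
      exact ⟨x, hx⟩
    have hst : Tendsto (fun n => V (s n) 0) atTop (nhds S) := by
      have h1 := (tendsto_one_div_add_atTop_nhds_zero_nat (𝕜 := ℝ)).const_sub S
      rw [sub_zero] at h1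
      exact tendsto_of_tendsto_of_tendsto_of_le_of_le h1 tendsto_const_nhds
        (fun n => (hs n).le) (fun n => hle _)
    set 𝒱 : Ultrafilter (ℝ × ℝ) := (hyperfilter ℕ).map (fun n => (s n, (0 : ℝ))) with h𝒱
    have hW := hV.tl hF.continuous_deriv 𝒱
    obtain ⟨-, jx, -, jxx, -⟩ := hV.reg.tl_jet (𝒰 := 𝒱)
    have hW0 : tl 𝒱 V 0 0 = S := by
      apply tl_eq_of_tendsto
      rw [h𝒱, Ultrafilter.coe_map, tendsto_map'_iff]
      refine (hst.mono_left Nat.hyperfilter_le_atTop).congr fun n => ?_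
      simp
    have hWle : ∀ x, tl 𝒱 V x 0 ≤ S := fun x =>
      le_of_tendsto (hV.reg.b.tendsto_tl (𝒰 := 𝒱) x 0) (Eventually.of_forall fun p => by
        rw [hy _ _ 0]; exact hle _)
    have hWE : F (tl 𝒱 V 0 0) - pdx (tl 𝒱 V) 0 0 ^ 2 / 2 = E := by
      rw [jx]
      refine tendsto_nhds_unique (((hF.1.continuous.tendsto _).comp
        (hV.reg.b.tendsto_tl (𝒰 := 𝒱) 0 0)).sub
        (((hV.reg.bx.tendsto_tl (𝒰 := 𝒱) 0 0).pow 2).div_const 2)) ?_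
      have hxy : ∀ x y, pdx V x y = pdx V x 0 := fun x y => by
        have h1 : (fun t => V t y) = fun t => V t 0 := funext fun t => hy t y 0
        have h2 := hV.reg.c2.dx x y
        rw [h1] at h2
        exact h2.unique (hv x)
      refine Tendsto.congr (fun p => ?_) tendsto_const_nhds
      simp only [Function.comp]
      rw [hxy, hy _ _ 0, hE]
    have hWode : pdxx (tl 𝒱 V) 0 0 = deriv F (tl 𝒱 V 0 0) := by
      rw [jxx]
      refine tendsto_nhds_unique (hV.reg.bxx.tendsto_tl (𝒰 := 𝒱) 0 0) ?_
      refine ((hF.continuous_deriv.tendsto _).comp (hV.reg.b.tendsto_tl (𝒰 := 𝒱) 0 0)).congr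
        fun p => ?_
      rw [hode]; rfl
    have hmin : IsLocalMin (fun t => - tl 𝒱 V t 0) 0 :=
      Eventually.of_forall fun t => by
        show - tl 𝒱 V 0 0 ≤ - tl 𝒱 V t 0
        rw [hW0]; exact neg_le_neg (hWle t)
    obtain ⟨t1, t2⟩ := IsLocalMin.deriv_tests (fun t => (hW.reg.c2.dx t 0).neg)
      (hW.reg.c2.dxx 0 0).neg hmin
    rw [hWode, hW0] at t2
    rw [hW0, neg_eq_zero.1 t1] at hWE
    have hS1 : |S| ≤ 1 := hW0 ▸ hW.le_one 0 0
    rcases hF.le_of_deriv_nonpos hS1 (by linarith) with h | h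
    · left
      intro x
      have h1 := hle x
      have h2 := (abs_le.1 (hV.le_one x 0)).1
      linarith
    · right
      linarith
  rcases hsup with h | h
  · right
    intro x y
    rw [hy x y 0, h]
  left
  set C := 2 * √(8 * K) + 2 * √(8 * K) with hC
  have hCb : ∀ a b, 2 * √(4 * K * (1 - V a 0)) + 2 * √(4 * K * (1 - V b 0)) ≤ C := by
    intro a b
    have h1 : ∀ x, 4 * K * (1 - V x 0) ≤ 8 * K := fun x => by
      have := (abs_le.1 (hV.le_one x 0)).1
      nlinarith
    have := Real.sqrt_le_sqrt (h1 a)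
    have := Real.sqrt_le_sqrt (h1 b)
    linarith
  have hint0 : ∀ a b, a ≤ b → 0 ≤ ∫ x in a..b, pdx V x 0 ^ 2 := fun a b hab =>
    intervalIntegral.integral_nonneg hab fun x _ => sq_nonneg _
  have hEF : E = F 1 := by
    refine le_antisymm ?_ h
    by_contra hlt
    push Not at hlt
    have hpos : 0 < E - F 1 := by linarith
    have hC0 : 0 ≤ C := by positivity
    have h1 := hen' 0 ((C + 1) / (E - F 1)) (by positivity)
    have h2 := hint0 0 ((C + 1) / (E - F 1)) (by positivity)
    have h3 := hCb 0 ((C + 1) / (E - F 1))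
    rw [sub_zero, div_mul_cancel₀ _ hpos.ne'] at h1
    linarith
  have hen2 : ∀ a b, a ≤ b → (∫ x in a..b, pdx V x 0 ^ 2) ≤
      2 * √(4 * K * (1 - V a 0)) + 2 * √(4 * K * (1 - V b 0)) := by
    intro a b hab
    have := hen' a b hab
    rw [hEF] at this
    linarith
  have hbnd := fun t => hV.reg.bx.1 t 0
  have hlip : ∀ s t, |pdx V s 0 - pdx V t 0| ≤ K * |s - t| := fun s t => by
    have := hV.reg.bx.2 s 0 t 0
    simpa using this
  have hlip' : ∀ s t, |deriv F (V s 0) - deriv F (V t 0)| ≤ K * |s - t| := fun s t => by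
    have := hV.reg.bxx.2 s 0 t 0
    rw [hode, hode] at this
    simpa using this
  have htop : Tendsto (fun x => V x 0) atTop (nhds 1) :=
    tendsto_one_of_action hF hv' (fun t => hV.le_one t 0) hbnd hlip hlip'
      (fun t => (hE t).trans hEF) (C := C) (fun b hb => (hen2 0 b hb).trans (hCb 0 b))
  have hbot : Tendsto (fun x => V (-x) 0) atTop (nhds 1) := by
    refine tendsto_one_of_action hF (V' := fun x => - pdx V (-x) 0) (K := K) (C := C) (fun t => ?_)
      (fun t => hV.le_one (-t) 0) (fun t => ?_) (fun s t => ?_) (fun s t => ?_) (fun t => ?_)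
      (fun b hb => ?_)
    · refine ((hv' (-t)).comp t (hasDerivAt_neg t)).neg.congr_deriv ?_
      ring
    · rw [abs_neg]; exact hbnd _
    · have := hlip (-t) (-s)
      rw [show -t - -s = s - t by ring] at this
      rwa [show - pdx V (-s) 0 - - pdx V (-t) 0 = pdx V (-t) 0 - pdx V (-s) 0 by ring]
    · have := hlip' (-s) (-t)
      rwa [show -s - -t = -(s - t) by ring, abs_neg] at this
    · rw [neg_sq]; exact (hE _).trans hEF
    · simp only [neg_sq]
      rw [intervalIntegral.integral_comp_neg (fun x => pdx V x 0 ^ 2)]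
      exact (hen2 _ _ (by linarith)).trans (hCb _ _)
  have hI : ∀ t, HasDerivAt (fun b => ∫ x in (0 : ℝ)..b, pdx V x 0 ^ 2) (pdx V t 0 ^ 2) t := fun t =>
    intervalIntegral.integral_hasDerivAt_right (hcx2.intervalIntegrable _ _)
      (hcx2.stronglyMeasurableAtFilter _ _) hcx2.continuousAt
  have hmono : Monotone (fun b => ∫ x in (0 : ℝ)..b, pdx V x 0 ^ 2) :=
    monotone_of_hasDerivAt_nonneg hI fun t => sq_nonneg _
  have hconst : ∀ s t, s ≤ t →
      (∫ x in (0 : ℝ)..t, pdx V x 0 ^ 2) ≤ ∫ x in (0 : ℝ)..s, pdx V x 0 ^ 2 := by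
    intro s t hst
    have hlim : Tendsto (fun n : ℝ => 2 * √(4 * K * (1 - V (-n) 0)) + 2 * √(4 * K * (1 - V n 0)))
        atTop (nhds 0) := by
      have := (((hbot.const_sub 1).const_mul (4 * K)).sqrt.const_mul 2).add
        (((htop.const_sub 1).const_mul (4 * K)).sqrt.const_mul 2)
      simpa using this
    have : (∫ x in (0 : ℝ)..t, pdx V x 0 ^ 2) - (∫ x in (0 : ℝ)..s, pdx V x 0 ^ 2) ≤ 0 := by
      refine ge_of_tendsto hlim ?_
      filter_upwards [eventually_ge_atTop (max |s| |t|)] with n hn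
      have h1 : -n ≤ s := by linarith [neg_abs_le s, le_max_left |s| |t|]
      have h2 : t ≤ n := by linarith [le_abs_self t, le_max_right |s| |t|]
      have h3 := hmono h1
      have h4 := hmono h2
      have h5 := hen2 (-n) n (by linarith)
      rw [← intervalIntegral.integral_interval_sub_left (hcx2.intervalIntegrable 0 n)
        (hcx2.intervalIntegrable 0 (-n))] at h5
      simp only at h3 h4
      linarith
    linarith
  have hzero : ∀ t, pdx V t 0 = 0 := by
    intro t
    have h1 : (fun b => ∫ x in (0 : ℝ)..b, pdx V x 0 ^ 2) =
        fun _ => ∫ x in (0 : ℝ)..0, pdx V x 0 ^ 2 := by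
      funext b
      rcases le_total 0 b with hb | hb
      · exact le_antisymm (hconst _ _ hb) (hmono hb)
      · exact le_antisymm (hmono hb) (hconst _ _ hb)
    have h2 := hI t
    rw [h1] at h2
    exact pow_eq_zero_iff (two_ne_zero) |>.1 (h2.unique (hasDerivAt_const _ _))
  intro x y
  rw [hy x y 0]
  refine hF.eq_one (hV.le_one x 0) ?_ ?_
  · have h1 : (fun t => pdx V t 0) = fun _ => (0 : ℝ) := funext hzero
    have h2 := hv' x
    rw [h1] at h2
    exact h2.unique (hasDerivAt_const _ _)
  · have := hE x
    rw [hzero, hEF] at this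
    linarith

theorem exists_ultrafilter_of_antitone {α : Type*} {P : ℕ → α → Prop} (h : ∀ n, ∃ p, P n p)
    (hanti : ∀ p n k, n ≤ k → P k p → P n p) :
    ∃ 𝒰 : Ultrafilter α, ∀ n, ∀ᶠ p in (𝒰 : Filter α), P n p := by
  choose s hs using h
  refine ⟨(hyperfilter ℕ).map s, fun n => ?_⟩
  rw [Ultrafilter.coe_map, eventually_map]
  exact Nat.hyperfilter_le_atTop ((eventually_ge_atTop n).mono fun k hk => hanti _ _ _ hk (hs k))

theorem tendsto_zero_of_nat {α : Type*} {l : Filter α} {φ : α → ℝ} {C : ℝ}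
    (h : ∀ n : ℕ, ∀ᶠ p in l, |φ p| ≤ C / (n + 1)) : Tendsto φ l (nhds 0) := by
  rw [Metric.tendsto_nhds]
  intro ε hε
  have h1 : Tendsto (fun n : ℕ => C * (1 / ((n : ℝ) + 1))) atTop (nhds 0) := by
    simpa using (tendsto_one_div_add_atTop_nhds_zero_nat (𝕜 := ℝ)).const_mul C
  obtain ⟨n, hn⟩ := (h1.eventually (gt_mem_nhds hε)).exists
  filter_upwards [h n] with p hp
  rw [Real.dist_eq, sub_zero]
  refine hp.trans_lt ?_
  rwa [mul_one_div] at hn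

theorem exists_nat_div_lt (C : ℝ) {ε : ℝ} (hε : 0 < ε) : ∃ n : ℕ, C / ((n : ℝ) + 1) < ε := by
  have h1 : Tendsto (fun n : ℕ => C * (1 / ((n : ℝ) + 1))) atTop (nhds 0) := by
    simpa using (tendsto_one_div_add_atTop_nhds_zero_nat (𝕜 := ℝ)).const_mul C
  obtain ⟨n, hn⟩ := (h1.eventually (gt_mem_nhds hε)).exists
  exact ⟨n, by rwa [mul_one_div] at hn⟩

/-- The nonlinearity `f` is increasing at rate `β` on the `ε`-neighbourhoods of `±1`. -/
structure Wells (f : ℝ → ℝ) (L ε β : ℝ) : Prop where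
  nb : NonlinBound f L
  ε_pos : 0 < ε
  ε_le : ε ≤ 1 / 2
  β_pos : 0 < β
  left : ∀ s, -1 ≤ s → s ≤ -1 + ε → β ≤ deriv f s
  right : ∀ s, 1 - ε ≤ s → s ≤ 1 → β ≤ deriv f s

theorem UnbalancedDoubleWell.exists_wells {F : ℝ → ℝ} (hF : UnbalancedDoubleWell F) :
    ∃ L ε β, Wells (deriv F) L ε β := by
  obtain ⟨L, hL⟩ := exists_nonlinBound hF.contDiff_deriv
  have hc : Continuous (deriv (deriv F)) := hF.contDiff_deriv.continuous_deriv (by norm_num)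
  obtain ⟨-, -, -, hm, hp, -⟩ := hF
  have h1 := (hc.tendsto (-1)).eventually (lt_mem_nhds (half_lt_self hm))
  have h2 := (hc.tendsto 1).eventually (lt_mem_nhds (half_lt_self hp))
  obtain ⟨e1, he1, h1⟩ := Metric.eventually_nhds_iff.1 h1
  obtain ⟨e2, he2, h2⟩ := Metric.eventually_nhds_iff.1 h2
  refine ⟨L, min (1 / 2) (min (e1 / 2) (e2 / 2)),
    min (deriv (deriv F) (-1) / 2) (deriv (deriv F) 1 / 2), hL, by positivity, min_le_left _ _,
    by positivity, fun s a b => ?_, fun s a b => ?_⟩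
  · have : min (1 / 2) (min (e1 / 2) (e2 / 2)) ≤ e1 / 2 := (min_le_right _ _).trans (min_le_left _ _)
    refine (min_le_left _ _).trans (h1 ?_).le
    rw [Real.dist_eq, abs_lt]; constructor <;> linarith
  · have : min (1 / 2) (min (e1 / 2) (e2 / 2)) ≤ e2 / 2 := (min_le_right _ _).trans (min_le_right _ _)
    refine (min_le_right _ _).trans (h2 ?_).le
    rw [Real.dist_eq, abs_lt]; constructor <;> linarith

section Comparison

theorem NonlinBound.continuous {f : ℝ → ℝ} {L : ℝ} (hf : NonlinBound f L) : Continuous f :=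
  continuous_iff_continuousAt.2 fun s => (hf.diff s).continuousAt

variable {f : ℝ → ℝ} {c K L ε β : ℝ} {u v : ℝ → ℝ → ℝ}

theorem Wells.sub_le (hf : Wells f L ε β) {s t : ℝ} (hs : -1 ≤ s) (hst : s ≤ t) (ht : t ≤ 1)
    (h : t ≤ -1 + ε ∨ 1 - ε ≤ s) : β * (t - s) ≤ f t - f s := by
  have hd : ∀ r ∈ Set.Icc s t, β ≤ deriv f r := by
    rintro r ⟨h1, h2⟩
    rcases h with h | h
    · exact hf.left r (hs.trans h1) (h2.trans h)
    · exact hf.right r (h.trans h1) (h2.trans ht)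
  have := (convex_Icc s t).mul_sub_le_image_sub_of_le_deriv
    (fun x _ => (hf.nb.diff x).continuousAt.continuousWithinAt)
    (fun x _ => (hf.nb.diff x).differentiableAt.differentiableWithinAt)
    (fun x hx => hd x (interior_subset hx))
  exact this s (Set.left_mem_Icc.2 hst) t (Set.right_mem_Icc.2 hst) hst

theorem Wells.deriv_ge (hf : Wells f L ε β) {s : ℝ} (hs : |s| ≤ 1)
    (h : ¬ (-1 + ε ≤ s ∧ s ≤ 1 - ε)) : β ≤ deriv f s := by
  obtain ⟨h1, h2⟩ := abs_le.1 hs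
  rcases lt_or_ge s (-1 + ε) with h3 | h3
  · exact hf.left s h1 h3.le
  · exact hf.right s (le_of_not_ge fun h4 => h ⟨h3, h4⟩) h2

/-- Comparison of a supersolution and a subsolution which are ordered except possibly where both
are near the same well. -/
theorem Wells.tail_comparison (hf : Wells f L ε β) {D : Set (ℝ × ℝ)} (hD : IsClosed D)
    (hv : IsC2 v) (hu : IsC2 u) (hv1 : ∀ x y, |v x y| ≤ 1) (hu1 : ∀ x y, |u x y| ≤ 1)
    (hvs : ∀ x y, Lop c v x y ≤ f (v x y)) (hus : ∀ x y, f (u x y) ≤ Lop c u x y)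
    (h : ∀ p ∈ D, v p.1 p.2 < u p.1 p.2 →
      D ∈ nhds p ∧ (u p.1 p.2 ≤ -1 + ε ∨ 1 - ε ≤ v p.1 p.2)) :
    ∀ p ∈ D, u p.1 p.2 ≤ v p.1 p.2 := by
  have key := IsC2.nonneg_of_lop_le hD (hv.sub hu) (A := 2) (c := c) (fun p _ => by
    have := (abs_le.1 (hv1 p.1 p.2)).1
    have := (abs_le.1 (hu1 p.1 p.2)).2
    linarith) hf.β_pos (fun p hp hlt => by
    have hlt' : v p.1 p.2 < u p.1 p.2 := by linarith
    obtain ⟨h1, h2⟩ := h p hp hlt'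
    refine ⟨h1, ?_⟩
    rw [hv.lop_sub hu]
    have := hf.sub_le (abs_le.1 (hv1 p.1 p.2)).1 hlt'.le (abs_le.1 (hu1 p.1 p.2)).2 h2
    have := hvs p.1 p.2
    have := hus p.1 p.2
    linarith)
  intro p hp
  have := key p hp
  linarith

/-- Sliding a supersolution down until it either reaches the height `τ₁` or touches the
subsolution, possibly at infinity. -/
theorem Wells.slide_or_contact (hf : Wells f L ε β) {D : Set (ℝ × ℝ)} (hD : IsClosed D)
    (hv : IsC2 v) (hvb : BddLip K v) (hu : IsC2 u) (hv1 : ∀ x y, |v x y| ≤ 1)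
    (hu1 : ∀ x y, |u x y| ≤ 1) (hvs : ∀ x y, Lop c v x y ≤ f (v x y))
    (hus : ∀ x y, f (u x y) ≤ Lop c u x y) {τ₁ t₀ : ℝ} (ht₀ : τ₁ ≤ t₀)
    (hbd : ∀ τ, τ₁ ≤ τ → ∀ p ∈ D, v p.1 (p.2 + τ) < u p.1 p.2 → D ∈ nhds p)
    (hH : ∀ p ∈ D, -1 + ε ≤ u p.1 p.2 → 1 - ε ≤ v p.1 (p.2 + t₀)) :
    (∀ p ∈ D, u p.1 p.2 ≤ v p.1 (p.2 + τ₁)) ∨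
    ∃ τ, τ₁ < τ ∧ (∀ p ∈ D, u p.1 p.2 ≤ v p.1 (p.2 + τ)) ∧ ∃ 𝒰 : Ultrafilter (ℝ × ℝ),
      (∀ᶠ p in (𝒰 : Filter (ℝ × ℝ)), p ∈ D) ∧
      (∀ᶠ p in (𝒰 : Filter (ℝ × ℝ)), -1 + ε ≤ u p.1 p.2 ∧ u p.1 p.2 ≤ 1 - ε / 2) ∧
      Tendsto (fun p : ℝ × ℝ => v p.1 (p.2 + τ) - u p.1 p.2) 𝒰 (nhds 0) := by
  have hcomp : ∀ τ, τ₁ ≤ τ → (∀ p ∈ D, v p.1 (p.2 + τ) < u p.1 p.2 →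
      (u p.1 p.2 ≤ -1 + ε ∨ 1 - ε ≤ v p.1 (p.2 + τ))) → ∀ p ∈ D, u p.1 p.2 ≤ v p.1 (p.2 + τ) := by
    intro τ hτ h
    have h0 := hv.shift 0 τ
    have h1 : ∀ x y, Lop c (fun x y => v (x + 0) (y + τ)) x y ≤ f (v (x + 0) (y + τ)) := by
      intro x y; rw [hv.lop_shift]; exact hvs _ _
    simp only [add_zero] at h0 h1
    exact hf.tail_comparison hD h0 hu (fun x y => hv1 _ _) hu1 h1 hus
      fun p hp hlt => ⟨hbd τ hτ p hp hlt, h p hp hlt⟩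
  set T : Set ℝ := {τ | τ₁ ≤ τ ∧ ∀ p ∈ D, u p.1 p.2 ≤ v p.1 (p.2 + τ)} with hT
  have ht₀T : t₀ ∈ T := ⟨ht₀, hcomp t₀ ht₀ fun p hp _ => by
    rcases le_total (u p.1 p.2) (-1 + ε) with h | h
    · exact Or.inl h
    · exact Or.inr (hH p hp h)⟩
  have hTclosed : IsClosed T := by
    rw [hT, Set.ofPred_and]
    refine isClosed_Ici.inter ?_
    simp only [Set.ofPred_forall]
    refine isClosed_iInter fun p => isClosed_iInter fun _ => ?_
    refine isClosed_le continuous_const ?_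
    exact hvb.continuous.comp (f := fun τ : ℝ => (p.1, p.2 + τ)) (by fun_prop)
  have hTb : BddBelow T := ⟨τ₁, fun τ h => h.1⟩
  have hτ := hTclosed.csInf_mem ⟨t₀, ht₀T⟩ hTb
  set τ := sInf T with hτdef
  rcases hτ.1.eq_or_lt with h | h
  · left; rw [h]; exact hτ.2
  right
  refine ⟨τ, h, hτ.2, ?_⟩
  have hK := hvb.nonneg
  obtain ⟨𝒰, h𝒰⟩ := exists_ultrafilter_of_antitone (P := fun (n : ℕ) (p : ℝ × ℝ) => p ∈ D ∧
      -1 + ε ≤ u p.1 p.2 ∧ v p.1 (p.2 + τ) - u p.1 p.2 ≤ K / (n + 1) ∧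
      v p.1 (p.2 + τ) ≤ 1 - ε + K / (n + 1)) (fun n => by
    have hn : 0 < 1 / ((n : ℝ) + 1) := by positivity
    set s := max τ₁ (τ - 1 / ((n : ℝ) + 1)) with hs
    have hs1 : s < τ := max_lt h (by linarith)
    have hs2 : s ∉ T := fun hs' => absurd (csInf_le hTb hs') (not_le.2 hs1)
    have hs3 : ¬ ∀ p ∈ D, v p.1 (p.2 + s) < u p.1 p.2 →
        (u p.1 p.2 ≤ -1 + ε ∨ 1 - ε ≤ v p.1 (p.2 + s)) := fun h' =>
      hs2 ⟨le_max_left _ _, hcomp s (le_max_left _ _) h'⟩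
    push Not at hs3
    obtain ⟨p, hp, h1, h2, h3⟩ := hs3
    have h4 := (abs_le.1 (hvb.2 p.1 (p.2 + τ) p.1 (p.2 + s))).2
    have h5 : |p.2 + τ - (p.2 + s)| ≤ 1 / ((n : ℝ) + 1) := by
      rw [add_sub_add_left_eq_sub, abs_of_pos (by linarith)]
      have := le_max_right τ₁ (τ - 1 / ((n : ℝ) + 1))
      linarith
    have h6 : K * (|p.1 - p.1| + |p.2 + τ - (p.2 + s)|) ≤ K / ((n : ℝ) + 1) := by
      rw [sub_self, abs_zero, zero_add, div_eq_mul_one_div]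
      gcongr
    exact ⟨p, hp, h2.le, by linarith, by linarith⟩) (fun p n k hnk hp => by
    obtain ⟨h1, h2, h3, h4⟩ := hp
    have h5 : K / ((k : ℝ) + 1) ≤ K / ((n : ℝ) + 1) := by gcongr
    exact ⟨h1, h2, h3.trans h5, h4.trans (by linarith)⟩)
  refine ⟨𝒰, (h𝒰 0).mono fun p hp => hp.1, ?_, ?_⟩
  · obtain ⟨n, hn⟩ := exists_nat_div_lt K (half_pos hf.ε_pos)
    filter_upwards [h𝒰 n] with p hp
    exact ⟨hp.2.1, by linarith [hτ.2 p hp.1, hp.2.2.2]⟩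
  · refine tendsto_zero_of_nat (C := K) fun n => ?_
    filter_upwards [h𝒰 n] with p hp
    rw [abs_of_nonneg (by linarith [hτ.2 p hp.1])]
    exact hp.2.2.1

/-- Sliding on the whole plane: the contact at infinity gives coinciding limits. -/
theorem Wells.slide (hf : Wells f L ε β) (hv : Reg K v) (hu : Reg K u)
    (hv1 : ∀ x y, |v x y| ≤ 1)
    (hu1 : ∀ x y, |u x y| ≤ 1) (hvs : ∀ x y, Lop c v x y ≤ f (v x y))
    (hus : ∀ x y, f (u x y) ≤ Lop c u x y) {τ₁ t₀ : ℝ} (ht₀ : τ₁ ≤ t₀)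
    (hH : ∀ x y, -1 + ε ≤ u x y → 1 - ε ≤ v x (y + t₀)) :
    (∀ x y, u x y ≤ v x (y + τ₁)) ∨
    ∃ τ, τ₁ < τ ∧ (∀ x y, u x y ≤ v x (y + τ)) ∧ ∃ 𝒰 : Ultrafilter (ℝ × ℝ),
      (∀ᶠ p in (𝒰 : Filter (ℝ × ℝ)), -1 + ε ≤ u p.1 p.2 ∧ u p.1 p.2 ≤ 1 - ε / 2) ∧
      ∀ x y, tl 𝒰 u x y = tl 𝒰 v x (y + τ) := by
  rcases hf.slide_or_contact isClosed_univ hv.c2 hv.b hu.c2 hv1 hu1 hvs hus ht₀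
    (fun _ _ p _ _ => univ_mem) (fun p _ => hH p.1 p.2) with h | ⟨τ, h1, h2, 𝒰, -, h3, h4⟩
  · exact Or.inl fun x y => h (x, y) trivial
  have hcf := hf.nb.continuous
  right
  refine ⟨τ, h1, fun x y => h2 (x, y) trivial, 𝒰, h3, ?_⟩
  have hV : Reg K (fun x y => v (x + 0) (y + τ)) := hv.shift 0 τ
  have hbound : ∀ {w : ℝ → ℝ → ℝ}, BddLip K w → (∀ x y, |w x y| ≤ 1) → ∀ x y, |tl 𝒰 w x y| ≤ 1 :=
    fun hw h x y => le_of_tendsto (hw.tendsto_tl x y).abs (Eventually.of_forall fun p => h _ _)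
  have key := eq_of_touch (c := c) hf.nb (hV.tl (𝒰 := 𝒰)).c2 (hu.tl (𝒰 := 𝒰)).c2
    (hbound hV.b fun x y => hv1 _ _) (hbound hu.b hu1)
    (fun x y => le_of_tendsto_of_tendsto (hV.tendsto_lop c x y)
      ((hcf.tendsto _).comp (hV.b.tendsto_tl x y)) (Eventually.of_forall fun p => by
        beta_reduce; rw [hv.c2.lop_shift]; exact hvs _ _))
    (fun x y => le_of_tendsto_of_tendsto ((hcf.tendsto _).comp (hu.b.tendsto_tl x y))
      (hu.tendsto_lop c x y) (Eventually.of_forall fun p => hus _ _))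
    (fun x y => le_of_tendsto_of_tendsto (hu.b.tendsto_tl x y) (hV.b.tendsto_tl x y)
      (Eventually.of_forall fun p => by
        have := h2 (p.1 + x, p.2 + y) trivial
        simpa using this))
    (x₀ := 0) (y₀ := 0) (by
      have h5 := (hV.b.tendsto_tl (𝒰 := 𝒰) 0 0).sub (hu.b.tendsto_tl (𝒰 := 𝒰) 0 0)
      simp only [add_zero] at h5
      have := tendsto_nhds_unique h5 h4
      simp only [add_zero]
      linarith)
  intro x y
  rw [key, hv.b.tl_shift, add_zero]

end Comparison

theorem Reg.hasDerivAt_line {K : ℝ} {w : ℝ → ℝ → ℝ} (hw : Reg K w) (a b x₀ y₀ t : ℝ) :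
    HasDerivAt (fun t => w (x₀ + a * t) (y₀ + b * t))
      (a * pdx w (x₀ + a * t) (y₀ + b * t) + b * pdy w (x₀ + a * t) (y₀ + b * t)) t := by
  have hK := hw.b.nonneg
  refine hasDerivAt_of_quadratic (K := K * a ^ 2 + K * (|b| * |a|) + K * b ^ 2) fun s => ?_
  set X := x₀ + a * t
  set Y := y₀ + b * t
  set X' := x₀ + a * s
  set Y' := y₀ + b * s
  have eX : X' - X = a * (s - t) := by simp only [X, X']; ring
  have eY : Y' - Y = b * (s - t) := by simp only [Y, Y']; ring
  have h1 := abs_taylor_le hK (fun r => hw.c2.dx r Y') (fun r r' => by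
    simpa using hw.bx.2 r Y' r' Y') X X'
  have h2 := abs_taylor_le hK (fun r => hw.c2.dy X r) (fun r r' => by
    simpa using hw.by'.2 X r X r') Y Y'
  have h3 : |(pdx w X Y' - pdx w X Y) * (X' - X)| ≤ K * (|b| * |a|) * (s - t) ^ 2 := by
    rw [abs_mul, eX, abs_mul]
    have h4 := hw.bx.2 X Y' X Y
    rw [sub_self, abs_zero, zero_add, eY, abs_mul] at h4
    calc |pdx w X Y' - pdx w X Y| * (|a| * |s - t|) ≤ K * (|b| * |s - t|) * (|a| * |s - t|) := by
          gcongr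
      _ = K * (|b| * |a|) * |s - t| ^ 2 := by ring
      _ = _ := by rw [sq_abs]
  have e : w X' Y' - w X Y - (a * pdx w X Y + b * pdy w X Y) * (s - t) =
      (w X' Y' - w X Y' - pdx w X Y' * (X' - X)) + (pdx w X Y' - pdx w X Y) * (X' - X) +
      (w X Y' - w X Y - pdy w X Y * (Y' - Y)) := by
    rw [eX, eY]; ring
  rw [e]
  rw [eX] at h1
  rw [eY] at h2
  refine (abs_add_three _ _ _).trans ?_
  rw [← eX] at h1
  rw [← eY] at h2
  have e1 : K * (X' - X) ^ 2 = K * a ^ 2 * (s - t) ^ 2 := by rw [eX]; ring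
  have e2 : K * (Y' - Y) ^ 2 = K * b ^ 2 * (s - t) ^ 2 := by rw [eY]; ring
  rw [e1] at h1
  rw [e2] at h2
  linarith

section Windows

variable {f : ℝ → ℝ} {c K L ε β : ℝ} {u v : ℝ → ℝ → ℝ}

theorem GoodWave.front_tl (hf : NonlinBound f L) (hu : GoodWave f c K u) {𝒰 : Ultrafilter (ℝ × ℝ)}
    {δ : ℝ} (hδ : 0 < δ)
    (h : ∀ᶠ p in (𝒰 : Filter (ℝ × ℝ)), -1 + δ ≤ u p.1 p.2 ∧ u p.1 p.2 ≤ 1 - δ) :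
    Front (_root_.tl 𝒰 u) := by
  have h0 := hu.reg.b.tendsto_tl (𝒰 := 𝒰) 0 0
  simp only [add_zero] at h0
  have h1 : -1 + δ ≤ _root_.tl 𝒰 u 0 0 := ge_of_tendsto h0 (h.mono fun p hp => hp.1)
  have h2 : _root_.tl 𝒰 u 0 0 ≤ 1 - δ := le_of_tendsto h0 (h.mono fun p hp => hp.2)
  rcases (hu.tl hf.continuous 𝒰).trichotomy hf with h3 | h3 | h3
  · rw [h3] at h2; linarith
  · rw [h3] at h1; linarith
  · exact h3

theorem GoodWave.exists_rise (hf : NonlinBound f L) (hu : GoodWave f c K u) {δ : ℝ} (hδ : 0 < δ) :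
    ∃ R > 0, ∀ x y, -1 + δ ≤ u x y → 1 - δ ≤ u x (y + R) := by
  by_contra hcon
  push Not at hcon
  obtain ⟨𝒰, h𝒰⟩ := exists_ultrafilter_of_antitone (P := fun (n : ℕ) (p : ℝ × ℝ) =>
    -1 + δ ≤ u p.1 p.2 ∧ u p.1 (p.2 + (n + 1)) ≤ 1 - δ) (fun n => by
      obtain ⟨x, y, h1, h2⟩ := hcon (n + 1) (by positivity)
      exact ⟨(x, y), h1, h2.le⟩) (fun p n k hnk hp => ⟨hp.1, (hu.mono _ (by gcongr)).trans hp.2⟩)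
  have h1 : -1 + δ ≤ _root_.tl 𝒰 u 0 0 :=
    ge_of_tendsto (hu.reg.b.tendsto_tl (𝒰 := 𝒰) 0 0) ((h𝒰 0).mono fun p hp => by simpa using hp.1)
  have h2 : ∀ y, _root_.tl 𝒰 u 0 y ≤ 1 - δ := by
    intro y
    obtain ⟨n, hn⟩ := exists_nat_ge y
    refine le_of_tendsto (hu.reg.b.tendsto_tl (𝒰 := 𝒰) 0 y) ((h𝒰 n).mono fun p hp => ?_)
    rw [add_zero]
    exact (hu.mono _ (by linarith)).trans hp.2
  rcases (hu.tl hf.continuous 𝒰).trichotomy hf with h3 | h3 | h3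
  · have := h2 0; rw [h3] at this; linarith
  · rw [h3] at h1; linarith
  · have := le_of_tendsto (h3.top 0) (Eventually.of_forall h2)
    linarith

theorem RegWave.exists_pdy_lower (hf : NonlinBound f L) (hg : GoodWave f c K u)
    (hu : RegWave f c K u) {δ : ℝ} (hδ : 0 < δ) :
    ∃ γ > 0, ∀ x y, -1 + δ ≤ u x y → u x y ≤ 1 - δ → γ ≤ pdy u x y := by
  obtain ⟨R, hR, hrise⟩ := hg.exists_rise hf (half_pos hδ)
  have hK : 0 < K := by linarith [hu.one_le]
  set η := δ / (4 * R) with hη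
  have hη0 : 0 < η := by positivity
  obtain ⟨γ, hγ, hgrow⟩ := exists_growth_const (c := c) (L := L) (ρ := η / (2 * K)) (D₁ := R)
    (D := R + 1) (η := η) (by positivity) hR.le (by linarith) hη0 hf.pos.le
  refine ⟨γ, hγ, fun x y h1 h2 => ?_⟩
  have h3 := hrise x y (by linarith)
  obtain ⟨b, ⟨hb1, hb2⟩, hb⟩ := exists_hasDerivAt_eq_slope (u x) (pdy u x)
    (show y < y + R by linarith) (fun t _ => (hu.reg.c2.dy x t).continuousAt.continuousWithinAt)
    (fun t _ => hu.reg.c2.dy x t)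
  have hb' : 2 * η ≤ pdy u x b := by
    rw [hb, add_sub_cancel_left, hη, le_div_iff₀ hR]
    have : 2 * (δ / (4 * R)) * R = δ / 2 := by field_simp; ring
    linarith
  refine hgrow (pdy u) x b hu.liny.c2 (fun x' y' _ => ⟨(hu.pos _ _).le, ?_⟩) (fun x' y' h => ?_)
    x y ?_
  · rw [hu.liny.eq]
    exact mul_le_mul_of_nonneg_right ((le_abs_self _).trans (hf.bd' _ (hu.le_one _ _)))
      (hu.pos _ _).le
  · have h4 := (abs_le.1 (hu.liny.b.2 x' y' x b)).1
    have h5 : |x' - x| ≤ η / (2 * K) := abs_le_of_sq_le_sq (by nlinarith [sq_nonneg (y' - b)]) (by positivity)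
    have h6 : |y' - b| ≤ η / (2 * K) := abs_le_of_sq_le_sq (by nlinarith [sq_nonneg (x' - x)]) (by positivity)
    have h7 : K * (|x' - x| + |y' - b|) ≤ K * (η / (2 * K) + η / (2 * K)) := by gcongr
    have h8 : K * (η / (2 * K) + η / (2 * K)) = η := by field_simp; ring
    linarith
  · nlinarith

/-- A solution of the linearised equation that is asymptotically nonnegative and vanishes along
`𝒰` has zero limit. -/
theorem IsLinSol.tl_eq_zero (hf : NonlinBound f L) (hu1 : ∀ x y, |u x y| ≤ 1) {q : ℝ → ℝ → ℝ}
    (hq : IsLinSol f c K u q) {𝒰 : Ultrafilter (ℝ × ℝ)}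
    (hnn : ∀ R e : ℝ, 0 < e → ∀ᶠ p in (𝒰 : Filter (ℝ × ℝ)), ∀ x y, (x - p.1) ^ 2 + (y - p.2) ^ 2 ≤ R ^ 2 →
      -e ≤ q x y)
    (h0 : Tendsto (fun p : ℝ × ℝ => q p.1 p.2) 𝒰 (nhds 0)) (x y : ℝ) : tl 𝒰 q x y = 0 := by
  have hnn' : 0 ≤ tl 𝒰 q x y := by
    refine le_of_forall_pos_le_add fun e he => ?_
    have h1 : -e ≤ tl 𝒰 q x y := by
      refine ge_of_tendsto (hq.b.tendsto_tl x y) ((hnn (√(x ^ 2 + y ^ 2)) e he).mono fun p hp => ?_)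
      refine hp _ _ ?_
      rw [Real.sq_sqrt (by positivity)]
      apply le_of_eq; ring
    linarith
  by_contra hne
  have hpos : 0 < tl 𝒰 q x y := lt_of_le_of_ne hnn' (Ne.symm hne)
  have hK := hq.b.nonneg
  set η := tl 𝒰 q x y / 4 with hη
  have hη0 : 0 < η := by positivity
  set ρ := η / (2 * (K + 1)) with hρ
  have hρ0 : 0 < ρ := by positivity
  set r := |x| + |y| with hr
  have hr0 : 0 ≤ r := by positivity
  obtain ⟨η', hη', hgrow⟩ := exists_growth_const (c := c) (L := 3 * L) (ρ := ρ) (D₁ := r)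
    (D := r + 1) hρ0 hr0 (by linarith) hη0 (by linarith [hf.pos])
  set e := min (η' / 4) η with he
  have he0 : 0 < e := by positivity
  have hloc : ∀ᶠ p in (𝒰 : Filter (ℝ × ℝ)), 2 * η < q (p.1 + x) (p.2 + y) :=
    (hq.b.tendsto_tl x y).eventually (lt_mem_nhds (by linarith))
  have hsmall : ∀ᶠ p in (𝒰 : Filter (ℝ × ℝ)), q p.1 p.2 < η' / 4 :=
    h0.eventually (gt_mem_nhds (by positivity))
  obtain ⟨p, h1, h2, h3⟩ := (hloc.and (hsmall.and (hnn (2 * r + 1) e he0))).exists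
  have hC : IsC2 (fun x y => 1 * q x y + 1 * (2 * e)) := hq.c2.lin (isC2_const _).1 1 1
  have hrsq : ∀ x' y', (x' - (p.1 + x)) ^ 2 + (y' - (p.2 + y)) ^ 2 ≤ (r + 1) ^ 2 →
      (x' - p.1) ^ 2 + (y' - p.2) ^ 2 ≤ (2 * r + 1) ^ 2 := by
    intro x' y' h
    set A := x' - (p.1 + x)
    set B := y' - (p.2 + y)
    have e1 : x' - p.1 = A + x := by simp only [A]; ring
    have e2 : y' - p.2 = B + y := by simp only [B]; ring
    rw [e1, e2]
    have hxy : x ^ 2 + y ^ 2 ≤ r ^ 2 := by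
      rw [hr]; nlinarith [sq_abs x, sq_abs y, abs_nonneg x, abs_nonneg y, mul_nonneg (abs_nonneg x) (abs_nonneg y)]
    have hCS : (A * x + B * y) ≤ (r + 1) * r := by
      apply le_of_sq_le_sq _ (by positivity)
      have : (A * x + B * y) ^ 2 ≤ (A ^ 2 + B ^ 2) * (x ^ 2 + y ^ 2) := by
        nlinarith [sq_nonneg (A * y - B * x)]
      refine this.trans ?_
      rw [mul_pow]
      exact mul_le_mul h hxy (by positivity) (by positivity)
    nlinarith
  have key := hgrow _ (p.1 + x) (p.2 + y) hC (fun x' y' h => ?_) (fun x' y' h => ?_) p.1 p.2 ?_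
  · have : e ≤ η' / 4 := min_le_left _ _
    linarith
  · have h4 := h3 x' y' (hrsq x' y' h)
    refine ⟨by linarith, ?_⟩
    rw [hq.c2.lop_lin (isC2_const _).1, lop_const, hq.eq]
    have h5 : |q x' y'| ≤ 3 * (1 * q x' y' + 1 * (2 * e)) := by
      rw [abs_le]; constructor <;> linarith
    have h6 : deriv f (u x' y') * q x' y' ≤ L * |q x' y'| := by
      refine (le_abs_self _).trans ?_
      rw [abs_mul]
      exact mul_le_mul_of_nonneg_right (hf.bd' _ (hu1 _ _)) (abs_nonneg _)
    have := mul_le_mul_of_nonneg_left h5 hf.pos.le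
    linarith
  · have h4 := (abs_le.1 (hq.b.2 x' y' (p.1 + x) (p.2 + y))).1
    have h5 : |x' - (p.1 + x)| ≤ ρ :=
      abs_le_of_sq_le_sq (by nlinarith [sq_nonneg (y' - (p.2 + y))]) (by positivity)
    have h6 : |y' - (p.2 + y)| ≤ ρ :=
      abs_le_of_sq_le_sq (by nlinarith [sq_nonneg (x' - (p.1 + x))]) (by positivity)
    have h7 : K * (|x' - (p.1 + x)| + |y' - (p.2 + y)|) ≤ (K + 1) * (ρ + ρ) := by
      gcongr; linarith
    have h8 : (K + 1) * (ρ + ρ) = η := by rw [hρ]; field_simp; ring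
    linarith
  · rw [sub_add_cancel_left, sub_add_cancel_left, neg_sq, neg_sq, hr]
    nlinarith [sq_abs x, sq_abs y, mul_nonneg (abs_nonneg x) (abs_nonneg y)]

end Windows

/-- `g` is the normalised increasing one-dimensional wave with speed `c₀`. -/
structure Profile (f : ℝ → ℝ) (c₀ : ℝ) (g : ℝ → ℝ) : Prop where
  pos : 0 < c₀
  smooth : ContDiff ℝ 3 g
  eq : ∀ s, deriv (deriv g) s + c₀ * deriv g s = f (g s)
  top : Tendsto g atTop (nhds 1)
  bot : Tendsto g atBot (nhds (-1))
  zero : g 0 = 0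
  mono : StrictMono g

/-- The planar function with profile `g` and level lines of slope `θ`. -/
noncomputable def planar (g : ℝ → ℝ) (θ x y : ℝ) : ℝ := g ((y - θ * x) / √(1 + θ ^ 2))

section Profile

variable {f g : ℝ → ℝ} {c c₀ K L ε β θ : ℝ} {u v : ℝ → ℝ → ℝ}

theorem sqrt_one_add_sq_pos (θ : ℝ) : 0 < √(1 + θ ^ 2) := Real.sqrt_pos.2 (by positivity)

theorem Profile.hasDerivAt (hg : Profile f c₀ g) (s : ℝ) : HasDerivAt g (deriv g s) s :=
  (hg.smooth.differentiable (by norm_num) s).hasDerivAt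

theorem Profile.hasDerivAt_deriv (hg : Profile f c₀ g) (s : ℝ) :
    HasDerivAt (deriv g) (deriv (deriv g) s) s := by
  have h : ContDiff ℝ 2 (deriv g) :=
    ((contDiff_succ_iff_deriv (n := 2)).1 hg.smooth).2.2
  exact (h.differentiable (by norm_num) s).hasDerivAt

theorem Profile.deriv_nonneg (hg : Profile f c₀ g) (s : ℝ) : 0 ≤ deriv g s :=
  hg.mono.monotone.deriv_nonneg

theorem Profile.exists_deriv_pos (hg : Profile f c₀ g) : ∃ s, 0 < deriv g s := by
  by_contra h
  push Not at h
  have := is_const_of_deriv_eq_zero (hg.smooth.differentiable (by norm_num))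
    (fun s => le_antisymm (h s) (hg.deriv_nonneg s)) 0 1
  exact (hg.mono (by norm_num : (0 : ℝ) < 1)).ne this

theorem Profile.abs_lt_one (hg : Profile f c₀ g) (s : ℝ) : |g s| < 1 := by
  rw [abs_lt]
  constructor
  · have h1 : -1 ≤ g (s - 1) := le_of_tendsto hg.bot
      ((eventually_le_atBot (s - 1)).mono fun t ht => hg.mono.monotone ht)
    exact h1.trans_lt (hg.mono (by linarith))
  · have h1 : g (s + 1) ≤ 1 := ge_of_tendsto hg.top
      ((eventually_ge_atTop (s + 1)).mono fun t ht => hg.mono.monotone ht)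
    exact (hg.mono (by linarith)).trans_le h1

theorem Profile.planar_contDiff (hg : Profile f c₀ g) (θ : ℝ) :
    ContDiff ℝ 3 (fun p : ℝ × ℝ => planar g θ p.1 p.2) :=
  hg.smooth.comp (by fun_prop)

theorem Profile.planar_lop (hg : Profile f c₀ g) (θ c x y : ℝ) : Lop c (planar g θ) x y =
    f (planar g θ x y) + (c / √(1 + θ ^ 2) - c₀) * deriv g ((y - θ * x) / √(1 + θ ^ 2)) := by
  have hs := sqrt_one_add_sq_pos θ
  have hs2 : √(1 + θ ^ 2) ^ 2 = 1 + θ ^ 2 := Real.sq_sqrt (by positivity)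
  set s := √(1 + θ ^ 2) with hsdef
  have hdx : ∀ x y, HasDerivAt (fun t => (y - θ * t) / s) (-θ / s) x := fun x y =>
    ((((hasDerivAt_id x).const_mul θ).const_sub y).div_const s).congr_deriv (by simp)
  have hdy : ∀ x y, HasDerivAt (fun t => (t - θ * x) / s) (1 / s) y := fun x y =>
    (((hasDerivAt_id y).sub_const (θ * x)).div_const s)
  obtain ⟨-, h1, h2, h3, h4⟩ := isC2_of_jet (w := planar g θ)
    (wx := fun x y => deriv g ((y - θ * x) / s) * (-θ / s))
    (wy := fun x y => deriv g ((y - θ * x) / s) * (1 / s))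
    (wxx := fun x y => deriv (deriv g) ((y - θ * x) / s) * (-θ / s) * (-θ / s))
    (wyy := fun x y => deriv (deriv g) ((y - θ * x) / s) * (1 / s) * (1 / s))
    (fun x y => (hg.hasDerivAt _).comp x (hdx x y)) (fun x y => (hg.hasDerivAt _).comp y (hdy x y))
    (fun x y => ((hg.hasDerivAt_deriv _).comp x (hdx x y)).mul_const _)
    (fun x y => ((hg.hasDerivAt_deriv _).comp y (hdy x y)).mul_const _)
    (hg.planar_contDiff θ).continuous
  have e := hg.eq ((y - θ * x) / s)
  simp only [Lop, h2, h3, h4]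
  have e2 : planar g θ x y = g ((y - θ * x) / s) := rfl
  rw [e2, ← e]
  have e3 : (-θ / s) * (-θ / s) + (1 / s) * (1 / s) = 1 := by
    field_simp
    linarith
  linear_combination deriv (deriv g) ((y - θ * x) / s) * e3

theorem Profile.planar_abs_le (hg : Profile f c₀ g) (θ x y : ℝ) : |planar g θ x y| ≤ 1 :=
  (hg.abs_lt_one _).le

theorem Profile.planar_reg (hf : NonlinBound f L) (hg : Profile f c₀ g) (θ : ℝ) :
    ∃ K, Reg K (planar g θ) := by
  have hs := sqrt_one_add_sq_pos θ
  obtain ⟨K, -, h, -⟩ := exists_reg (c := c₀ * √(1 + θ ^ 2)) hf (hg.planar_contDiff θ)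
    (fun x y => by rw [hg.planar_lop, mul_div_cancel_right₀ _ hs.ne']; ring) (hg.planar_abs_le θ)
  exact ⟨K, h⟩

theorem Profile.planar_front (hg : Profile f c₀ g) (θ : ℝ) : Front (planar g θ) where
  mono x y y' h := hg.mono (by have := sqrt_one_add_sq_pos θ; gcongr)
  top x := hg.top.comp (((tendsto_atTop_add_const_right _ (-(θ * x)) tendsto_id)).atTop_div_const
    (sqrt_one_add_sq_pos θ))
  bot x := hg.bot.comp (((tendsto_atBot_add_const_right _ (-(θ * x)) tendsto_id)).atBot_div_const
    (sqrt_one_add_sq_pos θ))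

theorem planar_zero_left (g : ℝ → ℝ) (θ x y : ℝ) : planar g θ x y = planar g θ 0 (y - θ * x) := by
  simp [planar]

theorem Front.gt_neg_one (h : Front u) (x y : ℝ) : -1 < u x y :=
  (le_of_tendsto (h.bot x) ((eventually_le_atBot (y - 1)).mono fun t ht =>
    (h.mono x).monotone ht)).trans_lt (h.mono x (by linarith))

theorem Front.lt_one (h : Front u) (x y : ℝ) : u x y < 1 :=
  (h.mono x (by linarith : y < y + 1)).trans_le (ge_of_tendsto (h.top x)
    ((eventually_ge_atTop (y + 1)).mono fun t ht => (h.mono x).monotone ht))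

theorem Front.exists_lt (h : Front u) (x : ℝ) {a : ℝ} (ha : -1 < a) : ∃ y, u x y < a :=
  ((h.bot x).eventually (gt_mem_nhds ha)).exists

theorem Front.exists_gt (h : Front u) (x : ℝ) {a : ℝ} (ha : a < 1) : ∃ y, a < u x y :=
  ((h.top x).eventually (lt_mem_nhds ha)).exists

/-- A planar supersolution and a planar subsolution with the same slope are translates. -/
theorem Wells.eq_shift_of_slope (hf : Wells f L ε β)
    (hv : IsC2 v) (hvb : BddLip K v) (hu : IsC2 u) (hv1 : ∀ x y, |v x y| ≤ 1)
    (hu1 : ∀ x y, |u x y| ≤ 1) (hvs : ∀ x y, Lop c v x y ≤ f (v x y))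
    (hus : ∀ x y, f (u x y) ≤ Lop c u x y) (hvF : Front v) (huF : Front u)
    (hvθ : ∀ x y, v x y = v 0 (y - θ * x)) (huθ : ∀ x y, u x y = u 0 (y - θ * x)) :
    ∃ τ, ∀ x y, u x y = v x (y + τ) := by
  have hε := hf.ε_pos
  obtain ⟨τ₁, hτ₁⟩ := hvF.exists_lt 0 (huF.gt_neg_one 0 0)
  obtain ⟨s₁, hs₁⟩ := huF.exists_lt 0 (show -1 < -1 + ε by linarith)
  obtain ⟨s₂, hs₂⟩ := hvF.exists_gt 0 (show 1 - ε < 1 by linarith)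
  obtain ⟨s₃, hs₃⟩ := huF.exists_gt 0 (show 1 - ε / 2 < 1 by linarith)
  rcases hf.slide_or_contact isClosed_univ hv hvb hu hv1 hu1 hvs hus
    (le_max_left τ₁ (s₂ - s₁)) (fun _ _ p _ _ => univ_mem) (fun p _ h => by
      rw [huθ] at h
      have h1 : s₁ < p.2 - θ * p.1 := (huF.mono 0).lt_iff_lt.1 (hs₁.trans_le h)
      rw [hvθ]
      refine hs₂.le.trans ((hvF.mono 0).monotone ?_)
      have := le_max_right τ₁ (s₂ - s₁)
      linarith) with h | ⟨τ, h1, h2, 𝒰, -, h3, h4⟩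
  · have := h (0, 0) trivial
    simp only [zero_add] at this
    linarith
  refine ⟨τ, ?_⟩
  have h5 : ∀ᶠ p in (𝒰 : Filter (ℝ × ℝ)), p.2 - θ * p.1 ∈ Set.Icc s₁ s₃ := h3.mono fun p hp => by
    rw [huθ] at hp
    exact ⟨((huF.mono 0).lt_iff_lt.1 (hs₁.trans_le hp.1)).le,
      ((huF.mono 0).lt_iff_lt.1 (hp.2.trans_lt hs₃)).le⟩
  obtain ⟨s, -, hs⟩ := isCompact_Icc.ultrafilter_le_nhds
    (𝒰.map fun p : ℝ × ℝ => p.2 - θ * p.1) (by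
      rw [le_principal_iff, Ultrafilter.mem_coe, Ultrafilter.mem_map]; exact h5)
  have hs' : Tendsto (fun p : ℝ × ℝ => p.2 - θ * p.1) 𝒰 (nhds s) := hs
  have h6 : Tendsto (fun p : ℝ × ℝ => v p.1 (p.2 + τ) - u p.1 p.2) 𝒰
      (nhds (v 0 (s + τ) - u 0 s)) := by
    have e : (fun p : ℝ × ℝ => v p.1 (p.2 + τ) - u p.1 p.2) =
        (fun r => v 0 (r + τ) - u 0 r) ∘ (fun p : ℝ × ℝ => p.2 - θ * p.1) := by
      funext p
      simp only [Function.comp_apply]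
      rw [hvθ p.1, huθ p.1]
      ring_nf
    rw [e]
    refine Tendsto.comp (Continuous.tendsto ?_ s) hs'
    exact (hv.cont.comp (f := fun r : ℝ => ((0 : ℝ), r + τ)) (by fun_prop)).sub
      (hu.cont.comp (f := fun r : ℝ => ((0 : ℝ), r)) (by fun_prop))
  have h7 := tendsto_nhds_unique h6 h4
  have hV := hv.shift 0 τ
  have hVs : ∀ x y, Lop c (fun x y => v (x + 0) (y + τ)) x y ≤ f (v (x + 0) (y + τ)) := by
    intro x y; rw [hv.lop_shift]; exact hvs _ _
  simp only [add_zero] at hV hVs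
  exact eq_of_touch hf.nb hV hu (fun _ _ => hv1 _ _) hu1 hVs hus (fun x y => h2 (x, y) trivial)
    (x₀ := 0) (y₀ := s) (by linarith)

theorem Reg.eq_of_slope (hu : Reg K u) (hq : ∀ x y, pdx u x y + θ * pdy u x y = 0) (x y : ℝ) :
    u x y = u 0 (y - θ * x) := by
  have h := is_const_of_deriv_eq_zero
    (fun t => (hu.hasDerivAt_line 1 θ 0 (y - θ * x) t).differentiableAt)
    (fun t => by rw [(hu.hasDerivAt_line 1 θ 0 (y - θ * x) t).deriv, one_mul, hq]) x 0
  simpa using h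

/-- A wave which is constant along lines of slope `θ` is the planar wave. -/
theorem Wave.eq_planar (hf : Wells f L ε β) (hg : Profile f c₀ g) (hu : Wave f c K u)
    (huF : Front u) (hq : ∀ x y, pdx u x y + θ * pdy u x y = 0) :
    c = c₀ * √(1 + θ ^ 2) ∧ ∃ b, ∀ x y, u x y = planar g θ x (y + b) := by
  have hs := sqrt_one_add_sq_pos θ
  obtain ⟨K', hP⟩ := hg.planar_reg hf.nb θ
  have huθ := hu.reg.eq_of_slope hq
  obtain ⟨b, hb⟩ : ∃ b, ∀ x y, u x y = planar g θ x (y + b) := by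
    rcases le_total (c / √(1 + θ ^ 2)) c₀ with h | h
    · refine hf.eq_shift_of_slope hP.c2 hP.b hu.reg.c2 (hg.planar_abs_le θ) hu.le_one
        (fun x y => ?_) (fun x y => (hu.eq x y).ge) (hg.planar_front θ) huF (planar_zero_left g θ)
        huθ
      rw [hg.planar_lop]
      have := mul_nonneg (sub_nonneg.2 h) (hg.deriv_nonneg ((y - θ * x) / √(1 + θ ^ 2)))
      linarith
    · obtain ⟨τ, hτ⟩ := hf.eq_shift_of_slope hu.reg.c2 hu.reg.b hP.c2 hu.le_one
        (hg.planar_abs_le θ) (fun x y => (hu.eq x y).le) (fun x y => by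
          rw [hg.planar_lop]
          have := mul_nonneg (sub_nonneg.2 h) (hg.deriv_nonneg ((y - θ * x) / √(1 + θ ^ 2)))
          linarith) huF (hg.planar_front θ) huθ (planar_zero_left g θ)
      refine ⟨-τ, fun x y => ?_⟩
      rw [hτ, neg_add_cancel_right]
  refine ⟨?_, b, hb⟩
  obtain ⟨s, hs'⟩ := hg.exists_deriv_pos
  have e : u = fun x y => planar g θ (x + 0) (y + b) := by
    funext x y; rw [add_zero]; exact hb x y
  have h1 := hu.eq 0 (s * √(1 + θ ^ 2) - b)
  rw [e, hP.c2.lop_shift, hg.planar_lop] at h1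
  simp only [add_zero, sub_add_cancel, mul_zero, sub_zero, mul_div_cancel_right₀ _ hs.ne'] at h1
  have h2 : (c / √(1 + θ ^ 2) - c₀) * deriv g s = 0 := by linarith
  have h3 := (mul_eq_zero.1 h2).resolve_right hs'.ne'
  field_simp at h3
  linarith

theorem BddLip.tl_lin {K' : ℝ} {𝒰 : Ultrafilter (ℝ × ℝ)} (hu : BddLip K u) (hv : BddLip K' v)
    (a b x y : ℝ) : _root_.tl 𝒰 (fun x y => a * u x y + b * v x y) x y =
      a * _root_.tl 𝒰 u x y + b * _root_.tl 𝒰 v x y :=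
  tl_eq_of_tendsto (((hu.tendsto_tl x y).const_mul a).add ((hv.tendsto_tl x y).const_mul b))

theorem Front.reg_wave (hu : RegWave f c K u) : Front u :=
  ⟨fun x => strictMono_of_deriv_pos (hu.pos x), hu.top, hu.bot⟩

/-- A limit of translates on which a directional derivative degenerates is planar. -/
theorem RegWave.tl_eq_planar (hf : Wells f L ε β) (hg : Profile f c₀ g) (hu : RegWave f c K u)
    (hgood : GoodWave f c K u) {𝒰 : Ultrafilter (ℝ × ℝ)} {δ a : ℝ} (hδ : 0 < δ) (ha : a ≠ 0)
    (h : ∀ᶠ p in (𝒰 : Filter (ℝ × ℝ)), -1 + δ ≤ u p.1 p.2 ∧ u p.1 p.2 ≤ 1 - δ)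
    (hnn : ∀ R e : ℝ, 0 < e → ∀ᶠ p in (𝒰 : Filter (ℝ × ℝ)), ∀ x y,
      (x - p.1) ^ 2 + (y - p.2) ^ 2 ≤ R ^ 2 → -e ≤ a * pdx u x y + a * θ * pdy u x y)
    (h0 : Tendsto (fun p : ℝ × ℝ => a * pdx u p.1 p.2 + a * θ * pdy u p.1 p.2) 𝒰 (nhds 0)) :
    c = c₀ * √(1 + θ ^ 2) ∧ ∃ b, ∀ x y, _root_.tl 𝒰 u x y = planar g θ x (y + b) := by
  refine (hu.toWave.tl hf.nb.continuous 𝒰).eq_planar hf hg (hgood.front_tl hf.nb hδ h) ?_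
  intro x y
  have h1 := (hu.linx.lin hu.liny a (a * θ)).tl_eq_zero hf.nb hu.le_one hnn h0 x y
  rw [hu.linx.b.tl_lin hu.liny.b] at h1
  obtain ⟨-, h2, h3, -⟩ := hu.reg.tl_jet (𝒰 := 𝒰)
  rw [h2, h3]
  have h4 : a * (_root_.tl 𝒰 (pdx u) x y + θ * _root_.tl 𝒰 (pdy u) x y) = 0 := by linarith
  exact (mul_eq_zero.1 h4).resolve_left ha

theorem Wells.nonneg_of_mid (hf : Wells f L ε β) (hu1 : ∀ x y, |u x y| ≤ 1) {w : ℝ → ℝ → ℝ}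
    (hw : IsLinSol f c K u w) (h : ∀ x y, -1 + ε ≤ u x y → u x y ≤ 1 - ε → 0 ≤ w x y) (x y : ℝ) :
    0 ≤ w x y := by
  refine IsC2.nonneg_of_lop_le isClosed_univ hw.c2 (A := K) (c := c)
    (fun p _ => (abs_le.1 (hw.b.1 p.1 p.2)).1) hf.β_pos (fun p _ hlt => ⟨univ_mem, ?_⟩)
    (x, y) trivial
  rw [hw.eq]
  exact mul_le_mul_of_nonpos_right (hf.deriv_ge (hu1 _ _) fun h' =>
    absurd (h p.1 p.2 h'.1 h'.2) (not_le.2 hlt)) hlt.le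

/-- The extremal slope of the level lines is attained by a planar limit. -/
theorem RegWave.exists_window (hf : Wells f L ε β) (hg : Profile f c₀ g) (hu : RegWave f c K u)
    (hgood : GoodWave f c K u) : ∃ θ, (∀ x y, 0 ≤ pdx u x y + θ * pdy u x y) ∧
      c = c₀ * √(1 + θ ^ 2) ∧ ∃ (𝒰 : Ultrafilter (ℝ × ℝ)) (b : ℝ),
        ∀ x y, _root_.tl 𝒰 u x y = planar g θ x (y + b) := by
  have hε := hf.ε_pos
  have hK : 0 < K := by linarith [hu.one_le]
  obtain ⟨γ, hγ, hlow⟩ := hu.exists_pdy_lower hf.nb hgood hε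
  set A : Set ℝ := {θ | ∀ x y, 0 ≤ pdx u x y + θ * pdy u x y} with hA
  have hmid : ∀ θ, (∀ x y, -1 + ε ≤ u x y → u x y ≤ 1 - ε → 0 ≤ pdx u x y + θ * pdy u x y) →
      θ ∈ A := by
    intro θ h x y
    have := hf.nonneg_of_mid hu.le_one (hu.linx.lin hu.liny 1 θ) (fun x y h1 h2 => by
      rw [one_mul]; exact h x y h1 h2) x y
    rwa [one_mul] at this
  have hne : K / γ ∈ A := hmid _ fun x y h1 h2 => by
    have h3 := hlow x y h1 h2
    have h4 := (abs_le.1 (hu.linx.b.1 x y)).1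
    have h5 : K / γ * γ ≤ K / γ * pdy u x y := by gcongr
    rw [div_mul_cancel₀ _ hγ.ne'] at h5
    linarith
  have hbd : BddBelow A := ⟨-pdx u 0 0 / pdy u 0 0, fun θ h => by
    rw [div_le_iff₀ (hu.pos 0 0)]
    linarith [h 0 0]⟩
  have hcl : IsClosed A := by
    rw [hA]
    simp only [Set.ofPred_forall]
    exact isClosed_iInter fun x => isClosed_iInter fun y =>
      isClosed_le continuous_const (by fun_prop)
  have hθ := hcl.csInf_mem ⟨_, hne⟩ hbd
  set θ := sInf A with hθdef
  obtain ⟨𝒰, h𝒰⟩ := exists_ultrafilter_of_antitone (P := fun (n : ℕ) (p : ℝ × ℝ) =>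
    (-1 + ε ≤ u p.1 p.2 ∧ u p.1 p.2 ≤ 1 - ε) ∧
      |1 * pdx u p.1 p.2 + 1 * θ * pdy u p.1 p.2| ≤ K / (n + 1)) (fun n => by
    have hn : (0 : ℝ) < 1 / ((n : ℝ) + 1) := by positivity
    have h1 : θ - 1 / ((n : ℝ) + 1) ∉ A := fun h => by
      have := csInf_le hbd h
      linarith
    have h2 := mt (hmid _) h1
    push Not at h2
    obtain ⟨x, y, h3, h4, h5⟩ := h2
    refine ⟨(x, y), ⟨h3, h4⟩, ?_⟩
    rw [one_mul, one_mul, abs_of_nonneg (hθ x y)]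
    have h6 := (abs_le.1 (hu.liny.b.1 x y)).2
    have h7 : 1 / ((n : ℝ) + 1) * pdy u x y ≤ 1 / ((n : ℝ) + 1) * K := by gcongr
    rw [one_div_mul_eq_div ((n : ℝ) + 1) K] at h7
    linarith) (fun p n k hnk hp => ⟨hp.1, hp.2.trans (by gcongr)⟩)
  obtain ⟨h1, b, h2⟩ := hu.tl_eq_planar (θ := θ) hf hg hgood hε one_ne_zero
    ((h𝒰 0).mono fun p hp => hp.1)
    (fun R e he => Eventually.of_forall fun p x y _ => by
      have := hθ x y
      rw [one_mul, one_mul]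
      linarith) (tendsto_zero_of_nat fun n => (h𝒰 n).mono fun p hp => hp.2)
  exact ⟨θ, hθ, h1, 𝒰, b, h2⟩

end Profile

section Symmetries

variable {F : ℝ → ℝ} {c : ℝ} {u : ℝ → ℝ → ℝ}

theorem IsTravelingWave.isC2 (hu : IsTravelingWave F c u) : IsC2 u :=
  ContDiff.isC2 (hu.1.1.of_le (by norm_num))

theorem IsTravelingWave.reflect (hu : IsTravelingWave F c u) (a : ℝ) :
    IsTravelingWave F c (fun x y => u (a - x) y) := by
  obtain ⟨-, -, h2, h3, h4⟩ := hu.isC2.reflect_jet a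
  obtain ⟨⟨k1, k2, k3, k4⟩, k5, k6⟩ := hu
  refine ⟨⟨k1.comp (f := fun p : ℝ × ℝ => (a - p.1, p.2)) (by fun_prop), fun x y => ?_,
    fun x y => k3 _ _, fun x y => ?_⟩, fun x => k5 _, fun x => k6 _⟩
  · rw [h2, h3, h4]; exact k2 _ _
  · rw [h2]; exact k4 _ _

theorem IsTravelingWave.shift (hu : IsTravelingWave F c u) (a b : ℝ) :
    IsTravelingWave F c (fun x y => u (x + a) (y + b)) := by
  obtain ⟨-, -, h2, h3, h4⟩ := hu.isC2.shift_jet a b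
  obtain ⟨⟨k1, k2, k3, k4⟩, k5, k6⟩ := hu
  refine ⟨⟨k1.comp (f := fun p : ℝ × ℝ => (p.1 + a, p.2 + b)) (by fun_prop), fun x y => ?_,
    fun x y => k3 _ _, fun x y => ?_⟩, fun x => (k5 _).comp (tendsto_atTop_add_const_right _ b tendsto_id),
    fun x => (k6 _).comp (tendsto_atBot_add_const_right _ b tendsto_id)⟩
  · rw [h2, h3, h4]; exact k2 _ _
  · rw [h2]; exact k4 _ _

end Symmetries

theorem tl_map_reflect {K : ℝ} {u : ℝ → ℝ → ℝ} (𝒰 : Ultrafilter (ℝ × ℝ))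
    (hu : BddLip K fun x y => u (0 - x) y) (x y : ℝ) :
    tl (𝒰.map fun p : ℝ × ℝ => (0 - p.1, p.2)) u x y = tl 𝒰 (fun x y => u (0 - x) y) (-x) y := by
  refine tl_eq_of_tendsto ?_
  rw [Ultrafilter.coe_map, tendsto_map'_iff]
  refine (hu.tendsto_tl (-x) y).congr fun p => ?_
  simp only [Function.comp_apply]
  congr 1
  ring

/-- A wave whose level lines have asymptotic slopes both `m` and `-m`. -/
structure VWave (F : ℝ → ℝ) (c c₀ : ℝ) (g : ℝ → ℝ) (m K : ℝ) (u : ℝ → ℝ → ℝ) : Prop where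
  tw : IsTravelingWave F c u
  reg : RegWave (deriv F) c K u
  good : GoodWave (deriv F) c K u
  m_pos : 0 < m
  speed : c = c₀ * √(1 + m ^ 2)
  cone : ∀ x y, |pdx u x y| ≤ m * pdy u x y
  right : ∃ (𝒰 : Ultrafilter (ℝ × ℝ)) (b : ℝ), ∀ x y, tl 𝒰 u x y = planar g m x (y + b)
  left : ∃ (𝒰 : Ultrafilter (ℝ × ℝ)) (b : ℝ), ∀ x y, tl 𝒰 u x y = planar g (-m) x (y + b)

theorem planar_neg (g : ℝ → ℝ) (θ x y : ℝ) : planar g θ (-x) y = planar g (-θ) x y := by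
  simp [planar]

section Classification

variable {F g : ℝ → ℝ} {c c₀ L ε β m K : ℝ} {u : ℝ → ℝ → ℝ}

theorem Profile.sq_eq_of_speed {f : ℝ → ℝ} (hg : Profile f c₀ g) {θ θ' : ℝ}
    (h : c = c₀ * √(1 + θ ^ 2)) (h' : c = c₀ * √(1 + θ' ^ 2)) : θ ^ 2 = θ' ^ 2 := by
  have h1 : √(1 + θ ^ 2) = √(1 + θ' ^ 2) := mul_left_cancel₀ hg.pos.ne' (h.symm.trans h')
  rw [Real.sqrt_inj (by positivity) (by positivity)] at h1
  linarith

theorem IsTravelingWave.planar_or_vWave (hF : UnbalancedDoubleWell F)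
    (hf : Wells (deriv F) L ε β) (hg : Profile (deriv F) c₀ g) (hc : 0 ≤ c)
    (hu : IsTravelingWave F c u) :
    (∃ θ b, c = c₀ * √(1 + θ ^ 2) ∧ ∀ x y, u x y = planar g θ x (y + b)) ∨
      ∃ m K, VWave F c c₀ g m K u := by
  obtain ⟨K, hr⟩ := hu.exists_regWave hf.nb
  obtain ⟨K', hr'⟩ := (hu.reflect 0).exists_regWave hf.nb
  have hgd := hr.goodWave hF hc
  obtain ⟨θ, hθ, hcθ, hw⟩ := hr.exists_window hf hg hgd
  obtain ⟨θ', hθ', hcθ', 𝒰, b, hw'⟩ := hr'.exists_window hf hg (hr'.goodWave hF hc)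
  have hθ'' : ∀ x y, pdx u x y ≤ θ' * pdy u x y := by
    intro x y
    obtain ⟨-, h1, h2, -⟩ := hu.isC2.reflect_jet 0
    have := hθ' (-x) y
    rw [h1, h2] at this
    simp only [zero_sub, neg_neg] at this
    linarith
  have hsq := hg.sq_eq_of_speed hcθ hcθ'
  by_cases h : θ' = -θ
  · left
    obtain ⟨h1, b, hb⟩ := hr.toWave.eq_planar (θ := θ) hf hg (Front.reg_wave hr) fun x y => by
      have h2 := hθ'' x y
      rw [h] at h2
      linarith [hθ x y]
    exact ⟨θ, b, h1, hb⟩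
  · right
    have h1 : θ' = θ := by
      rcases sq_eq_sq_iff_eq_or_eq_neg.1 hsq with h2 | h2
      · exact h2.symm
      · exact absurd (by linarith) h
    subst h1
    have h2 : 0 ≤ 2 * θ' := by
      have := hθ 0 0
      have := hθ'' 0 0
      by_contra hneg
      nlinarith [hr.pos 0 0]
    have h3 : θ' ≠ 0 := fun h0 => h (by rw [h0]; simp)
    refine ⟨θ', K, hu, hr, hgd, lt_of_le_of_ne (by linarith) h3.symm, hcθ, fun x y => ?_, hw,
      𝒰.map fun p : ℝ × ℝ => (0 - p.1, p.2), b, fun x y => ?_⟩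
    · rw [abs_le]
      exact ⟨by linarith [hθ x y], hθ'' x y⟩
    · rw [tl_map_reflect 𝒰 hr'.reg.b, hw', planar_neg]

theorem VWave.reflect (hF : UnbalancedDoubleWell F) (hf : Wells (deriv F) L ε β) (hc : 0 ≤ c)
    (hu : VWave F c c₀ g m K u) : ∃ K', VWave F c c₀ g m K' (fun x y => u (0 - x) y) := by
  obtain ⟨K', hr'⟩ := (hu.tw.reflect 0).exists_regWave hf.nb
  have e : (fun x y => (fun x y => u (0 - x) y) (0 - x) y) = u := by
    funext x y; simp
  have hw : ∀ {θ}, (∃ (𝒰 : Ultrafilter (ℝ × ℝ)) (b : ℝ), ∀ x y, tl 𝒰 u x y = planar g θ x (y + b)) →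
      ∃ (𝒰 : Ultrafilter (ℝ × ℝ)) (b : ℝ),
        ∀ x y, tl 𝒰 (fun x y => u (0 - x) y) x y = planar g (-θ) x (y + b) := by
    rintro θ ⟨𝒰, b, h⟩
    refine ⟨𝒰.map fun p : ℝ × ℝ => (0 - p.1, p.2), b, fun x y => ?_⟩
    rw [tl_map_reflect (K := K) 𝒰 (by rw [e]; exact hu.reg.reg.b), e, h, planar_neg]
  refine ⟨K', hu.tw.reflect 0, hr', hr'.goodWave hF hc, hu.m_pos, hu.speed, fun x y => ?_, ?_,
    hw hu.right⟩
  · obtain ⟨-, h1, h2, -⟩ := hu.tw.isC2.reflect_jet 0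
    rw [h1, h2, abs_neg]
    exact hu.cone _ _
  · have := hw hu.left
    rwa [neg_neg] at this

theorem VWave.shift (hF : UnbalancedDoubleWell F) (hf : Wells (deriv F) L ε β) (hc : 0 ≤ c)
    (hu : VWave F c c₀ g m K u) (a b : ℝ) :
    ∃ K', VWave F c c₀ g m K' (fun x y => u (x + a) (y + b)) := by
  obtain ⟨K', hr'⟩ := (hu.tw.shift a b).exists_regWave hf.nb
  have hw : ∀ {θ}, (∃ (𝒰 : Ultrafilter (ℝ × ℝ)) (b : ℝ), ∀ x y, tl 𝒰 u x y = planar g θ x (y + b)) →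
      ∃ (𝒰 : Ultrafilter (ℝ × ℝ)) (b' : ℝ),
        ∀ x y, tl 𝒰 (fun x y => u (x + a) (y + b)) x y = planar g θ x (y + b') := by
    rintro θ ⟨𝒰, b', h⟩
    refine ⟨𝒰, b + b' - θ * a, fun x y => ?_⟩
    rw [hu.reg.reg.b.tl_shift, h, planar, planar]
    congr 2
    ring
  refine ⟨K', hu.tw.shift a b, hr', hr'.goodWave hF hc, hu.m_pos, hu.speed, fun x y => ?_,
    hw hu.right, hw hu.left⟩
  obtain ⟨-, h1, h2, -⟩ := hu.tw.isC2.shift_jet a b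
  rw [h1, h2]
  exact hu.cone _ _

theorem VWave.speed_lt (hg : Profile (deriv F) c₀ g) (hu : VWave F c c₀ g m K u) : c₀ < c := by
  have h1 : 1 < √(1 + m ^ 2) := by
    rw [Real.lt_sqrt (by norm_num)]
    have := hu.m_pos
    nlinarith
  rw [hu.speed]
  nlinarith [hg.pos]

theorem VWave.le_cone (hu : VWave F c c₀ g m K u) (x y x' : ℝ) :
    u x y ≤ u x' (y + m * |x' - x|) := by
  have hm : ∀ a : ℝ, |a| = 1 → Monotone fun t => u (x + a * t) (y + m * t) := by
    intro a ha
    refine monotone_of_deriv_nonneg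
      (fun t => (hu.reg.reg.hasDerivAt_line a m x y t).differentiableAt) fun t => ?_
    rw [(hu.reg.reg.hasDerivAt_line a m x y t).deriv]
    have h1 := hu.cone (x + a * t) (y + m * t)
    have h2 := neg_abs_le (a * pdx u (x + a * t) (y + m * t))
    rw [abs_mul, ha, one_mul] at h2
    linarith
  rcases le_total x x' with h | h
  · have := hm 1 abs_one (abs_nonneg (x' - x))
    simp only [mul_zero, add_zero, one_mul] at this
    rwa [abs_of_nonneg (sub_nonneg.2 h), add_sub_cancel, ← abs_of_nonneg (sub_nonneg.2 h)] at this
  · have := hm (-1) (by simp) (abs_nonneg (x' - x))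
    simp only [mul_zero, add_zero] at this
    have e : x + -1 * |x' - x| = x' := by rw [abs_of_nonpos (sub_nonpos.2 h)]; ring
    rwa [e] at this

/-- There is no front at speed larger than `c₀` whose zero level line has a global maximum. -/
theorem GoodWave.not_level {f : ℝ → ℝ} (hf : Wells f L ε β) (hg : Profile f c₀ g)
    (hu : GoodWave f c K u) (huF : Front u) (hc : c₀ < c) (h0 : u 0 0 = 0)
    (h : ∀ x, 0 ≤ u x 0) : False := by
  have hε := hf.ε_pos
  have hεl := hf.ε_le
  obtain ⟨K', hP⟩ := hg.planar_reg hf.nb 0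
  have hPF := hg.planar_front 0
  obtain ⟨R, hR, hrise⟩ := hu.exists_rise hf.nb hε
  obtain ⟨s₁, hs₁⟩ := hPF.exists_lt 0 (show -1 < -1 + ε by linarith)
  obtain ⟨s₃, hs₃⟩ := hPF.exists_gt 0 (show 1 - ε / 2 < 1 by linarith)
  have hP0 : ∀ x y, planar g 0 x y = planar g 0 0 y := fun x y => by simp [planar]
  rcases hf.slide (hu.reg.mono (le_max_left K K')) (hP.mono (le_max_right K K')) hu.le_one
    (hg.planar_abs_le 0) (fun x y => (hu.eq x y).le) (fun x y => by
      rw [hg.planar_lop]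
      have e : c / √(1 + (0 : ℝ) ^ 2) = c := by simp
      rw [e]
      have := mul_nonneg (sub_nonneg.2 hc.le) (hg.deriv_nonneg ((y - 0 * x) / √(1 + (0 : ℝ) ^ 2)))
      linarith) (le_max_left (-1) (R - s₁)) (fun x y h1 => by
      rw [hP0] at h1
      have h2 : s₁ < y := (hPF.mono 0).lt_iff_lt.1 (hs₁.trans_le h1)
      refine (hrise x 0 (by linarith [h x])).trans (hu.mono x ?_)
      have := le_max_right (-1) (R - s₁)
      linarith) with h1 | ⟨τ, -, -, 𝒰, h2, h3⟩
  · have h2 := h1 0 0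
    have h3 : planar g 0 0 0 = 0 := by simp [planar, hg.zero]
    have h4 := huF.mono 0 (show (0 : ℝ) + -1 < 0 by norm_num)
    linarith
  · have h4 : ∀ᶠ p in (𝒰 : Filter (ℝ × ℝ)), p.2 ∈ Set.Icc s₁ s₃ := h2.mono fun p hp => by
      rw [hP0] at hp
      exact ⟨((hPF.mono 0).lt_iff_lt.1 (hs₁.trans_le hp.1)).le,
        ((hPF.mono 0).lt_iff_lt.1 (hp.2.trans_lt hs₃)).le⟩
    obtain ⟨s, -, hs⟩ := isCompact_Icc.ultrafilter_le_nhds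
      (𝒰.map fun p : ℝ × ℝ => p.2) (by
        rw [le_principal_iff, Ultrafilter.mem_coe, Ultrafilter.mem_map]; exact h4)
    have hs' : Tendsto (fun p : ℝ × ℝ => p.2) 𝒰 (nhds s) := hs
    have h5 : ∀ x y, _root_.tl 𝒰 u x y = planar g 0 0 (s + (y - τ)) := by
      intro x y
      have h6 := h3 x (y - τ)
      rw [sub_add_cancel] at h6
      rw [← h6]
      refine tl_eq_of_tendsto ?_
      have h7 : Continuous fun r => planar g 0 0 (r + (y - τ)) :=
        hP.b.continuous.comp (f := fun r : ℝ => ((0 : ℝ), r + (y - τ))) (by fun_prop)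
      exact ((h7.tendsto s).comp hs').congr fun p => by
        rw [hP0 (p.1 + x)]; rfl
    have h6 : Front (_root_.tl 𝒰 u) := by
      have e : _root_.tl 𝒰 u = fun x y => planar g 0 0 (y + (s - τ)) := by
        funext x y; rw [h5]; congr 1; ring
      rw [e]
      exact ⟨fun x y y' hy => hPF.mono 0 (by linarith),
        fun x => (hPF.top 0).comp (tendsto_atTop_add_const_right _ (s - τ) tendsto_id),
        fun x => (hPF.bot 0).comp (tendsto_atBot_add_const_right _ (s - τ) tendsto_id)⟩
    obtain ⟨h7, -⟩ := (hu.toWave.tl hf.nb.continuous 𝒰).eq_planar (θ := 0) hf hg h6 fun x y => by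
      have e : (fun t => _root_.tl 𝒰 u t y) = fun t => planar g 0 0 (s + (y - τ)) := by
        funext t; exact h5 t y
      rw [zero_mul, add_zero, pdx, e, deriv_const]
    simp at h7
    linarith

theorem VWave.exists_level (hu : VWave F c c₀ g m K u) : ∃ h : ℝ → ℝ, (∀ x, u x (h x) = 0) ∧
    ∀ x x', h x' ≤ h x + m * |x' - x| := by
  have hfr := Front.reg_wave hu.reg
  have h1 : ∀ x, ∃ y, u x y = 0 := by
    intro x
    obtain ⟨a, ha⟩ := hfr.exists_lt x (show (-1 : ℝ) < 0 by norm_num)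
    obtain ⟨b, hb⟩ := hfr.exists_gt x (show (0 : ℝ) < 1 by norm_num)
    have hc : Continuous (u x) :=
      hu.reg.reg.b.continuous.comp (f := fun y : ℝ => (x, y)) (by fun_prop)
    exact mem_range_of_exists_le_of_exists_ge hc ⟨a, ha.le⟩ ⟨b, hb.le⟩
  choose h hh using h1
  refine ⟨h, hh, fun x x' => (hfr.mono x').le_iff_le.1 ?_⟩
  rw [hh x', ← hh x]
  exact hu.le_cone x (h x) x'

theorem VWave.level_window (hg : Profile (deriv F) c₀ g) (hu : VWave F c c₀ g m K u)
    {h : ℝ → ℝ} (hh : ∀ x, u x (h x) = 0)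
    {𝒰 : Ultrafilter (ℝ × ℝ)} {θ b : ℝ} (hw : ∀ x y, tl 𝒰 u x y = planar g θ x (y + b)) (T : ℝ)
    {δ : ℝ} (hδ : 0 < δ) :
    ∀ᶠ p in (𝒰 : Filter (ℝ × ℝ)), h p.1 + θ * T - δ < h (p.1 + T) := by
  have hfr := Front.reg_wave hu.reg
  have hs := sqrt_one_add_sq_pos θ
  have h1 : 0 < tl 𝒰 u 0 (-b + δ / 2) := by
    rw [hw, planar]
    exact hg.zero.symm.trans_lt (hg.mono (div_pos (by linarith) hs))
  have h2 : tl 𝒰 u T (θ * T - b - δ / 2) < 0 := by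
    rw [hw, planar]
    exact (hg.mono (div_neg_of_neg_of_pos (by linarith) hs)).trans_eq hg.zero
  filter_upwards [(hu.reg.reg.b.tendsto_tl 0 (-b + δ / 2)).eventually (lt_mem_nhds h1),
    (hu.reg.reg.b.tendsto_tl T (θ * T - b - δ / 2)).eventually (gt_mem_nhds h2)] with p h3 h4
  rw [add_zero] at h3
  have h5 := (hfr.mono _).lt_iff_lt.1 ((hh p.1).trans_lt h3)
  have h6 := (hfr.mono _).lt_iff_lt.1 (h4.trans_eq (hh (p.1 + T)).symm)
  linarith

/-- A window of slope `-m` cannot occur arbitrarily far to the right. -/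
theorem VWave.no_window (hf : Wells (deriv F) L ε β) (hg : Profile (deriv F) c₀ g)
    (hu : VWave F c c₀ g m K u) {𝒱 : Ultrafilter (ℝ × ℝ)} {b' : ℝ}
    (hw' : ∀ x y, tl 𝒱 u x y = planar g (-m) x (y + b'))
    (hinf : ∀ X : ℝ, ∀ᶠ p in (𝒱 : Filter (ℝ × ℝ)), X ≤ p.1) : False := by
  obtain ⟨h, hh, hlip⟩ := hu.exists_level
  obtain ⟨𝒰, b, hw⟩ := hu.right
  have hm := hu.m_pos
  have hfr := Front.reg_wave hu.reg
  have hcont : Continuous h := by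
    have : LipschitzWith (Real.toNNReal m) h := LipschitzWith.of_le_add_mul _ fun x y => by
      rw [Real.coe_toNNReal _ hm.le, Real.dist_eq]
      exact hlip y x
    exact this.continuous
  obtain ⟨𝒲, h𝒲⟩ := exists_ultrafilter_of_antitone (P := fun (n : ℕ) (p : ℝ × ℝ) =>
    u p.1 p.2 = 0 ∧ ∀ x, |x| ≤ (n : ℝ) + 1 → 0 ≤ u (p.1 + x) p.2) (fun n => by
      set R : ℝ := n + 1 with hR
      have hR0 : 0 < R := by positivity
      obtain ⟨p, hp⟩ := (hu.level_window hg hh hw (2 * R) (mul_pos hm hR0)).exists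
      obtain ⟨p', hp', hp''⟩ := ((hu.level_window hg hh hw' (-(2 * R)) (mul_pos hm hR0)).and
        (hinf (p.1 + 4 * R))).exists
      obtain ⟨x, ⟨hx1, hx2⟩, hmax⟩ := (isCompact_Icc (a := p.1) (b := p'.1)).exists_isMaxOn
        ⟨p.1, le_refl _, by linarith⟩ hcont.continuousOn
      have k1 := hmax (show p.1 + 2 * R ∈ Set.Icc p.1 p'.1 from ⟨by linarith, by linarith⟩)
      have k2 := hmax (show p'.1 + -(2 * R) ∈ Set.Icc p.1 p'.1 from ⟨by linarith, by linarith⟩)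
      simp only [Set.mem_ofPred_eq] at k1 k2
      have k3 := hlip p.1 x
      have k4 := hlip p'.1 x
      rw [abs_of_nonneg (by linarith)] at k3
      rw [abs_of_nonpos (by linarith)] at k4
      have k5 : R < x - p.1 := lt_of_mul_lt_mul_left (by linarith) hm.le
      have k6 : R < p'.1 - x := lt_of_mul_lt_mul_left (by linarith) hm.le
      refine ⟨(x, h x), hh x, fun t ht => ?_⟩
      obtain ⟨ht1, ht2⟩ := abs_le.1 ht
      dsimp only
      rw [← hh (x + t)]
      exact (hfr.mono _).monotone (hmax ⟨by linarith, by linarith⟩))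
    (fun p n k hnk hp => ⟨hp.1, fun x hx => hp.2 x (hx.trans (by gcongr))⟩)
  have h0 : tl 𝒲 u 0 0 = 0 := tl_eq_of_tendsto (tendsto_const_nhds.congr' ((h𝒲 0).mono fun p hp => by
    beta_reduce; rw [add_zero, add_zero, hp.1]))
  refine (hu.good.tl hf.nb.continuous 𝒲).not_level hf hg
    (hu.good.front_tl hf.nb (δ := 1 / 2) (by norm_num) ((h𝒲 0).mono fun p hp => by
      rw [hp.1]; norm_num)) (hu.speed_lt hg) h0 fun x => ?_
  obtain ⟨n, hn⟩ := exists_nat_ge |x|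
  refine ge_of_tendsto (hu.reg.reg.b.tendsto_tl x 0) ((h𝒲 n).mono fun p hp => ?_)
  rw [add_zero]
  exact hp.2 x (by linarith)

theorem isC2_exp (a b d : ℝ) : IsC2 (fun x y => rexp (a * x + b * y + d)) ∧
    pdx (fun x y => rexp (a * x + b * y + d)) = (fun x y => rexp (a * x + b * y + d) * a) ∧
    pdy (fun x y => rexp (a * x + b * y + d)) = (fun x y => rexp (a * x + b * y + d) * b) ∧
    pdxx (fun x y => rexp (a * x + b * y + d)) = (fun x y => rexp (a * x + b * y + d) * a * a) ∧
    pdyy (fun x y => rexp (a * x + b * y + d)) = (fun x y => rexp (a * x + b * y + d) * b * b) := by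
  have hx : ∀ x y, HasDerivAt (fun t => rexp (a * t + b * y + d)) (rexp (a * x + b * y + d) * a) x :=
    fun x y => ((((hasDerivAt_id x).const_mul a).add_const (b * y)).add_const d).exp.congr_deriv
      (by simp)
  have hy : ∀ x y, HasDerivAt (fun t => rexp (a * x + b * t + d)) (rexp (a * x + b * y + d) * b) y :=
    fun x y => ((((hasDerivAt_id y).const_mul b).const_add (a * x)).add_const d).exp.congr_deriv
      (by simp)
  exact isC2_of_jet hx hy (fun x y => (hx x y).mul_const a) (fun x y => (hy x y).mul_const b)
    (by fun_prop)

/-- A solution of the linearised equation which is nonnegative between the wells on a half-plane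
is asymptotically nonnegative there. -/
theorem Wells.nonneg_of_mid_half {f : ℝ → ℝ} (hf : Wells f L ε β) (hu1 : ∀ x y, |u x y| ≤ 1)
    {w : ℝ → ℝ → ℝ} (hw : IsLinSol f c K u w) {X : ℝ}
    (h : ∀ x y, X ≤ x → -1 + ε ≤ u x y → u x y ≤ 1 - ε → 0 ≤ w x y) {e : ℝ} (he : 0 < e) :
    ∃ X', ∀ x y, X' ≤ x → -e ≤ w x y := by
  have hK := hw.b.nonneg
  have hβ := hf.β_pos
  set μ := min 1 β with hμ
  have hμ0 : 0 < μ := by positivity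
  have hμ1 : μ * μ ≤ β := by
    have h1 : μ ≤ 1 := min_le_left _ _
    have h2 : μ ≤ β := min_le_right _ _
    nlinarith
  obtain ⟨hE, -, hEy, hExx, hEyy⟩ := isC2_exp (-μ) 0 (μ * X)
  set E := fun x y : ℝ => rexp (-μ * x + 0 * y + μ * X) with hEdef
  have key : ∀ p ∈ {p : ℝ × ℝ | X ≤ p.1}, 0 ≤ 1 * w p.1 p.2 + K * E p.1 p.2 := by
    refine IsC2.nonneg_of_lop_le (isClosed_le continuous_const continuous_fst)
      (hw.c2.lin hE 1 K) (A := K) (c := c) (fun p _ => ?_) hβ (fun p hp hlt => ?_)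
    · have := (abs_le.1 (hw.b.1 p.1 p.2)).1
      have : 0 ≤ K * E p.1 p.2 := mul_nonneg hK (exp_pos _).le
      linarith
    · have hp' : X ≤ p.1 := hp
      have hwn : w p.1 p.2 < 0 := by
        have : 0 ≤ K * E p.1 p.2 := mul_nonneg hK (exp_pos _).le
        linarith
      constructor
      · rcases hp'.eq_or_lt with h1 | h1
        · exfalso
          have h2 : E p.1 p.2 = 1 := by
            simp only [hEdef, ← h1]; rw [← exp_zero]; congr 1; ring
          rw [h2] at hlt
          have := (abs_le.1 (hw.b.1 p.1 p.2)).1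
          linarith
        · exact mem_of_superset (continuous_fst.continuousAt.eventually (lt_mem_nhds h1))
            fun q (hq : X < q.1) => show X ≤ q.1 from hq.le
      · rw [hw.c2.lop_lin hE, hw.eq]
        have h1 : Lop c E p.1 p.2 = μ * μ * E p.1 p.2 := by
          simp only [Lop, hEy, hExx, hEyy]; simp only [hEdef]; ring
        rw [h1]
        have h2 := mul_le_mul_of_nonpos_right (hf.deriv_ge (hu1 _ _) fun h' =>
          absurd (h p.1 p.2 hp' h'.1 h'.2) (not_le.2 hwn)) hwn.le
        have h3 : K * (μ * μ * E p.1 p.2) ≤ β * (K * E p.1 p.2) := by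
          have := mul_le_mul_of_nonneg_right hμ1 (mul_nonneg hK (exp_pos (-μ * p.1 + 0 * p.2 + μ * X)).le)
          simp only [hEdef]
          linarith
        linarith
  have hlim : Tendsto (fun x : ℝ => K * rexp (-(μ * (x - X)))) atTop (nhds (K * 0)) :=
    ((tendsto_exp_neg_atTop_nhds_zero.comp
      ((tendsto_atTop_add_const_right _ (-X) tendsto_id).const_mul_atTop hμ0))).const_mul K
  rw [mul_zero] at hlim
  obtain ⟨X₁, hX₁⟩ := eventually_atTop.1 (hlim.eventually (gt_mem_nhds he))
  refine ⟨max X X₁, fun x y hx => ?_⟩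
  have h1 := key (x, y) ((le_max_left _ _).trans hx)
  have h2 := hX₁ x ((le_max_right _ _).trans hx)
  have h3 : E x y = rexp (-(μ * (x - X))) := by simp only [hEdef]; congr 1; ring
  simp only [h3] at h1
  linarith

/-- On the right, the level lines between the wells have asymptotic slope `m`. -/
theorem VWave.slope_limit (hf : Wells (deriv F) L ε β) (hg : Profile (deriv F) c₀ g)
    (hu : VWave F c c₀ g m K u) {e : ℝ} (he : 0 < e) :
    ∃ X, ∀ x y, X ≤ x → -1 + ε ≤ u x y → u x y ≤ 1 - ε →
      pdx u x y + m * pdy u x y ≤ e * pdy u x y := by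
  have hK : 0 < K := by linarith [hu.reg.one_le]
  set S : Set ℝ := {θ | ∃ X, ∀ x y, X ≤ x → -1 + ε ≤ u x y → u x y ≤ 1 - ε →
    pdx u x y + θ * pdy u x y ≤ 0} with hS
  suffices hmem : m - e ∈ S by
    obtain ⟨X, hX⟩ := hmem
    exact ⟨X, fun x y h1 h2 h3 => by linarith [hX x y h1 h2 h3]⟩
  by_contra hnot
  have hdown : ∀ θ ∈ S, ∀ θ' ≤ θ, θ' ∈ S := by
    rintro θ ⟨X, hX⟩ θ' hθ'
    refine ⟨X, fun x y h1 h2 h3 => ?_⟩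
    have := mul_le_mul_of_nonneg_right hθ' (hu.reg.pos x y).le
    linarith [hX x y h1 h2 h3]
  have hub : ∀ θ ∈ S, θ ≤ m - e := fun θ hθ => le_of_not_gt fun hlt => hnot (hdown θ hθ _ hlt.le)
  have hbd : BddAbove S := ⟨m - e, hub⟩
  have hneg : -m ∈ S := ⟨0, fun x y _ _ _ => by
    have := (abs_le.1 (hu.cone x y)).2
    linarith⟩
  set θ := sSup S with hθ
  have hθ1 : θ ≤ m - e := csSup_le ⟨_, hneg⟩ hub
  have hθ2 : -m ≤ θ := le_csSup hbd hneg
  have hnn : ∀ d : ℝ, 0 < d → ∃ X', ∀ x y, X' ≤ x → -d ≤ -1 * pdx u x y + -1 * θ * pdy u x y := by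
    intro d hd
    have hd' : 0 < d / (2 * K) := by positivity
    obtain ⟨θ', hθ', hlt⟩ := exists_lt_of_lt_csSup ⟨_, hneg⟩ (sub_lt_self θ hd')
    obtain ⟨X, hX⟩ := hdown θ' hθ' _ hlt.le
    obtain ⟨X', hX'⟩ := hf.nonneg_of_mid_half hu.reg.le_one
      (hu.reg.linx.lin hu.reg.liny (-1) (-(θ - d / (2 * K)))) (X := X) (fun x y h1 h2 h3 => by
        linarith [hX x y h1 h2 h3]) (half_pos hd)
    refine ⟨X', fun x y hx => ?_⟩
    have h1 := hX' x y hx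
    have h2 := (abs_le.1 (hu.reg.liny.b.1 x y)).2
    have h3 : d / (2 * K) * pdy u x y ≤ d / (2 * K) * K := by gcongr
    have h4 : d / (2 * K) * K = d / 2 := by field_simp
    linarith
  obtain ⟨𝒰, h𝒰⟩ := exists_ultrafilter_of_antitone (P := fun (n : ℕ) (p : ℝ × ℝ) =>
    (-1 + ε ≤ u p.1 p.2 ∧ u p.1 p.2 ≤ 1 - ε) ∧ (n : ℝ) ≤ p.1 ∧
      -1 * pdx u p.1 p.2 + -1 * θ * pdy u p.1 p.2 ≤ K / (n + 1)) (fun n => by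
    have hn : (0 : ℝ) < 1 / ((n : ℝ) + 1) := by positivity
    have h1 : θ + 1 / ((n : ℝ) + 1) ∉ S := fun h => by
      have := le_csSup hbd h
      linarith
    rw [hS, Set.mem_ofPred_eq] at h1
    push Not at h1
    obtain ⟨x, y, h2, h3, h4, h5⟩ := h1 n
    refine ⟨(x, y), ⟨h3, h4⟩, h2, ?_⟩
    have h6 := (abs_le.1 (hu.reg.liny.b.1 x y)).2
    have h7 : 1 / ((n : ℝ) + 1) * pdy u x y ≤ 1 / ((n : ℝ) + 1) * K := by gcongr
    rw [one_div_mul_eq_div ((n : ℝ) + 1) K] at h7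
    simp only
    linarith) (fun p n k hnk hp => ⟨hp.1, (Nat.cast_le.2 hnk).trans hp.2.1, hp.2.2.trans (by gcongr)⟩)
  have hinf : ∀ X : ℝ, ∀ᶠ p in (𝒰 : Filter (ℝ × ℝ)), X ≤ p.1 := fun X => by
    obtain ⟨n, hn⟩ := exists_nat_ge X
    exact (h𝒰 n).mono fun p hp => hn.trans hp.2.1
  obtain ⟨h1, b, h2⟩ := hu.reg.tl_eq_planar (θ := θ) (a := -1) hf hg hu.good hf.ε_pos (by norm_num)
    ((h𝒰 0).mono fun p hp => hp.1) (fun R d hd => by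
      obtain ⟨X', hX'⟩ := hnn d hd
      filter_upwards [hinf (X' + |R|)] with p hp x y hxy
      refine hX' x y ?_
      have h1 : |x - p.1| ≤ |R| := sq_le_sq.1 (by nlinarith [sq_nonneg (y - p.2)])
      linarith [(abs_le.1 h1).1]) (by
      rw [Metric.tendsto_nhds]
      intro d hd
      obtain ⟨X', hX'⟩ := hnn (d / 2) (half_pos hd)
      obtain ⟨n, hn⟩ := exists_nat_div_lt K hd
      filter_upwards [hinf X', h𝒰 n] with p hp hp'
      rw [Real.dist_eq, sub_zero, abs_lt]
      exact ⟨by linarith [hX' p.1 p.2 hp], hp'.2.2.trans_lt hn⟩)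
  have h3 : θ = -m := by
    rcases sq_eq_sq_iff_eq_or_eq_neg.1 (hg.sq_eq_of_speed h1 hu.speed) with h4 | h4
    · linarith
    · exact h4
  rw [h3] at h2
  exact hu.no_window hf hg h2 hinf

end Classification

theorem IsC2.mul_jet {w v : ℝ → ℝ → ℝ} (hw : IsC2 w) (hv : IsC2 v) (c : ℝ) :
    IsC2 (fun x y => w x y * v x y) ∧ ∀ x y, Lop c (fun x y => w x y * v x y) x y =
      w x y * Lop c v x y + v x y * Lop c w x y +
        2 * (pdx w x y * pdx v x y + pdy w x y * pdy v x y) := by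
  obtain ⟨h0, -, h2, h3, h4⟩ := isC2_of_jet
    (fun x y => (hw.dx x y).mul (hv.dx x y)) (fun x y => (hw.dy x y).mul (hv.dy x y))
    (fun x y => ((hw.dxx x y).mul (hv.dx x y)).add ((hw.dx x y).mul (hv.dxx x y)))
    (fun x y => ((hw.dyy x y).mul (hv.dy x y)).add ((hw.dy x y).mul (hv.dyy x y)))
    (hw.cont.mul hv.cont)
  refine ⟨h0, fun x y => ?_⟩

  simp only [Lop]
  erw [h2, h3, h4]
  ring

theorem IsC2.lop_nonneg_of_isLocalMin {Z : ℝ → ℝ → ℝ} (hZ : IsC2 Z) (c : ℝ) {p : ℝ × ℝ}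
    (h : ∀ᶠ q in nhds p, Z p.1 p.2 ≤ Z q.1 q.2) : 0 ≤ Lop c Z p.1 p.2 := by
  have hx : IsLocalMin (fun t => Z t p.2) p.1 := by
    have hc : Tendsto (fun t : ℝ => (t, p.2)) (nhds p.1) (nhds p) :=
      (Continuous.prodMk_left p.2).tendsto p.1
    exact hc.eventually h
  have hy : IsLocalMin (fun t => Z p.1 t) p.2 := by
    have hc : Tendsto (fun t : ℝ => (p.1, t)) (nhds p.2) (nhds p) :=
      (Continuous.prodMk_right p.1).tendsto p.2
    exact hc.eventually h
  have h1 := hx.deriv_tests (fun t => hZ.dx t p.2) (hZ.dxx p.1 p.2)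
  have h2 := hy.deriv_tests (fun t => hZ.dy p.1 t) (hZ.dyy p.1 p.2)
  rw [Lop, h2.1]
  linarith [h1.2, h2.2]

section Phase

variable {F g f : ℝ → ℝ} {c c₀ m K K' L ε β : ℝ} {u z Φ : ℝ → ℝ → ℝ}

/-- Comparison of a solution of the linearised equation with a strict supersolution, where `∂u/∂y`
controls the solution at infinity between the wells. -/
theorem RegWave.le_of_strict_super (hf : Wells f L ε β) (hu : RegWave f c K u)
    (hz : IsLinSol f c K' u z) (hΦ : IsC2 Φ) {D : Set (ℝ × ℝ)} (hD : IsClosed D)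
    (hΦ0 : ∀ p ∈ D, 0 ≤ Φ p.1 p.2)
    (hsup : ∀ p ∈ D, Lop c Φ p.1 p.2 < deriv f (u p.1 p.2) * Φ p.1 p.2)
    (hbd : ∀ p ∈ D, D ∉ nhds p → z p.1 p.2 < Φ p.1 p.2)
    (hfar : ∀ e : ℝ, 0 < e → ∃ C : Set (ℝ × ℝ), IsCompact C ∧ ∀ p ∈ D, -1 + ε ≤ u p.1 p.2 →
      u p.1 p.2 ≤ 1 - ε → p ∉ C → z p.1 p.2 ≤ e * pdy u p.1 p.2) :
    ∀ p ∈ D, z p.1 p.2 ≤ Φ p.1 p.2 := by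
  have hZ2 : ∀ l : ℝ, IsC2 fun x y => 1 * Φ x y + 1 * (l * pdy u x y + -1 * z x y) := fun l =>
    hΦ.lin (hu.liny.c2.lin hz.c2 l (-1)) 1 1
  have hLop : ∀ l x y, Lop c (fun x y => 1 * Φ x y + 1 * (l * pdy u x y + -1 * z x y)) x y =
      Lop c Φ x y + deriv f (u x y) * (l * pdy u x y - z x y) := fun l x y => by
    rw [hΦ.lop_lin (hu.liny.c2.lin hz.c2 l (-1)), hu.liny.c2.lop_lin hz.c2, hu.liny.eq, hz.eq]
    ring
  have h_int : ∀ l : ℝ, 0 ≤ l → ∀ p ∈ D, Φ p.1 p.2 + l * pdy u p.1 p.2 - z p.1 p.2 ≤ 0 →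
      D ∈ nhds p := fun l hl p hp h => by
    by_contra hn
    have := hbd p hp hn
    have := mul_nonneg hl (hu.pos p.1 p.2).le
    linarith
  have hext : ∀ l : ℝ, 0 ≤ l → (∀ p ∈ D, -1 + ε ≤ u p.1 p.2 → u p.1 p.2 ≤ 1 - ε →
      z p.1 p.2 ≤ Φ p.1 p.2 + l * pdy u p.1 p.2) →
      ∀ p ∈ D, z p.1 p.2 ≤ Φ p.1 p.2 + l * pdy u p.1 p.2 := by
    intro l hl h
    have := IsC2.nonneg_of_lop_le (c := c) (A := K') hD (hZ2 l) (fun p hp => by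
      have h1 := (abs_le.1 (hz.b.1 p.1 p.2)).2
      have h2 := hΦ0 p hp
      have h3 := mul_nonneg hl (hu.pos p.1 p.2).le
      linarith) hf.β_pos (fun p hp hlt => by
      refine ⟨h_int l hl p hp (by linarith), ?_⟩
      rw [hLop]
      have h1 := hf.deriv_ge (hu.le_one p.1 p.2) fun h' => by
        have := h p hp h'.1 h'.2
        linarith
      have h2 := mul_le_mul_of_nonpos_right h1 hlt.le
      have h3 := hsup p hp
      linarith)
    intro p hp
    linarith [this p hp]
  have hmid : ∀ e : ℝ, 0 < e → ∀ p ∈ D, -1 + ε ≤ u p.1 p.2 → u p.1 p.2 ≤ 1 - ε →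
      z p.1 p.2 ≤ Φ p.1 p.2 + e * pdy u p.1 p.2 := by
    intro e he p₀ hp₀ hp1 hp2
    by_contra hcon
    push Not at hcon
    obtain ⟨C, hC, hCe⟩ := hfar e he
    have hout : ∀ l : ℝ, e ≤ l → ∀ p ∈ D, -1 + ε ≤ u p.1 p.2 → u p.1 p.2 ≤ 1 - ε → p ∉ C →
        z p.1 p.2 ≤ Φ p.1 p.2 + l * pdy u p.1 p.2 := fun l hl p hp h1 h2 h3 => by
      have h4 := hCe p hp h1 h2 h3
      have h5 := hΦ0 p hp
      have h6 := mul_le_mul_of_nonneg_right hl (hu.pos p.1 p.2).le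
      linarith
    have hp3 : p₀ ∈ C := by
      by_contra hn
      exact absurd (hout e le_rfl p₀ hp₀ hp1 hp2 hn) (not_le.2 hcon)
    have hcu := hu.reg.c2.cont
    have hM : IsClosed {p : ℝ × ℝ | -1 + ε ≤ u p.1 p.2 ∧ u p.1 p.2 ≤ 1 - ε} :=
      (isClosed_le continuous_const hcu).inter (isClosed_le hcu continuous_const)
    have hr : Continuous fun p : ℝ × ℝ => (z p.1 p.2 - Φ p.1 p.2) / pdy u p.1 p.2 :=
      (hz.c2.cont.sub hΦ.cont).div hu.liny.c2.cont fun p => (hu.pos p.1 p.2).ne'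
    obtain ⟨q, ⟨⟨hqC, hqD⟩, hq1, hq2⟩, hq⟩ := ((hC.inter_right hD).inter_right hM).exists_isMaxOn
      ⟨p₀, ⟨hp3, hp₀⟩, hp1, hp2⟩ hr.continuousOn
    set l := (z q.1 q.2 - Φ q.1 q.2) / pdy u q.1 q.2 with hl
    have hle : e ≤ l := by
      have h1 : (z p₀.1 p₀.2 - Φ p₀.1 p₀.2) / pdy u p₀.1 p₀.2 ≤ l :=
        hq ⟨⟨hp3, hp₀⟩, hp1, hp2⟩
      refine le_trans ?_ h1
      rw [le_div_iff₀ (hu.pos _ _)]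
      linarith
    have hZ := hext l (he.le.trans hle) fun p hp h1 h2 => by
      by_cases h3 : p ∈ C
      · have h4 : (z p.1 p.2 - Φ p.1 p.2) / pdy u p.1 p.2 ≤ l := hq ⟨⟨h3, hp⟩, h1, h2⟩
        rw [div_le_iff₀ (hu.pos _ _)] at h4
        linarith
      · exact hout l hle p hp h1 h2 h3
    have hZ0 : l * pdy u q.1 q.2 = z q.1 q.2 - Φ q.1 q.2 := by
      rw [hl]; exact div_mul_cancel₀ _ (hu.pos _ _).ne'
    have hD' := h_int l (he.le.trans hle) q hqD (by linarith)
    have h1 := (hZ2 l).lop_nonneg_of_isLocalMin c (p := q) (mem_of_superset hD' fun p hp => by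
      have := hZ p hp
      rw [Set.mem_ofPred_eq]
      linarith)
    rw [hLop, hZ0] at h1
    have := hsup q hqD
    linarith
  intro p hp
  have hpos := hu.pos p.1 p.2
  refine le_of_forall_pos_le_add fun e he => ?_
  have h1 := hext (e / pdy u p.1 p.2) (by positivity) (hmid _ (by positivity)) p hp
  rwa [div_mul_cancel₀ _ hpos.ne'] at h1

theorem VWave.slope_nonneg (hu : VWave F c c₀ g m K u) (x y : ℝ) :
    0 ≤ pdx u x y + m * pdy u x y := by
  linarith [(abs_le.1 (hu.cone x y)).1]

theorem VWave.slope_small (hf : Wells (deriv F) L ε β) (hg : Profile (deriv F) c₀ g)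
    (hu : VWave F c c₀ g m K u) {e : ℝ} (he : 0 < e) :
    ∃ X, ∀ x y, X ≤ x → pdx u x y + m * pdy u x y ≤ e := by
  have hK : 0 < K := by linarith [hu.reg.one_le]
  have hd : 0 < e / (2 * K) := by positivity
  obtain ⟨X, hX⟩ := hu.slope_limit hf hg hd
  obtain ⟨X', hX'⟩ := hf.nonneg_of_mid_half hu.reg.le_one
    (hu.reg.linx.lin hu.reg.liny (-1) (e / (2 * K) - m)) (X := X) (fun x y h1 h2 h3 => by
      linarith [hX x y h1 h2 h3]) (half_pos he)
  refine ⟨X', fun x y hx => ?_⟩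
  have h1 := hX' x y hx
  have h2 := (abs_le.1 (hu.reg.liny.b.1 x y)).2
  have h3 : e / (2 * K) * pdy u x y ≤ e / (2 * K) * K := by gcongr
  have h4 : e / (2 * K) * K = e / 2 := by field_simp
  linarith

theorem VWave.slope_deriv_small (hf : Wells (deriv F) L ε β) (hg : Profile (deriv F) c₀ g)
    (hu : VWave F c c₀ g m K u) {e : ℝ} (he : 0 < e) :
    ∃ X, ∀ x y, X ≤ x → |pdx (pdy u) x y + m * pdy (pdy u) x y| ≤ e := by
  have hK : 0 < K := by linarith [hu.reg.one_le]
  have hm := hu.m_pos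
  set M := (1 + m) * K with hM
  have hM0 : 0 < M := by positivity
  obtain ⟨X, hX⟩ := hu.slope_small hf hg (e := e ^ 2 / (4 * M)) (by positivity)
  refine ⟨X, fun x y hx => ?_⟩
  rw [hu.reg.comm]
  have h1 := sq_deriv_le hM0 (φ := fun t => pdx u x t + m * pdy u x t)
    (φ' := fun t => pdy (pdx u) x t + m * pdy (pdy u) x t)
    (fun t => (hu.reg.linx.c2.dy x t).add ((hu.reg.liny.c2.dy x t).const_mul m))
    (fun s t => by
      have h2 := hu.reg.linx.by'.2 x s x t
      have h3 := hu.reg.liny.by'.2 x s x t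
      rw [sub_self, abs_zero, zero_add] at h2 h3
      have h4 : pdy (pdx u) x s + m * pdy (pdy u) x s - (pdy (pdx u) x t + m * pdy (pdy u) x t) =
        (pdy (pdx u) x s - pdy (pdx u) x t) + m * (pdy (pdy u) x s - pdy (pdy u) x t) := by ring
      rw [h4]
      refine (abs_add_le _ _).trans ?_
      rw [abs_mul, abs_of_pos hm]
      have h5 := mul_le_mul_of_nonneg_left h3 hm.le
      rw [hM]
      linarith)
    (fun t => hu.slope_nonneg x t) y
  have h2 := mul_le_mul_of_nonneg_left (hX x y hx) (by positivity : 0 ≤ 4 * M)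
  have h3 : 4 * M * (e ^ 2 / (4 * M)) = e ^ 2 := by field_simp
  exact abs_le_of_sq_le_sq (by linarith) he.le

theorem VWave.exists_decay (hf : Wells (deriv F) L ε β) (hg : Profile (deriv F) c₀ g)
    (hu : VWave F c c₀ g m K u) :
    ∃ μ > 0, ∃ T X σ : ℝ, 0 ≤ T ∧ ∀ x y, X ≤ x → σ ≤ x + m * y → pdx u x y + m * pdy u x y ≤
      T * (rexp (-(μ * (x + m * y - σ))) + rexp (-(μ * (1 + m ^ 2) * (x - X)))) := by
  have hK : 0 < K := by linarith [hu.reg.one_le]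
  have hm := hu.m_pos
  have hc : 0 < c := hg.pos.trans (hu.speed_lt hg)
  have hβ := hf.β_pos
  have hL := hf.nb.pos
  set μ' := min (min 1 β) (c * m / 2) with hμ'
  have hμ'0 : 0 < μ' := by positivity
  have hμ'1 : μ' ≤ 1 := (min_le_left _ _).trans (min_le_left _ _)
  have hμ'2 : μ' ≤ β := (min_le_left _ _).trans (min_le_right _ _)
  have hμ'3 : μ' ≤ c * m / 2 := min_le_right _ _
  have hμ'β : μ' * μ' ≤ β := by nlinarith
  set μ := μ' / (1 + m ^ 2) with hμ
  have hμ0 : 0 < μ := by positivity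
  have hμμ' : μ * (1 + m ^ 2) = μ' := div_mul_cancel₀ _ (by positivity)
  set ν := μ * (c * m - μ') with hν
  have hν0 : 0 < ν := mul_pos hμ0 (by linarith [mul_pos hc hm])
  obtain ⟨γ, hγ0, hγ⟩ := hu.reg.exists_pdy_lower hf.nb hu.good hf.ε_pos
  set κ := ν * γ / (4 * (L + β)) with hκ
  have hκ0 : 0 < κ := by positivity
  have hκ1 : 4 * (κ * (L + β)) = ν * γ := by rw [hκ]; field_simp
  set d := κ * β / (4 * μ) with hd
  have hd0 : 0 < d := by positivity
  have hd1 : 4 * (μ * d) = κ * β := by rw [hd]; field_simp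
  obtain ⟨X, hX⟩ := hu.slope_deriv_small hf hg hd0
  obtain ⟨Y, hY⟩ := ((hu.reg.top X).eventually (lt_mem_nhds (by linarith [hf.ε_pos] :
    1 - ε < 1))).exists
  set σ := X + m * Y with hσ
  have hupper : ∀ x y, X ≤ x → u x y ≤ 1 - ε → y ≤ Y + m * (x - X) := fun x y hx h => by
    by_contra hn
    push Not at hn
    have h1 := hu.le_cone X Y x
    rw [abs_of_nonneg (sub_nonneg.2 hx)] at h1
    have h2 := hu.reg.mono x hn.le
    linarith
  obtain ⟨hφ, hφx, hφy, hφxx, hφyy⟩ := isC2_exp (-μ) (-(μ * m)) (μ * σ)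
  set φ := fun x y : ℝ => rexp (-μ * x + -(μ * m) * y + μ * σ) with hφdef
  obtain ⟨hψ, -, hψy, hψxx, hψyy⟩ := isC2_exp (-μ') 0 (μ' * X)
  set ψ := fun x y : ℝ => rexp (-μ' * x + 0 * y + μ' * X) with hψdef
  have hφ0 : ∀ x y, 0 < φ x y := fun x y => exp_pos _
  have hψ0 : ∀ x y, 0 < ψ x y := fun x y => exp_pos _
  have hLφ : ∀ x y, Lop c φ x y = -ν * φ x y := fun x y => by
    have e1 : Lop c φ x y = (μ * (μ * (1 + m ^ 2)) - c * μ * m) * φ x y := by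
      simp only [Lop, hφy, hφxx, hφyy]; ring
    rw [e1, hμμ', hν]; ring
  have hLψ : ∀ x y, Lop c ψ x y = μ' * μ' * ψ x y := fun x y => by
    simp only [Lop, hψy, hψxx, hψyy]; ring
  obtain ⟨hP, hLP⟩ := hφ.mul_jet hu.reg.liny.c2 c
  set P := fun x y => φ x y * pdy u x y with hPdef
  set C := (1 + m) * K with hC
  have hC0 : 0 < C := by positivity
  have hzC : ∀ x y, pdx u x y + m * pdy u x y ≤ C := fun x y => by
    have h1 := (abs_le.1 (hu.reg.linx.b.1 x y)).2
    have h2 := mul_le_mul_of_nonneg_left (abs_le.1 (hu.reg.liny.b.1 x y)).2 hm.le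
    rw [hC]; linarith
  set T := C / κ with hT
  have hT0 : 0 < T := by positivity
  have hTκ : T * κ = C := div_mul_cancel₀ _ hκ0.ne'
  have hW : IsC2 fun x y => κ * φ x y + κ * ψ x y := hφ.lin hψ κ κ
  have hΦ : IsC2 fun x y => T * P x y + T * (κ * φ x y + κ * ψ x y) := hP.lin hW T T
  have hD : IsClosed {p : ℝ × ℝ | X ≤ p.1 ∧ σ ≤ p.1 + m * p.2} :=
    (isClosed_le continuous_const continuous_fst).inter
      (isClosed_le continuous_const (continuous_fst.add (continuous_const.mul continuous_snd)))
  have hP0 : ∀ x y, 0 < P x y := fun x y => mul_pos (hφ0 x y) (hu.reg.pos x y)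
  have hfar : ∀ e : ℝ, 0 < e → ∃ C : Set (ℝ × ℝ), IsCompact C ∧
      ∀ p ∈ {p : ℝ × ℝ | X ≤ p.1 ∧ σ ≤ p.1 + m * p.2}, -1 + ε ≤ u p.1 p.2 →
      u p.1 p.2 ≤ 1 - ε → p ∉ C → 1 * pdx u p.1 p.2 + m * pdy u p.1 p.2 ≤ e * pdy u p.1 p.2 := by
    intro e he
    obtain ⟨X', hX'⟩ := hu.slope_limit hf hg he
    refine ⟨Set.Icc X X' ×ˢ Set.Icc ((σ - X') / m) (Y + m * (X' - X)),
      isCompact_Icc.prod isCompact_Icc, ?_⟩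
    rintro ⟨x, y⟩ ⟨h1, h2⟩ h3 h4 h5
    simp only at h1 h2 h3 h4 ⊢
    rw [one_mul]
    by_contra h6
    have h7 : x ≤ X' := by
      by_contra h8
      exact h6 (hX' x y (not_le.1 h8).le h3 h4)
    refine h5 ⟨⟨h1, h7⟩, ?_, ?_⟩
    · rw [div_le_iff₀ hm]; linarith
    · have := hupper x y h1 h4
      have := mul_le_mul_of_nonneg_left h7 hm.le
      simp only
      linarith
  have key := hu.reg.le_of_strict_super hf (hu.reg.linx.lin hu.reg.liny 1 m) hΦ hD
    (fun p _ => by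
      have := hφ0 p.1 p.2; have := hψ0 p.1 p.2; have := hP0 p.1 p.2
      positivity) ?_ ?_ hfar
  · refine ⟨μ, hμ0, T * (K + κ), X, σ, by positivity, fun x y h1 h2 => ?_⟩
    have h3 := key (x, y) ⟨h1, h2⟩
    have e1 : φ x y = rexp (-(μ * (x + m * y - σ))) := by
      simp only [hφdef]; congr 1; ring
    have e2 : ψ x y = rexp (-(μ * (1 + m ^ 2) * (x - X))) := by
      simp only [hψdef, hμμ']; congr 1; ring
    rw [← e1, ← e2]
    have h4 : P x y ≤ φ x y * K :=
      mul_le_mul_of_nonneg_left (abs_le.1 (hu.reg.liny.b.1 x y)).2 (hφ0 x y).le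
    have h5 := mul_nonneg hK.le (hψ0 x y).le
    have h6 : P x y + (κ * φ x y + κ * ψ x y) ≤ (K + κ) * (φ x y + ψ x y) := by linarith
    have h7 := mul_le_mul_of_nonneg_left h6 hT0.le
    simp only at h3
    linarith
  · rintro ⟨x, y⟩ ⟨hx, hy⟩
    simp only at hx hy ⊢
    rw [hP.lop_lin hW, hφ.lop_lin hψ, hLP, hLφ, hLψ, hu.reg.liny.eq, hφx, hφy]
    have hs := abs_le.1 (hX x y hx)
    set s := pdx (pdy u) x y + m * pdy (pdy u) x y with hs'
    set D := deriv (deriv F) (u x y) with hDdef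
    have e1 : pdx (pdy u) x y = s - m * pdy (pdy u) x y := by rw [hs']; ring
    rw [e1]
    set q := pdy u x y with hq
    have hφp := hφ0 x y
    have hψp := hψ0 x y
    have hqp : 0 < q := hu.reg.pos x y
    suffices h : φ x y * (-(ν * q) - 2 * μ * s + κ * (-ν - D)) + κ * ψ x y * (μ' * μ' - D) < 0 by
      have h1 := mul_lt_mul_of_pos_left h hT0
      simp only [hPdef]
      simp only [← hq]
      linarith
    have hs2 : -(2 * μ * s) ≤ κ * β / 2 := by
      have := mul_le_mul_of_nonneg_left hs.1 hμ0.le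
      linarith
    have hκν := mul_pos hκ0 hν0
    have hκβ := mul_pos hκ0 hβ
    by_cases hmid : -1 + ε ≤ u x y ∧ u x y ≤ 1 - ε
    · have h1 := hγ x y hmid.1 hmid.2
      have h2 := (abs_le.1 (hf.nb.bd' _ (hu.reg.le_one x y))).1
      have h3 : ψ x y ≤ φ x y := by
        simp only [hφdef, hψdef]
        apply exp_le_exp.2
        have h4 := mul_le_mul_of_nonneg_left (hupper x y hx hmid.2) (mul_pos hμ0 hm).le
        have h5 : μ' * (x - X) = μ * (1 + m ^ 2) * (x - X) := by rw [hμμ']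
        rw [hσ]
        linarith
      have h4 : κ * ψ x y * (μ' * μ' - D) ≤ κ * φ x y * (β + L) := by
        have h5 : κ * ψ x y * (μ' * μ' - D) ≤ κ * ψ x y * (β + L) :=
          mul_le_mul_of_nonneg_left (by linarith) (by positivity)
        have h6 : κ * ψ x y * (β + L) ≤ κ * φ x y * (β + L) := by gcongr
        linarith
      have h5 : -(ν * q) - 2 * μ * s + κ * (-ν - D) + κ * (β + L) < 0 := by
        have h6 := mul_le_mul_of_nonneg_left h1 hν0.le
        have h7 := mul_le_mul_of_nonneg_left h2 hκ0.le
        have h8 := mul_pos hκ0 hL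
        linarith
      have h6 := mul_neg_of_pos_of_neg hφp h5
      linarith
    · have h1 := hf.deriv_ge (hu.reg.le_one x y) hmid
      have h2 : -(ν * q) - 2 * μ * s + κ * (-ν - D) < 0 := by
        have h6 := mul_pos hν0 hqp
        have h7 := mul_le_mul_of_nonneg_left h1 hκ0.le
        linarith
      have h3 := mul_neg_of_pos_of_neg hφp h2
      have h4 := mul_nonpos_of_nonneg_of_nonpos (mul_pos hκ0 hψp).le
        (by linarith : μ' * μ' - D ≤ 0)
      linarith
  · rintro ⟨x, y⟩ ⟨hx, hy⟩ hn
    simp only at hx hy ⊢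
    rw [one_mul]
    refine (hzC x y).trans_lt ?_
    have hφp := hφ0 x y
    have hψp := hψ0 x y
    suffices h : κ < P x y + (κ * φ x y + κ * ψ x y) by
      have := mul_lt_mul_of_pos_left h hT0
      linarith
    have hPp := hP0 x y
    have h1 := mul_pos hκ0 hφp
    have h2 := mul_pos hκ0 hψp
    rcases hx.eq_or_lt with h3 | h3
    · have h4 : ψ x y = 1 := by
        simp only [hψdef, ← h3]; rw [← exp_zero]; congr 1; ring
      rw [h4]; linarith
    rcases hy.eq_or_lt with h4 | h4
    · have h5 : φ x y = 1 := by
        simp only [hφdef, h4]; rw [← exp_zero]; congr 1; ring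
      rw [h5]; linarith
    exfalso
    refine hn ?_
    have h5 : ∀ᶠ p : ℝ × ℝ in nhds (x, y), X < p.1 :=
      continuous_fst.continuousAt.eventually (lt_mem_nhds h3)
    have h6 : ∀ᶠ p : ℝ × ℝ in nhds (x, y), σ < p.1 + m * p.2 :=
      (Continuous.continuousAt (f := fun p : ℝ × ℝ => p.1 + m * p.2) (by fun_prop)).eventually
        (lt_mem_nhds h4)
    exact mem_of_superset (h5.and h6) fun p hp => ⟨hp.1.le, hp.2.le⟩

end Phase

section Asymptotics

variable {F g : ℝ → ℝ} {c c₀ m K K' L ε β : ℝ} {u v : ℝ → ℝ → ℝ}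

theorem VWave.phase_bound (hf : Wells (deriv F) L ε β) (hg : Profile (deriv F) c₀ g)
    (hu : VWave F c c₀ g m K u) {e : ℝ} (he : 0 < e) :
    ∃ S : ℝ, ∀ x y t, S ≤ x → S ≤ x + m * y → 0 ≤ t → u (x + t) (y + m * t) ≤ u x y + e := by
  obtain ⟨μ, hμ, T, X, σ, hT, h⟩ := hu.exists_decay hf hg
  set μ' := μ * (1 + m ^ 2) with hμ'
  have hμ'0 : 0 < μ' := by positivity
  have hlim : Tendsto (fun S : ℝ => T * (rexp (-(μ * (S - σ))) + rexp (-(μ' * (S - X))))) atTop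
      (nhds (T * (0 + 0))) := by
    refine Tendsto.const_mul T (Tendsto.add ?_ ?_)
    · exact tendsto_exp_neg_atTop_nhds_zero.comp
        ((tendsto_atTop_add_const_right _ (-σ) tendsto_id).const_mul_atTop hμ)
    · exact tendsto_exp_neg_atTop_nhds_zero.comp
        ((tendsto_atTop_add_const_right _ (-X) tendsto_id).const_mul_atTop hμ'0)
  rw [add_zero, mul_zero] at hlim
  obtain ⟨S, hS, hSX, hSσ⟩ := ((hlim.eventually (gt_mem_nhds (mul_pos hμ'0 he))).and
    ((eventually_ge_atTop X).and (eventually_ge_atTop σ))).exists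
  set D := T * (rexp (-(μ * (S - σ))) + rexp (-(μ' * (S - X)))) with hD
  have hD0 : 0 ≤ D := by positivity
  refine ⟨S, fun x y t hx hy ht => ?_⟩
  have hder : ∀ s, HasDerivAt (fun s => u (x + 1 * s) (y + m * s) + D / μ' * rexp (-(μ' * s)))
      (1 * pdx u (x + 1 * s) (y + m * s) + m * pdy u (x + 1 * s) (y + m * s) -
        D * rexp (-(μ' * s))) s := fun s => by
    refine ((hu.reg.reg.hasDerivAt_line 1 m x y s).add
      ((((hasDerivAt_id s).const_mul μ').neg.exp).const_mul (D / μ'))).congr_deriv ?_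
    simp only [id, mul_one, Pi.neg_apply]
    field_simp
    ring
  have hanti : AntitoneOn (fun s => u (x + 1 * s) (y + m * s) + D / μ' * rexp (-(μ' * s)))
      (Set.Ici 0) := by
    refine antitoneOn_of_deriv_nonpos (convex_Ici 0)
      (fun s _ => (hder s).continuousAt.continuousWithinAt)
      (fun s _ => (hder s).differentiableAt.differentiableWithinAt) fun s hs => ?_
    rw [interior_Ici, Set.mem_Ioi] at hs
    rw [(hder s).deriv, one_mul, one_mul]
    have hm2 := mul_nonneg (sq_nonneg m) hs.le
    have h1 := h (x + s) (y + m * s) (by linarith) (by linarith)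
    refine sub_nonpos.2 (h1.trans ?_)
    have e1 : rexp (-(μ * (x + s + m * (y + m * s) - σ))) ≤
        rexp (-(μ * (S - σ))) * rexp (-(μ' * s)) := by
      rw [← exp_add, exp_le_exp, hμ']
      have := mul_le_mul_of_nonneg_left hy hμ.le
      linarith
    have e2 : rexp (-(μ' * (x + s - X))) ≤ rexp (-(μ' * (S - X))) * rexp (-(μ' * s)) := by
      rw [← exp_add, exp_le_exp]
      have := mul_le_mul_of_nonneg_left hx hμ'0.le
      linarith
    calc _ ≤ T * (rexp (-(μ * (S - σ))) * rexp (-(μ' * s)) +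
          rexp (-(μ' * (S - X))) * rexp (-(μ' * s))) :=
          mul_le_mul_of_nonneg_left (add_le_add e1 e2) hT
      _ = D * rexp (-(μ' * s)) := by rw [hD]; ring
  have h1 := hanti Set.self_mem_Ici (Set.mem_Ici.2 ht) ht
  simp only [mul_zero, add_zero, neg_zero, exp_zero, mul_one, one_mul] at h1
  have h2 : 0 ≤ D / μ' * rexp (-(μ' * t)) := by positivity
  have h3 : D / μ' ≤ e := by rw [div_le_iff₀ hμ'0]; linarith
  linarith

theorem VWave.monotone_line (hu : VWave F c c₀ g m K u) (x y : ℝ) :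
    Monotone fun t => u (x + t) (y + m * t) := by
  have h := hu.reg.reg.hasDerivAt_line 1 m x y
  simp only [one_mul] at h
  refine monotone_of_deriv_nonneg (fun t => (h t).differentiableAt) fun t => ?_
  rw [(h t).deriv]
  exact hu.slope_nonneg _ _

theorem VWave.exists_low_line (hf : Wells (deriv F) L ε β) (hg : Profile (deriv F) c₀ g)
    (hu : VWave F c c₀ g m K u) : ∃ x y, ∀ t, 0 ≤ t → u (x + t) (y + m * t) ≤ 1 / 2 := by
  have hm := hu.m_pos
  obtain ⟨S, hS⟩ := hu.phase_bound hf hg (e := 1 / 2) (by norm_num)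
  obtain ⟨X, hX⟩ := hu.slope_limit hf hg (e := m / 4) (by positivity)
  obtain ⟨h, hh, -⟩ := hu.exists_level
  have hline := hu.reg.reg.hasDerivAt_line 1 (m / 2) X (h X)
  have hle : ∀ t : ℝ, 0 ≤ t → u (X + 1 * t) (h X + m / 2 * t) ≤ 0 := fun t ht => by
    refine image_le_of_deriv_right_lt_deriv_boundary (a := 0) (b := t)
      (fun s _ => (hline s).continuousAt.continuousWithinAt)
      (fun s _ => (hline s).hasDerivWithinAt) (B := fun _ => 0) (B' := fun _ => 0) ?_
      (fun s => hasDerivAt_const _ _) (fun s hs h0 => ?_) ⟨ht, le_rfl⟩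
    · simp [hh]
    · have h1 := hX (X + 1 * s) (h X + m / 2 * s) (by linarith [hs.1])
        (by linarith [hf.ε_le]) (by linarith [hf.ε_le])
      have h2 := mul_pos hm (hu.reg.pos (X + 1 * s) (h X + m / 2 * s))
      linarith
  set t := max 0 (max (S - X) (S - X - m * h X)) with ht
  have ht0 : 0 ≤ t := le_max_left _ _
  have ht1 : S - X ≤ t := (le_max_left _ _).trans (le_max_right _ _)
  have ht2 : S - X - m * h X ≤ t := (le_max_right _ _).trans (le_max_right _ _)
  refine ⟨X + t, h X + m / 2 * t, fun s hs => ?_⟩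
  have h1 := hle t ht0
  rw [one_mul] at h1
  have h2 := hS (X + t) (h X + m / 2 * t) s (by linarith)
    (by have := mul_nonneg (mul_pos hm hm).le ht0; linarith) hs
  linarith

/-- The level lines of `u` on the right are asymptotic to a line of slope `m` with phase `b`. -/
def HasPhase (g : ℝ → ℝ) (m : ℝ) (u : ℝ → ℝ → ℝ) (b : ℝ) : Prop :=
  ∀ y, Tendsto (fun x => u x (y + m * x)) atTop (nhds (planar g m 0 (y + b)))

theorem VWave.exists_hasPhase (hf : Wells (deriv F) L ε β) (hg : Profile (deriv F) c₀ g)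
    (hu : VWave F c c₀ g m K u) : ∃ b, HasPhase g m u b := by
  have hmono : ∀ y, Monotone fun x => u x (y + m * x) := fun y => by
    simpa using hu.monotone_line 0 y
  have hle : ∀ x y, u x y ≤ 1 := fun x y => (abs_le.1 (hu.reg.le_one x y)).2
  set ℓ : ℝ → ℝ := fun y => ⨆ x, u x (y + m * x) with hℓ
  have hlim : ∀ y, Tendsto (fun x => u x (y + m * x)) atTop (nhds (ℓ y)) := fun y =>
    tendsto_atTop_ciSup (hmono y) ⟨1, by rintro _ ⟨x, rfl⟩; exact hle _ _⟩
  set 𝒰 : Ultrafilter (ℝ × ℝ) := (hyperfilter ℕ).map fun n : ℕ => ((n : ℝ), m * (n : ℝ)) with h𝒰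
  have htl : ∀ x y, tl 𝒰 u x y = ℓ (y - m * x) := fun x y => by
    apply tl_eq_of_tendsto
    rw [h𝒰, Ultrafilter.coe_map, tendsto_map'_iff]
    have h1 : Tendsto (fun n : ℕ => (n : ℝ) + x) atTop atTop :=
      tendsto_atTop_add_const_right _ x tendsto_natCast_atTop_atTop
    refine (((hlim (y - m * x)).comp h1).mono_left Nat.hyperfilter_le_atTop).congr fun n => ?_
    simp only [Function.comp]
    congr 1
    ring
  have hw := hu.good.tl hf.nb.continuous 𝒰
  have hslope : ∀ x y, pdx (tl 𝒰 u) x y + m * pdy (tl 𝒰 u) x y = 0 := fun x y => by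
    have h1 := hw.reg.hasDerivAt_line 1 m x y 0
    have h2 : (fun t => tl 𝒰 u (x + 1 * t) (y + m * t)) = fun _ => ℓ (y - m * x) := by
      funext t
      rw [htl]
      congr 1
      ring
    rw [h2] at h1
    have h3 := h1.unique (hasDerivAt_const _ _)
    simpa using h3
  have hfront : Front (tl 𝒰 u) := by
    rcases hw.trichotomy hf.nb with h | h | h
    · exfalso
      obtain ⟨x, y, hxy⟩ := hu.exists_low_line hf hg
      have h1 := h x y
      rw [htl] at h1
      have h2 : ℓ (y - m * x) ≤ 1 / 2 := by
        refine le_of_tendsto (hlim _) ((eventually_ge_atTop x).mono fun t ht => ?_)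
        have h3 := hxy (t - x) (by linarith)
        have e1 : x + (t - x) = t := by ring
        have e2 : y + m * (t - x) = y - m * x + m * t := by ring
        rwa [e1, e2] at h3
      linarith
    · exfalso
      have h1 := h 0 0
      rw [htl] at h1
      have h2 : u 0 (0 - m * 0 + m * 0) ≤ ℓ (0 - m * 0) := (hmono _).ge_of_tendsto (hlim _) 0
      have h3 := (Front.reg_wave hu.reg).gt_neg_one 0 (0 - m * 0 + m * 0)
      linarith
    · exact h
  obtain ⟨-, b, hb⟩ := hw.toWave.eq_planar hf hg hfront hslope
  refine ⟨b, fun y => ?_⟩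
  rw [← hb 0 y, htl]
  simpa using hlim y

theorem HasPhase.shift {b : ℝ} (h : HasPhase g m u b) (a d : ℝ) :
    HasPhase g m (fun x y => u (x + a) (y + d)) (b + d - m * a) := fun y => by
  have h1 := (h (y + d - m * a)).comp (tendsto_atTop_add_const_right atTop a tendsto_id)
  have e : y + d - m * a + b = y + (b + d - m * a) := by ring
  rw [e] at h1
  refine h1.congr fun x => ?_
  simp only [Function.comp, id]
  congr 1
  ring

theorem HasPhase.unique (hg : Profile (deriv F) c₀ g) {b b' : ℝ} (h : HasPhase g m u b)
    (h' : HasPhase g m u b') : b = b' := by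
  have h1 := tendsto_nhds_unique (h 0) (h' 0)
  have h2 := ((hg.planar_front m).mono 0).injective h1
  linarith

theorem HasPhase.tendsto {b s τ : ℝ} (h : HasPhase g m u b) (hu : BddLip K u)
    {l : Filter (ℝ × ℝ)} (h1 : Tendsto Prod.fst l atTop)
    (h2 : Tendsto (fun p : ℝ × ℝ => p.2 - m * p.1) l (nhds s)) :
    Tendsto (fun p : ℝ × ℝ => u p.1 (p.2 + τ)) l (nhds (planar g m 0 (s + τ + b))) := by
  have h3 := (h (s + τ)).comp h1
  have h4 : Tendsto (fun p : ℝ × ℝ => K * |p.2 - m * p.1 - s|) l (nhds 0) := by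
    have := ((h2.sub_const s).abs).const_mul K
    simpa using this
  have h5 : Tendsto (fun p : ℝ × ℝ => u p.1 (p.2 + τ) - u p.1 (s + τ + m * p.1)) l (nhds 0) := by
    refine squeeze_zero_norm (fun p => ?_) h4
    rw [Real.norm_eq_abs]
    have h6 := hu.2 p.1 (p.2 + τ) p.1 (s + τ + m * p.1)
    rw [sub_self, abs_zero, zero_add] at h6
    have e : p.2 + τ - (s + τ + m * p.1) = p.2 - m * p.1 - s := by ring
    rwa [e] at h6
  have h7 := h5.add h3
  rw [zero_add] at h7
  refine h7.congr fun p => ?_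
  simp only [Function.comp]
  ring

end Asymptotics

section Sliding

variable {F g : ℝ → ℝ} {c c₀ m K K' L ε β : ℝ} {u v : ℝ → ℝ → ℝ}

theorem VWave.exists_upper (hu : VWave F c c₀ g m K u) {a : ℝ} (ha : a < 1) :
    ∃ A, ∀ x y, A + m * |x| ≤ y → a ≤ u x y := by
  obtain ⟨Y, hY⟩ := (Front.reg_wave hu.reg).exists_gt 0 ha
  refine ⟨Y, fun x y h => ?_⟩
  have h1 := hu.le_cone 0 Y x
  rw [sub_zero] at h1
  exact (hY.le.trans h1).trans (hu.reg.mono x h)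

theorem VWave.exists_lower_right (hg : Profile (deriv F) c₀ g) (hu : VWave F c c₀ g m K u) {b : ℝ}
    (hb : HasPhase g m u b) {a : ℝ} (ha : -1 < a) : ∃ A, ∀ x y, a ≤ u x y → m * x - A ≤ y := by
  obtain ⟨Y, hY⟩ := (hg.planar_front m).exists_lt 0 ha
  refine ⟨b - Y, fun x y h => ?_⟩
  by_contra hn
  push Not at hn
  have hmono : Monotone fun x => u x (Y - b + m * x) := by simpa using hu.monotone_line 0 (Y - b)
  have h1 := hmono.ge_of_tendsto (hb (Y - b)) x
  rw [sub_add_cancel] at h1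
  have h2 := hu.reg.mono x (show y ≤ Y - b + m * x by linarith)
  linarith

theorem VWave.exists_lower (hF : UnbalancedDoubleWell F) (hf : Wells (deriv F) L ε β)
    (hg : Profile (deriv F) c₀ g) (hc : 0 ≤ c) (hu : VWave F c c₀ g m K u) {a : ℝ} (ha : -1 < a) :
    ∃ A, ∀ x y, a ≤ u x y → m * |x| - A ≤ y := by
  obtain ⟨b, hb⟩ := hu.exists_hasPhase hf hg
  obtain ⟨K', hu'⟩ := hu.reflect hF hf hc
  obtain ⟨b', hb'⟩ := hu'.exists_hasPhase hf hg
  obtain ⟨A, hA⟩ := hu.exists_lower_right hg hb ha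
  obtain ⟨A', hA'⟩ := hu'.exists_lower_right hg hb' ha
  refine ⟨max A A', fun x y h => ?_⟩
  rcases abs_cases x with ⟨h1, -⟩ | ⟨h1, -⟩
  · rw [h1]
    linarith [hA x y h, le_max_left A A']
  · rw [h1]
    have := hA' (-x) y (by simpa using h)
    linarith [le_max_right A A']

theorem VWave.no_contact_right (hF : UnbalancedDoubleWell F) (hf : Wells (deriv F) L ε β)
    (hg : Profile (deriv F) c₀ g) (hc : 0 ≤ c) (hu : VWave F c c₀ g m K u) (hvb : BddLip K' v)
    {b b' τ : ℝ} (hb : HasPhase g m u b) (hb' : HasPhase g m v b') (hτ : b < τ + b')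
    {𝒰 : Ultrafilter (ℝ × ℝ)}
    (hmid : ∀ᶠ p in (𝒰 : Filter (ℝ × ℝ)), -1 + ε ≤ u p.1 p.2 ∧ u p.1 p.2 ≤ 1 - ε / 2)
    (h1 : Tendsto Prod.fst (𝒰 : Filter (ℝ × ℝ)) atTop)
    (h2 : Tendsto (fun p : ℝ × ℝ => v p.1 (p.2 + τ) - u p.1 p.2) 𝒰 (nhds 0)) : False := by
  have hε := hf.ε_pos
  obtain ⟨A, hA⟩ := hu.exists_lower hF hf hg hc (a := -1 + ε) (by linarith)
  obtain ⟨A', hA'⟩ := hu.exists_upper (a := 1 - ε / 4) (by linarith)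
  have hbox : ∀ᶠ p in (𝒰 : Filter (ℝ × ℝ)), p.2 - m * p.1 ∈ Set.Icc (-A) A' := by
    filter_upwards [hmid, h1.eventually_ge_atTop 0] with p hp hp0
    have h3 := hA p.1 p.2 hp.1
    have h4 : ¬ A' + m * |p.1| ≤ p.2 := fun h => by linarith [hA' p.1 p.2 h, hp.2]
    rw [abs_of_nonneg hp0] at h3 h4
    exact ⟨by linarith, by linarith⟩
  obtain ⟨s, -, hs⟩ := isCompact_Icc.ultrafilter_le_nhds
    (𝒰.map fun p : ℝ × ℝ => p.2 - m * p.1) (by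
      rw [le_principal_iff, Ultrafilter.mem_coe, Ultrafilter.mem_map]; exact hbox)
  have hs' : Tendsto (fun p : ℝ × ℝ => p.2 - m * p.1) 𝒰 (nhds s) := hs
  have h3 := hb.tendsto (τ := 0) hu.reg.reg.b h1 hs'
  have h4 := hb'.tendsto (τ := τ) hvb h1 hs'
  simp only [add_zero] at h3
  have h5 := tendsto_nhds_unique (h4.sub h3) h2
  have h6 := (hg.planar_front m).mono 0 (show s + b < s + τ + b' by linarith)
  linarith

/-- The sliding method on a closed set `D`. -/
theorem VWave.le_on (hF : UnbalancedDoubleWell F) (hf : Wells (deriv F) L ε β)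
    (hg : Profile (deriv F) c₀ g) (hc : 0 ≤ c) (hu : VWave F c c₀ g m K u)
    (hv : VWave F c c₀ g m K' v) {b b' : ℝ} (hb : HasPhase g m u b) (hb' : HasPhase g m v b')
    (hbb : b ≤ b') {D : Set (ℝ × ℝ)} (hD : IsClosed D)
    (hbd : ∀ τ : ℝ, 0 ≤ τ → ∀ p ∈ D, v p.1 (p.2 + τ) < u p.1 p.2 → D ∈ nhds p)
    (hleft : ∀ τ : ℝ, 0 < τ → ∀ 𝒰 : Ultrafilter (ℝ × ℝ), (∀ᶠ p in (𝒰 : Filter (ℝ × ℝ)), p ∈ D) →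
      (∀ᶠ p in (𝒰 : Filter (ℝ × ℝ)), -1 + ε ≤ u p.1 p.2 ∧ u p.1 p.2 ≤ 1 - ε / 2) →
      Tendsto Prod.fst (𝒰 : Filter (ℝ × ℝ)) atBot →
      Tendsto (fun p : ℝ × ℝ => v p.1 (p.2 + τ) - u p.1 p.2) 𝒰 (nhds 0) → False)
    (htouch : ∀ τ : ℝ, 0 < τ → (∀ p ∈ D, u p.1 p.2 ≤ v p.1 (p.2 + τ)) →
      ∀ p ∈ D, v p.1 (p.2 + τ) ≠ u p.1 p.2) : ∀ p ∈ D, u p.1 p.2 ≤ v p.1 p.2 := by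
  have hε := hf.ε_pos
  obtain ⟨A, hA⟩ := hu.exists_lower hF hf hg hc (a := -1 + ε) (by linarith)
  obtain ⟨A', hA'⟩ := hu.exists_upper (a := 1 - ε / 4) (by linarith)
  obtain ⟨B, hB⟩ := hv.exists_upper (a := 1 - ε) (by linarith)
  rcases hf.slide_or_contact hD hv.reg.reg.c2 hv.reg.reg.b hu.reg.reg.c2 hv.reg.le_one
    hu.reg.le_one (fun x y => (hv.reg.eq x y).le) (fun x y => (hu.reg.eq x y).ge)
    (le_max_left 0 (A + B)) hbd (fun p _ h => by
      refine hB _ _ ?_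
      linarith [hA _ _ h, le_max_right 0 (A + B)]) with h | ⟨τ, hτ, hle, 𝒰, h1, h2, h3⟩
  · simpa using h
  exfalso
  by_cases htop : Tendsto Prod.fst (𝒰 : Filter (ℝ × ℝ)) atTop
  · exact hu.no_contact_right hF hf hg hc hv.reg.reg.b hb hb' (by linarith) h2 htop h3
  by_cases hbot : Tendsto Prod.fst (𝒰 : Filter (ℝ × ℝ)) atBot
  · exact hleft τ hτ 𝒰 h1 h2 hbot h3
  rw [Filter.tendsto_atTop] at htop
  rw [Filter.tendsto_atBot] at hbot
  push Not at htop hbot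
  obtain ⟨X, hX⟩ := htop
  obtain ⟨X', hX'⟩ := hbot
  have hbox : ∀ᶠ p in (𝒰 : Filter (ℝ × ℝ)),
      p ∈ Set.Icc X' X ×ˢ Set.Icc (-A) (A' + m * (|X| + |X'|)) := by
    filter_upwards [h2, hX, hX'] with p hp hp1 hp2
    have hm := hu.m_pos
    have h4 := hA p.1 p.2 hp.1
    have h5 : ¬ A' + m * |p.1| ≤ p.2 := fun h => by linarith [hA' p.1 p.2 h, hp.2]
    have h6 : |p.1| ≤ |X| + |X'| := by
      rw [abs_le]
      exact ⟨by linarith [neg_abs_le X', abs_nonneg X], by linarith [le_abs_self X, abs_nonneg X']⟩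
    have h7 := mul_le_mul_of_nonneg_left h6 hm.le
    have h8 := mul_nonneg hm.le (abs_nonneg p.1)
    exact ⟨⟨hp2.le, hp1.le⟩, by linarith, by linarith⟩
  obtain ⟨q, -, hq⟩ := (isCompact_Icc.prod isCompact_Icc).ultrafilter_le_nhds 𝒰
    (le_principal_iff.2 hbox)
  have hqD : q ∈ D := hD.mem_of_tendsto (f := id) hq h1
  have hcont : Continuous fun p : ℝ × ℝ => v p.1 (p.2 + τ) - u p.1 p.2 :=
    (hv.reg.reg.c2.cont.comp (f := fun p : ℝ × ℝ => (p.1, p.2 + τ)) (by fun_prop)).sub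
      hu.reg.reg.c2.cont
  have h4 := tendsto_nhds_unique ((hcont.tendsto q).mono_left hq) h3
  exact htouch τ hτ hle q hqD (sub_eq_zero.1 h4)

theorem VWave.le_of_hasPhase (hF : UnbalancedDoubleWell F) (hf : Wells (deriv F) L ε β)
    (hg : Profile (deriv F) c₀ g) (hc : 0 ≤ c) (hu : VWave F c c₀ g m K u)
    (hv : VWave F c c₀ g m K' v) {b d : ℝ} (hb : HasPhase g m u b) (hb' : HasPhase g m v b)
    (hd : HasPhase g m (fun x y => u (0 - x) y) d) (hd' : HasPhase g m (fun x y => v (0 - x) y) d)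
    (x y : ℝ) : u x y ≤ v x y := by
  refine hu.le_on hF hf hg hc hv hb hb' le_rfl isClosed_univ (fun _ _ _ _ _ => univ_mem)
    (fun τ hτ 𝒰 _ hmid hbot h => ?_) (fun τ hτ hle q _ hq => ?_) (x, y) trivial
  · obtain ⟨K₁, hu'⟩ := hu.reflect hF hf hc
    obtain ⟨K₂, hv'⟩ := hv.reflect hF hf hc
    refine hu'.no_contact_right hF hf hg hc hv'.reg.reg.b hd hd' (τ := τ) (by linarith)
      (𝒰 := 𝒰.map fun p : ℝ × ℝ => (0 - p.1, p.2)) ?_ ?_ ?_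
    · rw [Ultrafilter.coe_map, eventually_map]
      simpa using hmid
    · rw [Ultrafilter.coe_map, tendsto_map'_iff]
      simpa [Function.comp_def] using tendsto_neg_atBot_atTop.comp hbot
    · rw [Ultrafilter.coe_map, tendsto_map'_iff]
      simpa [Function.comp_def] using h
  · have hvs := hv.reg.reg.c2.shift 0 τ
    have h1 := eq_of_touch (c := c) hf.nb hvs hu.reg.reg.c2 (fun x y => hv.reg.le_one _ _)
      hu.reg.le_one (fun x y => by rw [hv.reg.reg.c2.lop_shift]; exact (hv.reg.eq _ _).le)
      (fun x y => (hu.reg.eq x y).ge) (fun x y => by simpa using hle (x, y) trivial)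
      (x₀ := q.1) (y₀ := q.2) (by simpa using hq.symm)
    have h2 : u = fun x y => v (x + 0) (y + τ) := by funext x y; exact h1 x y
    have h3 := hb'.shift 0 τ
    rw [← h2] at h3
    have := hb.unique hg h3
    linarith

theorem VWave.eq_shift (hF : UnbalancedDoubleWell F) (hf : Wells (deriv F) L ε β)
    (hg : Profile (deriv F) c₀ g) (hc : 0 ≤ c) (hu : VWave F c c₀ g m K u)
    (hv : VWave F c c₀ g m K' v) : ∃ a d, ∀ x y, v x y = u (x + a) (y + d) := by
  have hm := hu.m_pos
  obtain ⟨Ku, hur⟩ := hu.reflect hF hf hc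
  obtain ⟨Kv, hvr⟩ := hv.reflect hF hf hc
  obtain ⟨b, hb⟩ := hu.exists_hasPhase hf hg
  obtain ⟨b', hb'⟩ := hv.exists_hasPhase hf hg
  obtain ⟨d, hd⟩ := hur.exists_hasPhase hf hg
  obtain ⟨d', hd'⟩ := hvr.exists_hasPhase hf hg
  set a := ((d' - d) - (b' - b)) / (2 * m) with ha
  set s := ((d' - d) + (b' - b)) / 2 with hs
  have hma : m * a = ((d' - d) - (b' - b)) / 2 := by rw [ha]; field_simp
  obtain ⟨K₁, hw⟩ := hu.shift hF hf hc a s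
  have hwb : HasPhase g m (fun x y => u (x + a) (y + s)) b' := by
    have := hb.shift a s
    have e : b + s - m * a = b' := by rw [hma, hs]; ring
    rwa [e] at this
  have hwd : HasPhase g m (fun x y => (fun x y => u (x + a) (y + s)) (0 - x) y) d' := by
    have := hd.shift (-a) s
    have e : d + s - m * -a = d' := by rw [mul_neg, hma, hs]; ring
    rw [e] at this
    have e2 : (fun x y => u (0 - (x + -a)) (y + s)) = fun x y => u (0 - x + a) (y + s) := by
      funext x y; congr 1; ring
    rw [e2] at this
    exact this
  exact ⟨a, s, fun x y => le_antisymm (hv.le_of_hasPhase hF hf hg hc hw hb' hwb hd' hwd x y)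
    (hw.le_of_hasPhase hF hf hg hc hv hwb hb' hwd hd' x y)⟩

theorem VWave.exists_even (hF : UnbalancedDoubleWell F) (hf : Wells (deriv F) L ε β)
    (hg : Profile (deriv F) c₀ g) (hc : 0 ≤ c) (hu : VWave F c c₀ g m K u) :
    ∃ x₀, ∀ x y, u (x₀ + x) y = u (x₀ - x) y := by
  obtain ⟨K', hur⟩ := hu.reflect hF hf hc
  obtain ⟨a, d, h⟩ := hu.eq_shift hF hf hg hc hur
  have hd : d = 0 := by
    have h1 := h 0 0
    have h2 := h (-a) d
    have e1 : (0 : ℝ) - -a = 0 + a := by ring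
    have e2 : -a + a = (0 : ℝ) - 0 := by ring
    have e3 : d = 0 + d := (zero_add d).symm
    rw [e1, e2] at h2
    have h3 : u (0 - 0) 0 = u (0 - 0) (d + d) := by rw [← h2, h1]; congr 1; ring
    have := ((Front.reg_wave hu.reg).mono (0 - 0)).injective h3
    linarith
  subst hd
  refine ⟨a / 2, fun x y => ?_⟩
  have h1 := h (x - a / 2) y
  have e1 : 0 - (x - a / 2) = a / 2 - x := by ring
  have e2 : x - a / 2 + a = a / 2 + x := by ring
  rw [e1, e2, add_zero] at h1
  exact h1.symm

theorem isPreconnected_fst_gt (a : ℝ) : IsPreconnected {p : ℝ × ℝ | a < p.1} := by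
  have h : {p : ℝ × ℝ | a < p.1} = Set.Ioi a ×ˢ Set.univ := by ext p; simp
  rw [h]
  exact isPreconnected_Ioi.prod isPreconnected_univ

theorem isOpen_fst_gt (a : ℝ) : IsOpen {p : ℝ × ℝ | a < p.1} :=
  isOpen_lt continuous_const continuous_fst

theorem VWave.le_reflect (hF : UnbalancedDoubleWell F) (hf : Wells (deriv F) L ε β)
    (hg : Profile (deriv F) c₀ g) (hc : 0 ≤ c) (hu : VWave F c c₀ g m K u) {x₀ : ℝ}
    (he : ∀ x y, u (x₀ + x) y = u (x₀ - x) y) {a : ℝ} (ha : x₀ < a) {x : ℝ} (hx : a ≤ x) (y : ℝ) :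
    u x y ≤ u (x + 2 * (x₀ - a)) y := by
  obtain ⟨b, hb⟩ := hu.exists_hasPhase hf hg
  obtain ⟨K', hv⟩ := hu.shift hF hf hc (2 * (x₀ - a)) 0
  have hb' := hb.shift (2 * (x₀ - a)) 0
  have hmp := mul_pos hu.m_pos (sub_pos.2 ha)
  have hedge : ∀ y, u (a + 2 * (x₀ - a)) y = u a y := fun y => by
    have := he (a - x₀) y
    have e1 : x₀ + (a - x₀) = a := by ring
    have e2 : x₀ - (a - x₀) = a + 2 * (x₀ - a) := by ring
    rw [e1, e2] at this
    exact this.symm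
  have hstrict := (Front.reg_wave hu.reg).mono
  have := hu.le_on hF hf hg hc hv hb hb' (by linarith) (D := {p : ℝ × ℝ | a ≤ p.1})
    (isClosed_le continuous_const continuous_fst) ?_ ?_ ?_ (x, y) hx
  · simpa using this
  · rintro τ hτ p hp hlt
    rcases (show a ≤ p.1 from hp).eq_or_lt with h | h
    · exfalso
      rw [← h, hedge] at hlt
      have := (hstrict a).monotone (show p.2 ≤ p.2 + τ + 0 by linarith)
      linarith
    · exact mem_of_superset ((isOpen_fst_gt a).mem_nhds h) fun q (hq : a < q.1) => show a ≤ q.1 from hq.le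
  · intro τ _ 𝒰 hD _ hbot _
    obtain ⟨p, hp, hp'⟩ := (hD.and (hbot.eventually (eventually_lt_atBot a))).exists
    exact absurd (show a ≤ p.1 from hp) (not_le.2 hp')
  · intro τ hτ hle p hp hcon
    rcases (show a ≤ p.1 from hp).eq_or_lt with h | h
    · rw [← h, hedge] at hcon
      have := hstrict a (show p.2 < p.2 + τ + 0 by linarith)
      linarith
    · have hvs := hu.reg.reg.c2.shift (2 * (x₀ - a)) (τ + 0)
      have h1 := (hvs.sub hu.reg.reg.c2).eq_zero_of_preconnected (c := c) (L := L)
        (isOpen_fst_gt a) (isPreconnected_fst_gt a) hf.nb.pos.le (fun q hq => by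
          have h2 := hle q (show a ≤ q.1 from le_of_lt (show a < q.1 from hq))
          beta_reduce at h2
          rw [add_assoc] at h2
          refine ⟨sub_nonneg.2 h2, ?_⟩
          rw [hvs.lop_sub hu.reg.reg.c2, hu.reg.reg.c2.lop_shift, hu.reg.eq, hu.reg.eq]
          have h3 := hf.nb.lip _ _ (hu.reg.le_one (q.1 + 2 * (x₀ - a)) (q.2 + (τ + 0)))
            (hu.reg.le_one q.1 q.2)
          rw [abs_of_nonneg (sub_nonneg.2 h2)] at h3
          exact (abs_le.1 h3).2) (p₀ := p) h (by
          rw [← add_assoc]; exact sub_eq_zero.2 hcon)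
      have h2 := hb.shift (2 * (x₀ - a)) (τ + 0)
      have h3 : HasPhase g m u (b + (τ + 0) - m * (2 * (x₀ - a))) := fun y => by
        refine (h2 y).congr' ((eventually_gt_atTop a).mono fun x hx => ?_)
        exact sub_eq_zero.1 (h1 (x, y + m * x) hx)
      have := hb.unique hg h3
      linarith

theorem VWave.pdx_neg (hF : UnbalancedDoubleWell F) (hf : Wells (deriv F) L ε β)
    (hg : Profile (deriv F) c₀ g) (hc : 0 ≤ c) (hu : VWave F c c₀ g m K u) {x₀ : ℝ}
    (he : ∀ x y, u (x₀ + x) y = u (x₀ - x) y) {x : ℝ} (hx : x₀ < x) (y : ℝ) : pdx u x y < 0 := by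
  have hanti : ∀ y, AntitoneOn (fun t => u t y) (Set.Ioi x₀) := fun y s hs t ht hst => by
    rw [Set.mem_Ioi] at hs ht
    have := hu.le_reflect hF hf hg hc he (a := (s + t) / 2) (by linarith) (x := t)
      (by linarith) y
    have e : t + 2 * (x₀ - (s + t) / 2) = x₀ - (s - x₀) := by ring
    rw [e, ← he] at this
    simpa using this
  have hnonpos : ∀ x y, x₀ < x → pdx u x y ≤ 0 := fun x y hx => by
    have h1 := (hanti y).derivWithin_nonpos (x := x)
    rwa [derivWithin_of_mem_nhds (Ioi_mem_nhds hx)] at h1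
  refine lt_of_le_of_ne (hnonpos x y hx) fun h0 => ?_
  have hlx := hu.reg.linx
  have hz := hlx.c2.neg.eq_zero_of_preconnected (c := c) (L := L) (isOpen_fst_gt x₀)
    (isPreconnected_fst_gt x₀) hf.nb.pos.le (fun q hq => by
      have h1 := hnonpos q.1 q.2 hq
      refine ⟨neg_nonneg.2 h1, ?_⟩
      rw [hlx.c2.lop_neg, hlx.eq]
      have h2 := (abs_le.1 (hf.nb.bd' _ (hu.reg.le_one q.1 q.2))).2
      have h3 := mul_le_mul_of_nonpos_right h2 h1
      linarith) (p₀ := (x, y)) hx (by simpa using h0)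
  have hconst : ∀ t y, x₀ + 1 ≤ t → u t y = u (x₀ + 1) y := fun t y ht =>
    constant_of_has_deriv_right_zero (a := x₀ + 1) (b := t) (f := fun s => u s y)
      (fun s _ => (hu.reg.reg.c2.dx s y).continuousAt.continuousWithinAt)
      (fun s hs => by
        have h1 := (hu.reg.reg.c2.dx s y).hasDerivWithinAt (s := Set.Ici s)
        have h2 := hz (s, y) (show x₀ < s by linarith [hs.1])
        rwa [neg_eq_zero.1 h2] at h1) t ⟨ht, le_rfl⟩
  obtain ⟨b, hb⟩ := hu.exists_hasPhase hf hg
  have h1 : Tendsto (fun x => u x (0 + m * x)) atTop (nhds 1) := by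
    have h2 := (hu.reg.top (x₀ + 1)).comp (tendsto_atTop_add_const_left _ 0
      (tendsto_id.const_mul_atTop hu.m_pos))
    exact h2.congr' ((eventually_ge_atTop (x₀ + 1)).mono fun t ht => (hconst t _ ht).symm)
  have h2 := tendsto_nhds_unique (hb 0) h1
  exact ((hg.planar_front m).lt_one 0 (0 + b)).ne h2

end Sliding

theorem isPlanar_of_eq_planar {g : ℝ → ℝ} {c c₀ θ b : ℝ} {u : ℝ → ℝ → ℝ} (hc₀ : 0 < c₀)
    (hc : c = c₀ * √(1 + θ ^ 2)) (hu : ∀ x y, u x y = planar g θ x (y + b)) :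
    IsPlanar g (Real.arccos (c₀ / c)) u := by
  have hs := sqrt_one_add_sq_pos θ
  have hsq : √(1 + θ ^ 2) ^ 2 = 1 + θ ^ 2 := Real.sq_sqrt (by positivity)
  have h1 : c₀ / c = 1 / √(1 + θ ^ 2) := by
    rw [hc]
    field_simp
  have h2 : 1 / √(1 + θ ^ 2) ≤ 1 := by
    rw [div_le_one hs, Real.one_le_sqrt]
    nlinarith [sq_nonneg θ]
  have hcos : Real.cos (Real.arccos (c₀ / c)) = 1 / √(1 + θ ^ 2) := by
    rw [h1, Real.cos_arccos (by linarith [one_div_pos.2 hs]) h2]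
  have hsin : Real.sin (Real.arccos (c₀ / c)) = |θ| / √(1 + θ ^ 2) := by
    have h3 : 1 - (1 / √(1 + θ ^ 2)) ^ 2 = (|θ| / √(1 + θ ^ 2)) ^ 2 := by
      rw [div_pow, div_pow, hsq, sq_abs]
      field_simp
      ring
    rw [h1, Real.sin_arccos, h3, Real.sqrt_sq (by positivity)]
  obtain ⟨ε, hε, hθ⟩ : ∃ ε : ℝ, (ε = 1 ∨ ε = -1) ∧ ε * |θ| = -θ := by
    rcases abs_cases θ with ⟨h, -⟩ | ⟨h, -⟩
    · exact ⟨-1, Or.inr rfl, by rw [h]; ring⟩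
    · exact ⟨1, Or.inl rfl, by rw [h]; ring⟩
  refine ⟨ε, hε, b / √(1 + θ ^ 2), fun x y => ?_⟩
  rw [hu, planar, hcos, hsin]
  congr 1
  have h3 : y * (1 / √(1 + θ ^ 2)) + ε * x * (|θ| / √(1 + θ ^ 2)) + b / √(1 + θ ^ 2)
      = (y + (ε * |θ|) * x + b) / √(1 + θ ^ 2) := by ring
  rw [h3, hθ]
  ring

/-- A planar wave cannot be even and strictly decreasing to the right of its axis. -/
theorem IsPlanar.not_even_decreasing {g : ℝ → ℝ} {α x₀ : ℝ} {u : ℝ → ℝ → ℝ}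
    (hg : StrictMono g) (hu : IsPlanar g α u) (he : ∀ x y, u (x₀ + x) y = u (x₀ - x) y)
    (hd : ∀ x y, x₀ < x → pdx u x y < 0) : False := by
  obtain ⟨ε, hε, b, hu⟩ := hu
  have h1 := he 1 0
  rw [hu, hu] at h1
  have h2 := hg.injective h1
  have h3 : ε * Real.sin α = 0 := by linarith
  have h4 : ∀ x y, u x y = g (y * Real.cos α + b) := fun x y => by
    rw [hu]
    congr 1
    linear_combination x * h3
  have h5 := hd (x₀ + 1) 0 (by linarith)
  simp [pdx, h4] at h5

/-- Classification of monotone traveling wave solutions of the unbalanced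
Allen-Cahn equation in the plane (Theorem 3.2): the speed satisfies `c ≥ c₀`
and `u` is either planar or the (unique up to translation) even `V`-shaped
traveling wave. -/
theorem classification_unbalanced_traveling_waves
    (F : ℝ → ℝ) (hF : UnbalancedDoubleWell F)
    (c₀ : ℝ) (hc₀ : 0 < c₀) (g : ℝ → ℝ) (hg : ContDiff ℝ 3 g)
    (hgeq : ∀ s : ℝ, deriv (deriv g) s + c₀ * deriv g s = deriv F (g s))
    (hgtop : Tendsto g atTop (nhds 1)) (hgbot : Tendsto g atBot (nhds (-1)))
    (hg0 : g 0 = 0) (hgmono : StrictMono g)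
    (c : ℝ) (hc : 0 < c)
    (u : ℝ → ℝ → ℝ) (hu : IsTravelingWave F c u) :
    c₀ ≤ c ∧
    Xor' (IsPlanar g (Real.arccos (c₀ / c)) u)
      (∃ x₀ : ℝ, (∀ x y : ℝ, u (x₀ + x) y = u (x₀ - x) y) ∧
        (∀ x y : ℝ, x₀ < x → pdx u x y < 0) ∧
        ∀ v : ℝ → ℝ → ℝ, IsTravelingWave F c v →
          ¬ IsPlanar g (Real.arccos (c₀ / c)) v →
          ∃ a b : ℝ, ∀ x y : ℝ, v x y = u (x + a) (y + b)) := by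
  obtain ⟨L, ε, β, hf⟩ := hF.exists_wells
  have hp : Profile (deriv F) c₀ g := ⟨hc₀, hg, hgeq, hgtop, hgbot, hg0, hgmono⟩
  rcases hu.planar_or_vWave hF hf hp hc.le with ⟨θ, b, hθ, hb⟩ | ⟨m, K, hV⟩
  · have hpl := isPlanar_of_eq_planar hc₀ hθ hb
    refine ⟨?_, Or.inl ⟨hpl, ?_⟩⟩
    · rw [hθ]
      exact le_mul_of_one_le_right hc₀.le
        (Real.one_le_sqrt.2 (le_add_of_nonneg_right (sq_nonneg θ)))
    · rintro ⟨x₀, he, hd, -⟩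
      exact hpl.not_even_decreasing hgmono he hd
  · obtain ⟨x₀, he⟩ := hV.exists_even hF hf hp hc.le
    have hd : ∀ x y : ℝ, x₀ < x → pdx u x y < 0 := fun x y hx =>
      hV.pdx_neg hF hf hp hc.le he hx y
    refine ⟨(hV.speed_lt hp).le, Or.inr ⟨⟨x₀, he, hd, fun v hv hnp => ?_⟩,
      fun hpl => hpl.not_even_decreasing hgmono he hd⟩⟩
    rcases hv.planar_or_vWave hF hf hp hc.le with ⟨θ, b, hθ, hb⟩ | ⟨m', K', hV'⟩
    · exact absurd (isPlanar_of_eq_planar hc₀ hθ hb) hnp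
    · have hm : m' = m := by
        have := hp.sq_eq_of_speed hV'.speed hV.speed
        exact (sq_eq_sq₀ hV'.m_pos.le hV.m_pos.le).1 this
      subst hm
      exact hV.eq_shift hF hf hp hc.le hV'
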